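/- arXiv:1902.01381 — 3 statements merged into one kernel-verified Lean document; each statement's English description precedes it below -/
import Mathlib

section
/- Let N be a positive integer and let μ be the G-invariant Borel probability measure on X_N = G/Γ_N. Let {r_t}_{t∈ℕ} ⊂ [1,∞). If ∑_{t=1}^∞ Ψ_Δ(r_t) = ∞, where Ψ_Δ(T) = μ({x ∈ X_N : Δ(x) ≥ T}), then for μ-almost every x ∈ X_N there exist infinitely many t ∈ ℕ such that Δ(a(t)x) ≥ r_t. -/
open Matrix MeasureTheory

section setup

variable (ι : Type*) [Fintype ι] [DecidableEq ι]

/-- `SL(ι, R)` acts on `ι → R` by matrix-vector multiplication. -/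
instance slVecAction (R : Type*) [CommRing R] :
    MulAction (Matrix.SpecialLinearGroup ι R) (ι → R) where
  smul g v := g.1.mulVec v
  one_smul v := show (1 : Matrix.SpecialLinearGroup ι R).1.mulVec v = v by simp
  mul_smul g h v := show (g * h).1.mulVec v = g.1.mulVec (h.1.mulVec v) by
    simp [Matrix.SpecialLinearGroup.coe_mul, Matrix.mulVec_mulVec]

/-- The congruence subgroup `{γ ∈ SL(ι,ℤ) : γ e ≡ e (mod N)}`, realized as the
preimage of the stabilizer of `e` under reduction `SL(ι,ℤ) → SL(ι, ZMod N)`. -/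
def congruenceStabilizer (N : ℕ) (e : ι → ZMod N) :
    Subgroup (Matrix.SpecialLinearGroup ι ℤ) :=
  (MulAction.stabilizer (Matrix.SpecialLinearGroup ι (ZMod N)) e).comap
    (Matrix.SpecialLinearGroup.map (Int.castRingHom (ZMod N)))

/-- The congruence subgroup `Γ_N ≤ SL(ι,ℝ)`: the image in `SL(ι,ℝ)` of
`{γ ∈ SL(ι,ℤ) : γ e ≡ e (mod N)}`. -/
def congruenceSubgroupR (N : ℕ) (e : ι → ZMod N) :
    Subgroup (Matrix.SpecialLinearGroup ι ℝ) :=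
  (congruenceStabilizer ι N e).map (Matrix.SpecialLinearGroup.map (Int.castRingHom ℝ))

instance : TopologicalSpace (Matrix.SpecialLinearGroup ι ℝ) :=
  inferInstanceAs (TopologicalSpace {A : Matrix ι ι ℝ // A.det = 1})

instance : MeasurableSpace (Matrix.SpecialLinearGroup ι ℝ) :=
  borel (Matrix.SpecialLinearGroup ι ℝ)

end setup

/-- The first standard basis vector `e₁` of `(ZMod N)^{m+n}`. -/
def stdE1Mod (m n N : ℕ) : Fin m ⊕ Fin n → ZMod N :=
  Sum.elim (fun i => if (i : ℕ) = 0 then 1 else 0) 0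

/-- The function `Δ(gΓ_N) = sup {log 1/‖h e₁‖ : h ∈ g Γ_N}` on `X_N`,
where `‖·‖` is the maximum norm on `ℝ^{m+n}`. -/
noncomputable def DeltaCusp (m n N : ℕ)
    (x : Matrix.SpecialLinearGroup (Fin m ⊕ Fin n) ℝ ⧸
      congruenceSubgroupR (Fin m ⊕ Fin n) N (stdE1Mod m n N)) : ℝ :=
  sSup {ρ : ℝ | ∃ h : Matrix.SpecialLinearGroup (Fin m ⊕ Fin n) ℝ,
    QuotientGroup.mk h = x ∧
    ρ = Real.log ‖h.1.mulVec (Sum.elim (fun i => if (i : ℕ) = 0 then (1:ℝ) else 0) 0)‖⁻¹}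

/-- `a(t) = diag(e^{t/m},…,e^{t/m},e^{-t/n},…,e^{-t/n})` as an element of `SL(m+n,ℝ)`. -/
noncomputable def aFlowStd (m n : ℕ) (hm : 0 < m) (hn : 0 < n) (t : ℝ) :
    Matrix.SpecialLinearGroup (Fin m ⊕ Fin n) ℝ :=
  ⟨Matrix.diagonal (Sum.elim (fun _ => Real.exp (t / m)) (fun _ => Real.exp (-(t / n)))), by
    rw [Matrix.det_diagonal, Fintype.prod_sum_type]
    simp only [Sum.elim_inl, Sum.elim_inr, Finset.prod_const, Finset.card_univ,
      Fintype.card_fin, ← Real.exp_nat_mul, ← Real.exp_add]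
    rw [show (m : ℝ) * (t / m) + (n : ℝ) * -(t / n) = 0 by
      field_simp; ring, Real.exp_zero]⟩

section CuspExcursions

open Set Filter Topology Metric
open scoped ENNReal

section space

variable {ι : Type*} [Fintype ι] [DecidableEq ι]

instance : BorelSpace (Matrix.SpecialLinearGroup ι ℝ) := ⟨rfl⟩

instance : IsTopologicalGroup (Matrix.SpecialLinearGroup ι ℝ) :=
  Matrix.SpecialLinearGroup.topologicalGroup

instance : PolishSpace (Matrix.SpecialLinearGroup ι ℝ) := by
  have h : IsClosed {A : Matrix ι ι ℝ | A.det = 1} :=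
    isClosed_eq (continuous_id.matrix_det) continuous_const
  have : PolishSpace (Matrix ι ι ℝ) := inferInstanceAs (PolishSpace (ι → ι → ℝ))
  exact h.polishSpace

/-- The orbit `{h e : h ∈ gΓ}` attached to a point `x = gΓ`. -/
def cosetVectors (Γ : Subgroup (Matrix.SpecialLinearGroup ι ℝ)) (e : ι → ℝ)
    (x : Matrix.SpecialLinearGroup ι ℝ ⧸ Γ) : Set (ι → ℝ) :=
  {v | ∃ h : Matrix.SpecialLinearGroup ι ℝ, QuotientGroup.mk h = x ∧ v = h.1.mulVec e}

/-- A subgroup of `SL(ι, ℝ)` all of whose elements have integral entries. -/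
def IsIntegralSubgroup (Γ : Subgroup (Matrix.SpecialLinearGroup ι ℝ)) : Prop :=
  ∀ γ ∈ Γ, ∃ M : Matrix ι ι ℤ, γ.1 = M.map (Int.cast : ℤ → ℝ)

lemma IsIntegralSubgroup.isClosed {Γ : Subgroup (Matrix.SpecialLinearGroup ι ℝ)}
    (hΓ : IsIntegralSubgroup Γ) : IsClosed (Γ : Set (Matrix.SpecialLinearGroup ι ℝ)) := by
  have hemb : IsClosedEmbedding (fun M : ι → ι → ℤ => fun i j => (M i j : ℝ)) := by
    refine IsClosedEmbedding.piMap (f := fun (_ : ι) (r : ι → ℤ) => fun j => (r j : ℝ)) fun _ => ?_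
    exact IsClosedEmbedding.piMap (f := fun (_ : ι) (r : ℤ) => (r : ℝ))
      fun _ => Int.isClosedEmbedding_coe_real
  have hcl : IsClosed ((fun M : ι → ι → ℤ => fun i j => (M i j : ℝ)) ''
      {M | ∃ γ ∈ Γ, γ.1 = fun i j => (M i j : ℝ)}) := hemb.isClosedMap _ (isClosed_discrete _)
  have hc : Continuous (fun g : Matrix.SpecialLinearGroup ι ℝ => (g.1 : ι → ι → ℝ)) :=
    continuous_subtype_val
  convert hcl.preimage hc using 1
  ext g
  simp only [SetLike.mem_coe]
  constructor
  · intro hg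
    obtain ⟨M, hM⟩ := hΓ g hg
    exact ⟨M, ⟨g, hg, hM⟩, hM.symm⟩
  · rintro ⟨M, ⟨γ, hγ, h1⟩, h2⟩
    have : g = γ := Subtype.ext (h2.symm.trans h1.symm)
    rwa [this]

lemma IsIntegralSubgroup.countable {Γ : Subgroup (Matrix.SpecialLinearGroup ι ℝ)}
    (hΓ : IsIntegralSubgroup Γ) : Countable Γ := by
  have : Countable (Matrix ι ι ℤ) := inferInstanceAs (Countable (ι → ι → ℤ))
  choose f hf using hΓ
  refine Function.Injective.countable (f := fun γ : Γ => f γ.1 γ.2) fun a b hab => ?_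
  apply Subtype.ext
  apply Subtype.ext
  rw [hf a.1 a.2, hf b.1 b.2]
  exact congrArg (fun M : Matrix ι ι ℤ => M.map (Int.cast : ℤ → ℝ)) hab

variable {Γ : Subgroup (Matrix.SpecialLinearGroup ι ℝ)} {e : ι → ℝ}

lemma mulVec_mem_cosetVectors (g : Matrix.SpecialLinearGroup ι ℝ)
    {x : Matrix.SpecialLinearGroup ι ℝ ⧸ Γ} {v : ι → ℝ} (hv : v ∈ cosetVectors Γ e x) :
    g.1.mulVec v ∈ cosetVectors Γ e (g • x) := by
  obtain ⟨h, rfl, rfl⟩ := hv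
  exact ⟨g * h, rfl, by simp [Matrix.SpecialLinearGroup.coe_mul, Matrix.mulVec_mulVec]⟩

lemma exists_of_mem_cosetVectors_smul (g : Matrix.SpecialLinearGroup ι ℝ)
    {x : Matrix.SpecialLinearGroup ι ℝ ⧸ Γ} {v : ι → ℝ} (hv : v ∈ cosetVectors Γ e (g • x)) :
    ∃ w ∈ cosetVectors Γ e x, v = g.1.mulVec w := by
  refine ⟨g⁻¹.1.mulVec v, ?_, ?_⟩
  · simpa using mulVec_mem_cosetVectors g⁻¹ hv
  · rw [Matrix.mulVec_mulVec, ← Matrix.SpecialLinearGroup.coe_mul]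
    simp

lemma cosetVectors_mk (g : Matrix.SpecialLinearGroup ι ℝ) :
    cosetVectors Γ e (QuotientGroup.mk g) =
      (fun w => g.1.mulVec w) '' {w | ∃ γ ∈ Γ, w = γ.1.mulVec e} := by
  ext v
  constructor
  · rintro ⟨h, hh, rfl⟩
    refine ⟨(g⁻¹ * h).1.mulVec e, ⟨g⁻¹ * h, QuotientGroup.eq.1 hh.symm, rfl⟩, ?_⟩
    simp only [Matrix.mulVec_mulVec, ← Matrix.SpecialLinearGroup.coe_mul, mul_inv_cancel_left]
  · rintro ⟨w, ⟨γ, hγ, rfl⟩, rfl⟩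
    refine ⟨g * γ, ?_, by simp [Matrix.SpecialLinearGroup.coe_mul, Matrix.mulVec_mulVec]⟩
    exact QuotientGroup.mk_mul_of_mem g hγ

lemma specialLinear_mulVec_injective (g : Matrix.SpecialLinearGroup ι ℝ) :
    Function.Injective (fun w : ι → ℝ => g.1.mulVec w) := by
  intro a b hab
  have := congrArg (fun w => g⁻¹.1.mulVec w) hab
  simpa only [Matrix.mulVec_mulVec, ← Matrix.SpecialLinearGroup.coe_mul, inv_mul_cancel,
    Matrix.SpecialLinearGroup.coe_one, Matrix.one_mulVec] using this

lemma exists_lattice_of_cosetVectors (hΓ : IsIntegralSubgroup Γ)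
    (he : ∃ z : ι → ℤ, e = fun i => (z i : ℝ)) (he0 : e ≠ 0)
    (x : Matrix.SpecialLinearGroup ι ℝ ⧸ Γ) :
    ∃ g : Matrix.SpecialLinearGroup ι ℝ, ∀ v ∈ cosetVectors Γ e x,
      v ≠ 0 ∧ ∃ z : ι → ℤ, v = g.1.mulVec (fun i => (z i : ℝ)) := by
  obtain ⟨g, rfl⟩ := QuotientGroup.mk_surjective x
  refine ⟨g, fun v hv => ⟨?_, ?_⟩⟩
  · obtain ⟨h, -, rfl⟩ := hv
    intro h0
    exact he0 (specialLinear_mulVec_injective h (by simpa using h0))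
  · rw [cosetVectors_mk] at hv
    obtain ⟨w, ⟨γ, hγ, rfl⟩, rfl⟩ := hv
    obtain ⟨M, hM⟩ := hΓ γ hγ
    obtain ⟨z, rfl⟩ := he
    refine ⟨M.mulVec z, ?_⟩
    congr 1
    rw [hM]
    ext i
    simp [Matrix.mulVec, dotProduct]

lemma continuous_mulVec_prod :
    Continuous fun p : Matrix.SpecialLinearGroup ι ℝ × (ι → ℝ) => p.1.1.mulVec p.2 :=
  Continuous.matrix_mulVec (continuous_subtype_val.comp continuous_fst) continuous_snd

lemma borelSpace_quotient (hΓ : IsIntegralSubgroup Γ) :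
    BorelSpace (Matrix.SpecialLinearGroup ι ℝ ⧸ Γ) := by
  have : IsClosed (Γ : Set (Matrix.SpecialLinearGroup ι ℝ)) := hΓ.isClosed
  have : T0Space (Quotient (QuotientGroup.leftRel Γ)) :=
    inferInstanceAs (T0Space (Matrix.SpecialLinearGroup ι ℝ ⧸ Γ))
  have : SecondCountableTopology (Quotient (QuotientGroup.leftRel Γ)) :=
    inferInstanceAs (SecondCountableTopology (Matrix.SpecialLinearGroup ι ℝ ⧸ Γ))
  exact Quotient.borelSpace (s := QuotientGroup.leftRel Γ)

lemma measurable_smul_quotient (hΓ : IsIntegralSubgroup Γ) {E : Type*} [TopologicalSpace E]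
    [SecondCountableTopology E] [MeasurableSpace E] [BorelSpace E]
    {f : E → Matrix.SpecialLinearGroup ι ℝ} (hf : Continuous f) :
    Measurable fun p : (Matrix.SpecialLinearGroup ι ℝ ⧸ Γ) × E => f p.2 • p.1 := by
  have := borelSpace_quotient hΓ
  have : Continuous fun p : (Matrix.SpecialLinearGroup ι ℝ ⧸ Γ) × E => f p.2 • p.1 :=
    (hf.comp continuous_snd).smul continuous_fst
  exact this.measurable

lemma measurable_tsum_cosetVectors (hΓ : IsIntegralSubgroup Γ) {E : Type*} [MeasurableSpace E]
    [StandardBorelSpace E]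
    {f : ((Matrix.SpecialLinearGroup ι ℝ ⧸ Γ) × E) × (ι → ℝ) → ℝ≥0∞} (hf : Measurable f) :
    Measurable fun p : (Matrix.SpecialLinearGroup ι ℝ ⧸ Γ) × E =>
      ∑' v : cosetVectors Γ e p.1, f (p, v) := by
  have := borelSpace_quotient hΓ
  have : IsClosed (Γ : Set (Matrix.SpecialLinearGroup ι ℝ)) := hΓ.isClosed
  have := hΓ.countable
  have hq : Measurable fun p : Matrix.SpecialLinearGroup ι ℝ × E =>
      ((QuotientGroup.mk p.1 : Matrix.SpecialLinearGroup ι ℝ ⧸ Γ), p.2) :=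
    (QuotientGroup.continuous_mk.measurable.comp measurable_fst).prodMk measurable_snd
  have hs : Function.Surjective fun p : Matrix.SpecialLinearGroup ι ℝ × E =>
      ((QuotientGroup.mk p.1 : Matrix.SpecialLinearGroup ι ℝ ⧸ Γ), p.2) := by
    rintro ⟨x, y⟩
    obtain ⟨g, rfl⟩ := QuotientGroup.mk_surjective x
    exact ⟨(g, y), rfl⟩
  rw [← hq.measurable_comp_iff_of_surjective hs]
  have hcount : Countable {w : ι → ℝ | ∃ γ ∈ Γ, w = γ.1.mulVec e} := by
    have : {w : ι → ℝ | ∃ γ ∈ Γ, w = γ.1.mulVec e} = range fun γ : Γ => γ.1.1.mulVec e := by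
      ext w; simp [eq_comm]
    rw [this]
    exact (countable_range _).to_subtype
  have : ((fun p : (Matrix.SpecialLinearGroup ι ℝ ⧸ Γ) × E =>
      ∑' v : cosetVectors Γ e p.1, f (p, v)) ∘ fun p : Matrix.SpecialLinearGroup ι ℝ × E =>
      ((QuotientGroup.mk p.1 : Matrix.SpecialLinearGroup ι ℝ ⧸ Γ), p.2)) =
      fun p => ∑' w : {w : ι → ℝ | ∃ γ ∈ Γ, w = γ.1.mulVec e},
        f (((QuotientGroup.mk p.1 : Matrix.SpecialLinearGroup ι ℝ ⧸ Γ), p.2), p.1.1.mulVec w) := by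
    funext p
    simp only [Function.comp]
    rw [cosetVectors_mk]
    exact tsum_image
      (fun v => f (((QuotientGroup.mk p.1 : Matrix.SpecialLinearGroup ι ℝ ⧸ Γ), p.2), v))
      (specialLinear_mulVec_injective p.1).injOn
  rw [this]
  refine Measurable.tsum fun w => ?_
  refine hf.comp (hq.prodMk ?_)
  exact (continuous_mulVec_prod.measurable).comp (measurable_fst.prodMk measurable_const)

lemma measurableSet_exists_cosetVectors (hΓ : IsIntegralSubgroup Γ) {E : Type*} [MeasurableSpace E]
    [StandardBorelSpace E] {B : Set (((Matrix.SpecialLinearGroup ι ℝ ⧸ Γ) × E) × (ι → ℝ))}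
    (hB : MeasurableSet B) :
    MeasurableSet {p : (Matrix.SpecialLinearGroup ι ℝ ⧸ Γ) × E |
      ∃ v ∈ cosetVectors Γ e p.1, (p, v) ∈ B} := by
  have h := measurable_tsum_cosetVectors (e := e) hΓ (f := B.indicator 1)
    (measurable_one.indicator hB)
  convert (h (measurableSet_singleton 0)).compl using 1
  ext p
  simp [ENNReal.tsum_eq_zero]

lemma measurableSet_exists_cosetVectors' (hΓ : IsIntegralSubgroup Γ)
    {B : Set (ι → ℝ)} (hB : MeasurableSet B) :
    MeasurableSet {x : Matrix.SpecialLinearGroup ι ℝ ⧸ Γ | ∃ v ∈ cosetVectors Γ e x, v ∈ B} := by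
  have h := measurableSet_exists_cosetVectors (e := e) hΓ (E := Unit) (B := Prod.snd ⁻¹' B)
    (measurable_snd hB)
  exact (measurable_id.prodMk measurable_const : Measurable fun x => (x, ())) h

end space

section lattice

variable {ι : Type*} [Fintype ι] [DecidableEq ι]

/-- Points of a unimodular lattice in a ball of large radius `R` number at most `(4R)^d`,
where the threshold for `R` depends on the lattice. -/
lemma exists_encard_lattice_le (g : Matrix.SpecialLinearGroup ι ℝ) :
    ∃ R₀ : ℝ, ∀ R ≥ R₀, ∀ S : Set (ι → ℝ),
      (∀ v ∈ S, ‖v‖ ≤ R ∧ ∃ z : ι → ℤ, v = g.1.mulVec (fun i => (z i : ℝ))) →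
      (S.encard : ℝ≥0∞) ≤ ENNReal.ofReal ((4 * R) ^ Fintype.card ι) := by
  let L : (ι → ℝ) →L[ℝ] (ι → ℝ) := LinearMap.toContinuousLinearMap (Matrix.mulVecLin g.1)
  have hL : ∀ y, L y = g.1.mulVec y := fun y => rfl
  refine ⟨max ‖L‖ 0, fun R hR S hS => ?_⟩
  have hR0 : 0 ≤ R := (le_max_right _ _).trans hR
  have hRL : ‖L‖ ≤ R := (le_max_left _ _).trans hR
  have hgg : ∀ y, g.1.mulVec (g⁻¹.1.mulVec y) = y := fun y => by
    rw [Matrix.mulVec_mulVec, ← Matrix.SpecialLinearGroup.coe_mul, mul_inv_cancel,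
      Matrix.SpecialLinearGroup.coe_one, Matrix.one_mulVec]
  have hgg' : ∀ y, g⁻¹.1.mulVec (g.1.mulVec y) = y := fun y => by
    rw [Matrix.mulVec_mulVec, ← Matrix.SpecialLinearGroup.coe_mul, inv_mul_cancel,
      Matrix.SpecialLinearGroup.coe_one, Matrix.one_mulVec]
  have hScount : S.Countable := by
    refine (countable_range fun z : ι → ℤ => g.1.mulVec (fun i => (z i : ℝ))).mono fun v hv => ?_
    obtain ⟨z, hz⟩ := (hS v hv).2
    exact ⟨z, hz.symm⟩
  have : Countable S := hScount.to_subtype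
  let Q : Set (ι → ℝ) := Set.pi univ fun _ => Ico (0 : ℝ) 1
  have hQm : MeasurableSet Q := MeasurableSet.univ_pi fun _ => measurableSet_Ico
  have hQv : volume Q = 1 := by simp [Q, volume_pi_pi]
  have hinv : Measurable fun y : ι → ℝ => Matrix.mulVecLin g⁻¹.1 y :=
    (LinearMap.continuous_of_finiteDimensional _).measurable
  let C : S → Set (ι → ℝ) := fun v => (fun y => y - v.1) ⁻¹' ((Matrix.mulVecLin g⁻¹.1) ⁻¹' Q)
  have hCm : ∀ v, MeasurableSet (C v) := fun v => (measurable_id.sub_const _) (hinv hQm)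
  have hCv : ∀ v, volume (C v) = 1 := by
    intro v
    have hdet : LinearMap.det (Matrix.mulVecLin g⁻¹.1) = 1 := by
      have := LinearMap.det_toLin' g⁻¹.1
      rw [g⁻¹.2] at this
      exact this
    simp only [C]
    simp only [sub_eq_add_neg]
    rw [measure_preimage_add_right, Measure.addHaar_preimage_linearMap _ (by rw [hdet]; simp),
      hdet, hQv]
    simp
  have hdisj : Pairwise (Function.onFun Disjoint C) := by
    intro v w hvw
    rw [Function.onFun, Set.disjoint_left]
    intro y hy hy'
    apply hvw
    obtain ⟨z, hz⟩ := (hS v v.2).2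
    obtain ⟨z', hz'⟩ := (hS w w.2).2
    simp only [C, Q, mem_preimage, Matrix.mulVecLin_apply, Matrix.mulVec_sub, hz, hz', hgg',
      Set.mem_pi, mem_univ,
      true_imp_iff, Pi.sub_apply, mem_Ico] at hy hy'
    have : z = z' := by
      funext i
      have h1 := hy i
      have h2 := hy' i
      have h3 : ⌊(g⁻¹.1.mulVec y) i⌋ = z i := Int.floor_eq_iff.2 ⟨by linarith, by linarith⟩
      have h4 : ⌊(g⁻¹.1.mulVec y) i⌋ = z' i := Int.floor_eq_iff.2 ⟨by linarith, by linarith⟩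
      exact h3.symm.trans h4
    apply Subtype.ext
    rw [hz, hz', this]
  have hsub : (⋃ v, C v) ⊆ closedBall (0 : ι → ℝ) (2 * R) := by
    refine iUnion_subset fun v y hy => ?_
    rw [mem_closedBall_zero_iff]
    have h1 : y = v.1 + L (g⁻¹.1.mulVec (y - v.1)) := by
      rw [hL, hgg]; abel
    have h2 : ‖g⁻¹.1.mulVec (y - v.1)‖ ≤ 1 := by
      rw [pi_norm_le_iff_of_nonneg zero_le_one]
      intro i
      have := hy i (mem_univ i)
      simp only [Matrix.mulVecLin_apply, mem_Ico] at this
      rw [Real.norm_eq_abs, abs_le]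
      exact ⟨by linarith, by linarith⟩
    rw [h1]
    calc _ ≤ ‖v.1‖ + ‖L (g⁻¹.1.mulVec (y - v.1))‖ := norm_add_le _ _
      _ ≤ R + ‖L‖ * 1 := by
        gcongr
        · exact (hS v v.2).1
        · exact (L.le_opNorm _).trans (by gcongr)
      _ ≤ 2 * R := by linarith
  calc (S.encard : ℝ≥0∞) = ∑' v : S, volume (C v) := by
        simp only [hCv]; exact (ENNReal.tsum_set_one S).symm
    _ = volume (⋃ v, C v) := (measure_iUnion hdisj hCm).symm
    _ ≤ volume (closedBall (0 : ι → ℝ) (2 * R)) := measure_mono hsub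
    _ = _ := by rw [Real.volume_pi_closedBall _ (by linarith)]; ring_nf

variable {Γ : Subgroup (Matrix.SpecialLinearGroup ι ℝ)} {e : ι → ℝ}

lemma exists_encard_cosetVectors_le (hΓ : IsIntegralSubgroup Γ)
    (he : ∃ z : ι → ℤ, e = fun i => (z i : ℝ)) (he0 : e ≠ 0)
    (x : Matrix.SpecialLinearGroup ι ℝ ⧸ Γ) :
    ∃ R₀ : ℝ, ∀ R ≥ R₀, ((cosetVectors Γ e x ∩ closedBall 0 R).encard : ℝ≥0∞) ≤
      ENNReal.ofReal ((4 * R) ^ Fintype.card ι) := by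
  obtain ⟨g, hg⟩ := exists_lattice_of_cosetVectors hΓ he he0 x
  obtain ⟨R₀, h⟩ := exists_encard_lattice_le g
  exact ⟨R₀, fun R hR => h R hR _ fun v hv => ⟨mem_closedBall_zero_iff.1 hv.2, (hg v hv.1).2⟩⟩

lemma finite_cosetVectors_inter (hΓ : IsIntegralSubgroup Γ)
    (he : ∃ z : ι → ℤ, e = fun i => (z i : ℝ)) (he0 : e ≠ 0)
    (x : Matrix.SpecialLinearGroup ι ℝ ⧸ Γ) (R : ℝ) :
    (cosetVectors Γ e x ∩ closedBall 0 R).Finite := by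
  obtain ⟨R₀, h⟩ := exists_encard_cosetVectors_le hΓ he he0 x
  have h1 := h (max R R₀) (le_max_right _ _)
  have h2 : (cosetVectors Γ e x ∩ closedBall 0 (max R R₀)).Finite := by
    rw [← Set.encard_ne_top_iff]
    intro h3
    rw [h3] at h1
    exact absurd h1 (by simp)
  exact h2.subset (inter_subset_inter_right _ (closedBall_subset_closedBall (le_max_left _ _)))

lemma exists_pos_le_norm_cosetVectors (hΓ : IsIntegralSubgroup Γ)
    (he : ∃ z : ι → ℤ, e = fun i => (z i : ℝ)) (he0 : e ≠ 0)
    (x : Matrix.SpecialLinearGroup ι ℝ ⧸ Γ) :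
    ∃ κ > 0, ∀ v ∈ cosetVectors Γ e x, κ ≤ ‖v‖ := by
  have hfin := finite_cosetVectors_inter hΓ he he0 x 1
  obtain ⟨g, hg⟩ := exists_lattice_of_cosetVectors hΓ he he0 x
  rcases (cosetVectors Γ e x ∩ closedBall 0 1).eq_empty_or_nonempty with h | h
  · refine ⟨1, one_pos, fun v hv => ?_⟩
    by_contra! hlt
    have : v ∈ cosetVectors Γ e x ∩ closedBall 0 1 := ⟨hv, mem_closedBall_zero_iff.2 hlt.le⟩
    rw [h] at this
    exact this
  · obtain ⟨v₀, hv₀, hmin⟩ := hfin.exists_minimalFor (fun v => ‖v‖) _ h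
    refine ⟨‖v₀‖, norm_pos_iff.2 (hg v₀ hv₀.1).1, fun v hv => ?_⟩
    by_contra! hlt
    have h1 : ‖v₀‖ ≤ 1 := mem_closedBall_zero_iff.1 hv₀.2
    have := hmin ⟨hv, mem_closedBall_zero_iff.2 (hlt.le.trans h1)⟩ hlt.le
    exact absurd this (not_le.2 hlt)

end lattice

section congruence

/-- The first standard basis vector of `ℝ^{m+n}`. -/
noncomputable def stdE1 (m n : ℕ) : Fin m ⊕ Fin n → ℝ :=
  Sum.elim (fun i => if (i : ℕ) = 0 then (1:ℝ) else 0) 0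

lemma stdE1_eq_single {m n : ℕ} (hm : 0 < m) :
    stdE1 m n = Pi.single (Sum.inl ⟨0, hm⟩) 1 := by
  ext k
  rcases k with k | k
  · simp [stdE1, Pi.single_apply, Fin.ext_iff]
  · simp [stdE1]

lemma stdE1_ne_zero {m n : ℕ} (hm : 0 < m) : stdE1 m n ≠ 0 := by
  rw [stdE1_eq_single hm]
  simp

lemma exists_int_stdE1 (m n : ℕ) : ∃ z : Fin m ⊕ Fin n → ℤ, stdE1 m n = fun i => (z i : ℝ) := by
  refine ⟨Sum.elim (fun i => if (i : ℕ) = 0 then 1 else 0) 0, ?_⟩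
  ext k
  rcases k with k | k <;> simp [stdE1]

lemma isIntegralSubgroup_congruenceSubgroupR {ι : Type*} [Fintype ι] [DecidableEq ι] (N : ℕ)
    (e : ι → ZMod N) : IsIntegralSubgroup (congruenceSubgroupR ι N e) := by
  rintro γ ⟨A, -, rfl⟩
  exact ⟨A.1, rfl⟩

variable {m n N : ℕ}

/-- The vectors attached to a point of `X_N`. -/
abbrev cuspVectors (m n N : ℕ) (x : Matrix.SpecialLinearGroup (Fin m ⊕ Fin n) ℝ ⧸
    congruenceSubgroupR (Fin m ⊕ Fin n) N (stdE1Mod m n N)) : Set (Fin m ⊕ Fin n → ℝ) :=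
  cosetVectors (congruenceSubgroupR (Fin m ⊕ Fin n) N (stdE1Mod m n N)) (stdE1 m n) x

lemma exists_norm_le_of_le_DeltaCusp {x : Matrix.SpecialLinearGroup (Fin m ⊕ Fin n) ℝ ⧸
    congruenceSubgroupR (Fin m ⊕ Fin n) N (stdE1Mod m n N)} (hm : 0 < m) {r : ℝ}
    (h : r ≤ DeltaCusp m n N x) : ∃ v ∈ cuspVectors m n N x, ‖v‖ ≤ Real.exp (1 - r) := by
  obtain ⟨g, rfl⟩ := QuotientGroup.mk_surjective x
  obtain ⟨ρ, ⟨h', hx, rfl⟩, hlt⟩ := exists_lt_of_lt_csSup (b := r - 1)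
    (s := {ρ : ℝ | ∃ h : Matrix.SpecialLinearGroup (Fin m ⊕ Fin n) ℝ,
      QuotientGroup.mk h = QuotientGroup.mk g ∧
      ρ = Real.log ‖h.1.mulVec (stdE1 m n)‖⁻¹}) ⟨_, g, rfl, rfl⟩
      (lt_of_lt_of_le (by linarith) h)
  have hpos : 0 < ‖h'.1.mulVec (stdE1 m n)‖ := by
    rw [norm_pos_iff]
    intro h0
    exact stdE1_ne_zero hm (specialLinear_mulVec_injective h' (by simpa using h0))
  refine ⟨_, ⟨h', hx, rfl⟩, ?_⟩
  rw [Real.log_inv] at hlt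
  rw [← Real.log_le_iff_le_exp hpos]
  linarith

lemma le_DeltaCusp {x : Matrix.SpecialLinearGroup (Fin m ⊕ Fin n) ℝ ⧸
    congruenceSubgroupR (Fin m ⊕ Fin n) N (stdE1Mod m n N)} (hm : 0 < m) {r : ℝ}
    (h : ∃ v ∈ cuspVectors m n N x, ‖v‖ ≤ Real.exp (-r)) : r ≤ DeltaCusp m n N x := by
  obtain ⟨κ, hκ, hκv⟩ := exists_pos_le_norm_cosetVectors
    (isIntegralSubgroup_congruenceSubgroupR N (stdE1Mod m n N)) (exists_int_stdE1 m n)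
    (stdE1_ne_zero hm) x
  obtain ⟨v, ⟨g, hg, rfl⟩, hv⟩ := h
  have hpos := hκ.trans_le (hκv _ ⟨g, hg, rfl⟩)
  refine le_trans ?_ (le_csSup (a := Real.log ‖g.1.mulVec (stdE1 m n)‖⁻¹) ?_ ⟨g, hg, rfl⟩)
  · rw [Real.log_inv]
    have := (Real.log_le_iff_le_exp hpos).2 hv
    linarith
  · refine ⟨Real.log κ⁻¹, ?_⟩
    rintro _ ⟨h, hh, rfl⟩
    have h1 := hκv _ ⟨h, hh, rfl⟩
    rw [Real.log_inv, Real.log_inv, neg_le_neg_iff]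
    exact Real.log_le_log hκ h1

lemma exists_cuspVectors_apply_ne_zero (hm : 0 < m) (hN : 0 < N)
    (x : Matrix.SpecialLinearGroup (Fin m ⊕ Fin n) ℝ ⧸
    congruenceSubgroupR (Fin m ⊕ Fin n) N (stdE1Mod m n N)) (j : Fin m ⊕ Fin n) :
    ∃ v ∈ cuspVectors m n N x, v j ≠ 0 := by
  obtain ⟨g, rfl⟩ := QuotientGroup.mk_surjective x
  by_contra! hcon
  rw [cuspVectors, cosetVectors_mk, stdE1_eq_single hm] at hcon
  set i0 : Fin m ⊕ Fin n := Sum.inl ⟨0, hm⟩ with hi0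
  have h0 : g.1 j i0 = 0 := by
    have := hcon _ ⟨_, ⟨1, one_mem _, rfl⟩, rfl⟩
    have h1 : (g.1.mulVec ((1 : Matrix (Fin m ⊕ Fin n) (Fin m ⊕ Fin n) ℝ).mulVec
        (Pi.single i0 1))) j = 0 := this
    rw [Matrix.one_mulVec, Matrix.mulVec_single_one] at h1
    exact h1
  have hk : ∀ k, g.1 j k = 0 := by
    intro k
    by_cases hki : k = i0
    · rw [hki, h0]
    let A : Matrix.SpecialLinearGroup (Fin m ⊕ Fin n) ℤ :=
      ⟨Matrix.transvection k i0 (N : ℤ), Matrix.det_transvection_of_ne _ _ hki _⟩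
    have hA : A ∈ congruenceStabilizer (Fin m ⊕ Fin n) N (stdE1Mod m n N) := by
      have : Matrix.SpecialLinearGroup.map (Int.castRingHom (ZMod N)) A = 1 := by
        ext a b
        change ((Matrix.transvection k i0 (N : ℤ) a b : ℤ) : ZMod N) =
          (1 : Matrix (Fin m ⊕ Fin n) (Fin m ⊕ Fin n) (ZMod N)) a b
        simp [Matrix.transvection, Matrix.add_apply, Matrix.one_apply, Matrix.single_apply]
      rw [congruenceStabilizer, Subgroup.mem_comap, this]
      exact one_mem _
    have := hcon _ ⟨_, ⟨_, ⟨A, hA, rfl⟩, rfl⟩, rfl⟩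
    have hval : (Matrix.SpecialLinearGroup.map (Int.castRingHom ℝ) A).1 =
        Matrix.transvection k i0 (N : ℝ) := by
      ext a b
      change ((Matrix.transvection k i0 (N : ℤ) a b : ℤ) : ℝ) = _
      simp [Matrix.transvection, Matrix.add_apply, Matrix.one_apply,
        Matrix.single_apply]
    change (g.1.mulVec ((Matrix.SpecialLinearGroup.map (Int.castRingHom ℝ) A).1.mulVec
      (Pi.single i0 1))) j = 0 at this
    rw [hval, Matrix.transvection, Matrix.add_mulVec, Matrix.one_mulVec, Matrix.mulVec_add,
      Pi.add_apply, Matrix.mulVec_single_one, Matrix.col_apply, h0, zero_add,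
      Matrix.single_mulVec, Pi.single_eq_same, mul_one] at this
    rw [show Function.update (0 : Fin m ⊕ Fin n → ℝ) k (N : ℝ) = Pi.single k (N : ℝ) from rfl,
      Matrix.mulVec_single, Pi.smul_apply, Matrix.col_apply] at this
    have hN' : (N : ℝ) ≠ 0 := by exact_mod_cast hN.ne'
    simpa [hN'] using this
  have hdet := g.2
  rw [Matrix.det_eq_zero_of_row_eq_zero j hk] at hdet
  exact zero_ne_one hdet

end congruence

section elements

variable {ι : Type*} [Fintype ι] [DecidableEq ι]

/-- The shear `v ↦ v + v_j α` (the `j`-th coordinate of `α` is ignored). -/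
noncomputable def shear (j : ι) (α : ι → ℝ) : Matrix.SpecialLinearGroup ι ℝ :=
  ⟨1 + Matrix.vecMulVec (Function.update α j 0) (Pi.single j 1), by
    rw [Matrix.vecMulVec_eq Unit, Matrix.det_one_add_replicateCol_mul_replicateRow]
    simp⟩

lemma shear_mulVec (j : ι) (α v : ι → ℝ) :
    (shear j α).1.mulVec v = v + v j • Function.update α j 0 := by
  ext k
  simp [shear, Matrix.add_mulVec, Matrix.vecMulVec_mulVec]

lemma continuous_shear (j : ι) : Continuous (shear (ι := ι) j) := by
  refine Continuous.subtype_mk ?_ _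
  refine continuous_const.add ?_
  exact Continuous.matrix_vecMulVec (continuous_id.update j continuous_const) continuous_const

/-- The diagonal matrix expanding the coordinate `i` by `K ^ (d - 1)` and contracting the other
ones by `K`. -/
noncomputable def axisDiag (i : ι) (K : ℝ) (hK : K ≠ 0) : Matrix.SpecialLinearGroup ι ℝ :=
  ⟨Matrix.diagonal fun k => if k = i then K ^ (Fintype.card ι - 1) else K⁻¹, by
    rw [Matrix.det_diagonal, ← Finset.mul_prod_erase _ _ (Finset.mem_univ i), if_pos rfl,
      Finset.prod_congr rfl (g := fun _ => K⁻¹) fun k hk => if_neg (Finset.ne_of_mem_erase hk),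
      Finset.prod_const, Finset.card_erase_of_mem (Finset.mem_univ i), Finset.card_univ,
      ← mul_pow, mul_inv_cancel₀ hK, one_pow]⟩

lemma axisDiag_mulVec_self (i : ι) (K : ℝ) (hK : K ≠ 0) (v : ι → ℝ) :
    (axisDiag i K hK).1.mulVec v i = K ^ (Fintype.card ι - 1) * v i := by
  simp [axisDiag, Matrix.mulVec_diagonal]

lemma axisDiag_mulVec_of_ne {i k : ι} (hk : k ≠ i) (K : ℝ) (hK : K ≠ 0) (v : ι → ℝ) :
    (axisDiag i K hK).1.mulVec v k = K⁻¹ * v k := by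
  simp [axisDiag, Matrix.mulVec_diagonal, hk]

end elements

section invariant

variable {ι : Type*} [Fintype ι] [DecidableEq ι]
  {Γ : Subgroup (Matrix.SpecialLinearGroup ι ℝ)} {e : ι → ℝ}
  {μ : Measure (Matrix.SpecialLinearGroup ι ℝ ⧸ Γ)}

lemma measurable_smul_quotient_const (hΓ : IsIntegralSubgroup Γ)
    (g : Matrix.SpecialLinearGroup ι ℝ) :
    Measurable fun x : Matrix.SpecialLinearGroup ι ℝ ⧸ Γ => g • x := by
  have h := measurable_smul_quotient hΓ (E := ℝ) (f := fun _ => g) continuous_const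
  exact h.comp (measurable_id.prodMk (measurable_const (a := (0 : ℝ))))

lemma measure_smul_mem (hΓ : IsIntegralSubgroup Γ)
    (hμ : ∀ g : Matrix.SpecialLinearGroup ι ℝ, Measure.map (fun x => g • x) μ = μ)
    (g : Matrix.SpecialLinearGroup ι ℝ) {A : Set (Matrix.SpecialLinearGroup ι ℝ ⧸ Γ)}
    (hA : MeasurableSet A) : μ {x | g • x ∈ A} = μ A := by
  conv_rhs => rw [← hμ g]
  rw [Measure.map_apply (measurable_smul_quotient_const hΓ g) hA]
  rfl

lemma lintegral_smul_quotient (hΓ : IsIntegralSubgroup Γ)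
    (hμ : ∀ g : Matrix.SpecialLinearGroup ι ℝ, Measure.map (fun x => g • x) μ = μ)
    (g : Matrix.SpecialLinearGroup ι ℝ) {F : Matrix.SpecialLinearGroup ι ℝ ⧸ Γ → ℝ≥0∞}
    (hF : Measurable F) : ∫⁻ x, F (g • x) ∂μ = ∫⁻ x, F x ∂μ := by
  conv_rhs => rw [← hμ g]
  rw [lintegral_map hF (measurable_smul_quotient_const hΓ g)]

lemma lintegral_lintegral_smul_quotient [SFinite μ] (hΓ : IsIntegralSubgroup Γ)
    (hμ : ∀ g : Matrix.SpecialLinearGroup ι ℝ, Measure.map (fun x => g • x) μ = μ)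
    {E : Type*} [TopologicalSpace E] [SecondCountableTopology E] [MeasurableSpace E] [BorelSpace E]
    {f : E → Matrix.SpecialLinearGroup ι ℝ} (hf : Continuous f) (ν : Measure E) [SFinite ν]
    {F : Matrix.SpecialLinearGroup ι ℝ ⧸ Γ → ℝ≥0∞} (hF : Measurable F) :
    ∫⁻ x, ∫⁻ a, F (f a • x) ∂ν ∂μ = (∫⁻ x, F x ∂μ) * ν univ := by
  rw [lintegral_lintegral_swap]
  · simp_rw [lintegral_smul_quotient hΓ hμ _ hF]
    simp
  · exact (hF.comp (measurable_smul_quotient hΓ hf)).aemeasurable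

lemma lintegral_measure_smul_mem [SFinite μ] (hΓ : IsIntegralSubgroup Γ)
    (hμ : ∀ g : Matrix.SpecialLinearGroup ι ℝ, Measure.map (fun x => g • x) μ = μ)
    {E : Type*} [TopologicalSpace E] [SecondCountableTopology E] [MeasurableSpace E] [BorelSpace E]
    {f : E → Matrix.SpecialLinearGroup ι ℝ} (hf : Continuous f) (ν : Measure E) [SFinite ν]
    {A : Set (Matrix.SpecialLinearGroup ι ℝ ⧸ Γ)} (hA : MeasurableSet A) :
    ∫⁻ x, ν {a | f a • x ∈ A} ∂μ = μ A * ν univ := by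
  have h := lintegral_lintegral_smul_quotient hΓ hμ hf ν (measurable_one.indicator hA)
  rw [lintegral_indicator_one hA] at h
  rw [← h]
  refine lintegral_congr fun x => ?_
  have hm : MeasurableSet {a | f a • x ∈ A} :=
    ((measurable_smul_quotient hΓ hf).comp (measurable_const.prodMk measurable_id)) hA
  rw [← lintegral_indicator_one hm]
  rfl

end invariant

section slab

variable {ι : Type*} [Fintype ι]

/-- Vectors with a small coordinate `i₀`, whose other coordinates are dominated by the `i`-th. -/
def slab (i₀ i : ι) (δ : ℝ) : Set (ι → ℝ) :=
  {v | |v i₀| ≤ δ ∧ 1 / 2 < |v i| ∧ ∀ k, k ≠ i₀ → |v k| ≤ 1}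

lemma measurableSet_slab (i₀ i : ι) (δ : ℝ) : MeasurableSet (slab i₀ i δ) := by
  unfold slab
  measurability

end slab

section firstMoment

variable {ι : Type*} [Fintype ι] [DecidableEq ι]
  {Γ : Subgroup (Matrix.SpecialLinearGroup ι ℝ)} {e : ι → ℝ}
  {μ : Measure (Matrix.SpecialLinearGroup ι ℝ ⧸ Γ)} [IsProbabilityMeasure μ]

lemma shear_single_mulVec_self {i₀ i : ι} (hi : i ≠ i₀) (a : ℝ) (v : ι → ℝ) :
    (shear i (Pi.single i₀ a)).1.mulVec v i₀ = v i₀ + v i * a := by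
  rw [shear_mulVec]
  simp [hi.symm]

lemma shear_single_mulVec_of_ne {i₀ i k : ι} (hk : k ≠ i₀) (a : ℝ) (v : ι → ℝ) :
    (shear i (Pi.single i₀ a)).1.mulVec v k = v k := by
  rw [shear_mulVec]
  by_cases h : k = i
  · subst h; simp
  · simp [hk, h]

lemma mem_slab_iff {i₀ i : ι} (hi : i ≠ i₀) {δ K : ℝ} (hK : 0 < K) (a : ℝ) (v : ι → ℝ) :
    (axisDiag i₀ K hK.ne').1.mulVec ((shear i (Pi.single i₀ a)).1.mulVec v) ∈ slab i₀ i δ ↔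
      K ^ (Fintype.card ι - 1) * |v i₀ + v i * a| ≤ δ ∧ K / 2 < |v i| ∧
        ∀ k, k ≠ i₀ → |v k| ≤ K := by
  unfold slab
  rw [mem_ofPred_eq, axisDiag_mulVec_self, shear_single_mulVec_self hi, abs_mul,
    abs_of_pos (pow_pos hK _), axisDiag_mulVec_of_ne hi, shear_single_mulVec_of_ne hi, abs_mul,
    abs_of_pos (inv_pos.2 hK)]
  refine and_congr_right fun _ => and_congr ?_ (forall_congr' fun k => forall_congr' fun hk => ?_)
  · rw [inv_mul_eq_div, lt_div_iff₀ hK, one_div, inv_mul_eq_div]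
  · rw [axisDiag_mulVec_of_ne hk, shear_single_mulVec_of_ne hk, abs_mul,
      abs_of_pos (inv_pos.2 hK), inv_mul_eq_div, div_le_one hK]

lemma volume_slab_le {i₀ i : ι} (hi : i ≠ i₀) {δ : ℝ} {K : ℝ} (hK : 0 < K)
    (v : ι → ℝ) :
    volume {a : ℝ | (axisDiag i₀ K hK.ne').1.mulVec
      ((shear i (Pi.single i₀ a)).1.mulVec v) ∈ slab i₀ i δ} ≤
      ENNReal.ofReal (4 * δ * (K ^ Fintype.card ι)⁻¹) := by
  have hcard : K ^ Fintype.card ι = K ^ (Fintype.card ι - 1) * K := by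
    rw [← pow_succ, Nat.sub_add_cancel (Fintype.card_pos_iff.2 ⟨i⟩)]
  have hP : 0 < K ^ (Fintype.card ι - 1) := pow_pos hK _
  have hsub : {a : ℝ | (axisDiag i₀ K hK.ne').1.mulVec
      ((shear i (Pi.single i₀ a)).1.mulVec v) ∈ slab i₀ i δ} ⊆
      closedBall (-(v i₀ / v i)) (2 * δ * (K ^ Fintype.card ι)⁻¹) := by
    intro a ha
    obtain ⟨h1, h2, -⟩ := (mem_slab_iff hi hK a v).1 ha
    have hv : 0 < |v i| := (half_pos hK).trans h2
    have hv0 : v i ≠ 0 := abs_pos.1 hv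
    have h3 : |v i₀ + v i * a| = |v i| * |a - -(v i₀ / v i)| := by
      rw [← abs_mul]; congr 1; field_simp; ring
    rw [mem_closedBall, Real.dist_eq, hcard, ← div_eq_mul_inv, le_div_iff₀ (by positivity)]
    rw [h3] at h1
    have h4 : K ^ (Fintype.card ι - 1) * (K / 2 * |a - -(v i₀ / v i)|) ≤ δ :=
      le_trans (by gcongr) h1
    linarith
  refine (measure_mono hsub).trans ?_
  rw [Real.volume_closedBall]
  exact ENNReal.ofReal_le_ofReal (by linarith)

lemma norm_le_of_mem_slab {i₀ i : ι} (hi : i ≠ i₀) {δ K : ℝ} (hδ : δ ≤ 1) (hK : 1 ≤ K)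
    {a : ℝ} (ha : a ∈ Icc (0 : ℝ) 1) {v : ι → ℝ}
    (h : (axisDiag i₀ K (by positivity)).1.mulVec
      ((shear i (Pi.single i₀ a)).1.mulVec v) ∈ slab i₀ i δ) : ‖v‖ ≤ 2 * K := by
  have hK0 : 0 < K := by positivity
  obtain ⟨h1, h2, h3⟩ := (mem_slab_iff hi hK0 a v).1 h
  rw [pi_norm_le_iff_of_nonneg (by positivity)]
  intro k
  rw [Real.norm_eq_abs]
  by_cases hk : k = i₀
  · subst hk
    have h4 : |v k + v i * a| ≤ 1 := by
      refine le_trans ?_ (h1.trans hδ)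
      exact le_mul_of_one_le_left (abs_nonneg _) (one_le_pow₀ hK)
    have h5 : |v i * a| ≤ K := by
      rw [abs_mul, abs_of_nonneg ha.1]
      exact (mul_le_of_le_one_right (abs_nonneg _) ha.2).trans (h3 i hi)
    calc |v k| = |(v k + v i * a) - v i * a| := by ring_nf
      _ ≤ |v k + v i * a| + |v i * a| := abs_sub _ _
      _ ≤ 2 * K := by linarith
  · exact (h3 k hk).trans (by linarith)

lemma eventually_volume_slab_le (hΓ : IsIntegralSubgroup Γ)
    (he : ∃ z : ι → ℤ, e = fun i => (z i : ℝ)) (he0 : e ≠ 0)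
    {i₀ i : ι} (hi : i ≠ i₀) {δ : ℝ} (hδ : δ ≤ 1) (x : Matrix.SpecialLinearGroup ι ℝ ⧸ Γ) :
    ∀ᶠ k : ℕ in atTop, volume.restrict (Icc (0 : ℝ) 1) {a : ℝ |
      (axisDiag i₀ ((k : ℝ) + 1) (by positivity) * shear i (Pi.single i₀ a)) • x ∈
        {y | ∃ v ∈ cosetVectors Γ e y, v ∈ slab i₀ i δ}} ≤
      ENNReal.ofReal (4 * 8 ^ Fintype.card ι * δ) := by
  obtain ⟨R₀, hR₀⟩ := exists_encard_cosetVectors_le hΓ he he0 x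
  obtain ⟨k₀, hk₀⟩ := exists_nat_ge R₀
  filter_upwards [eventually_ge_atTop k₀] with k hk
  have hk' : (k₀ : ℝ) ≤ k := by exact_mod_cast hk
  set K : ℝ := (k : ℝ) + 1 with hKdef
  have hK1 : 1 ≤ K := by rw [hKdef]; linarith [(Nat.cast_nonneg k : (0:ℝ) ≤ k)]
  have hK0 : 0 < K := by positivity
  have hcount := hR₀ (2 * K) (by linarith)
  set S := cosetVectors Γ e x ∩ closedBall 0 (2 * K) with hS
  have hfin : S.Finite := finite_cosetVectors_inter hΓ he he0 x _
  have : Countable S := hfin.countable.to_subtype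
  have hsub : {a : ℝ | (axisDiag i₀ K hK0.ne' * shear i (Pi.single i₀ a)) • x ∈
        {y | ∃ v ∈ cosetVectors Γ e y, v ∈ slab i₀ i δ}} ∩ Icc 0 1 ⊆
      ⋃ v : S, {a : ℝ | (axisDiag i₀ K hK0.ne').1.mulVec
        ((shear i (Pi.single i₀ a)).1.mulVec v) ∈ slab i₀ i δ} := by
    rintro a ⟨⟨v, hv, hvs⟩, ha⟩
    obtain ⟨w, hw, rfl⟩ := exists_of_mem_cosetVectors_smul _ hv
    rw [Matrix.SpecialLinearGroup.coe_mul, ← Matrix.mulVec_mulVec] at hvs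
    exact mem_iUnion.2 ⟨⟨w, hw, mem_closedBall_zero_iff.2
      (norm_le_of_mem_slab hi hδ hK1 ha hvs)⟩, hvs⟩
  rw [Measure.restrict_apply' measurableSet_Icc]
  calc _ ≤ ∑' v : S, volume {a : ℝ | (axisDiag i₀ K hK0.ne').1.mulVec
        ((shear i (Pi.single i₀ a)).1.mulVec v) ∈ slab i₀ i δ} :=
        (measure_mono hsub).trans (measure_iUnion_le _)
    _ ≤ ∑' v : S, ENNReal.ofReal (4 * δ * (K ^ Fintype.card ι)⁻¹) :=
        ENNReal.tsum_le_tsum fun v => volume_slab_le hi hK0 v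
    _ = S.encard * ENNReal.ofReal (4 * δ * (K ^ Fintype.card ι)⁻¹) := by
        rw [ENNReal.tsum_const]; rfl
    _ ≤ ENNReal.ofReal ((4 * (2 * K)) ^ Fintype.card ι) *
          ENNReal.ofReal (4 * δ * (K ^ Fintype.card ι)⁻¹) := by gcongr
    _ = _ := by
        rw [← ENNReal.ofReal_mul (by positivity)]
        congr 1
        rw [show 4 * (2 * K) = 8 * K by ring, mul_pow]
        field_simp

lemma measure_slab_le (hΓ : IsIntegralSubgroup Γ)
    (he : ∃ z : ι → ℤ, e = fun i => (z i : ℝ)) (he0 : e ≠ 0)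
    (hμ : ∀ g : Matrix.SpecialLinearGroup ι ℝ, Measure.map (fun x => g • x) μ = μ)
    {i₀ i : ι} (hi : i ≠ i₀) {δ : ℝ} (hδ : δ ≤ 1) :
    μ {x | ∃ v ∈ cosetVectors Γ e x, v ∈ slab i₀ i δ} ≤
      ENNReal.ofReal (4 * 8 ^ Fintype.card ι * δ) := by
  set A := {x | ∃ v ∈ cosetVectors Γ e x, v ∈ slab i₀ i δ} with hA
  have hAm : MeasurableSet A := measurableSet_exists_cosetVectors' hΓ (measurableSet_slab _ _ _)
  have hc : ∀ k : ℕ, Continuous fun a : ℝ =>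
      axisDiag i₀ ((k : ℝ) + 1) (by positivity) * shear i (Pi.single i₀ a) := fun k =>
    continuous_const.mul ((continuous_shear i).comp (continuous_single (A := fun _ : ι => ℝ) i₀))
  let ψ : ℕ → Matrix.SpecialLinearGroup ι ℝ ⧸ Γ → ℝ≥0∞ := fun k x =>
    volume.restrict (Icc (0 : ℝ) 1) {a : ℝ |
      (axisDiag i₀ ((k : ℝ) + 1) (by positivity) * shear i (Pi.single i₀ a)) • x ∈ A}
  have hψ : ∀ k, ∫⁻ x, ψ k x ∂μ = μ A := fun k => by
    rw [lintegral_measure_smul_mem hΓ hμ (hc k) _ hAm]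
    simp
  have hψm : ∀ k, Measurable (ψ k) := fun k =>
    measurable_measure_prodMk_left ((measurable_smul_quotient hΓ (hc k)) hAm)
  have hlim := limsup_lintegral_le (μ := μ) (f := ψ) (fun _ => 1) hψm (fun k => ae_of_all _ fun x =>
    (measure_mono (subset_univ _)).trans (by simp)) (by simp)
  simp only [hψ, limsup_const] at hlim
  refine hlim.trans ?_
  calc _ ≤ ∫⁻ x, ENNReal.ofReal (4 * 8 ^ Fintype.card ι * δ) ∂μ := by
        refine lintegral_mono fun x => limsup_le_of_le ?_ ?_
        · isBoundedDefault
        · exact eventually_volume_slab_le hΓ he he0 hi hδ x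
    _ = _ := by simp

lemma measure_scaled_slab_le (hΓ : IsIntegralSubgroup Γ)
    (he : ∃ z : ι → ℤ, e = fun i => (z i : ℝ)) (he0 : e ≠ 0)
    (hμ : ∀ g : Matrix.SpecialLinearGroup ι ℝ, Measure.map (fun x => g • x) μ = μ)
    {i₀ i : ι} (hi : i ≠ i₀) {ε : ℝ} (hε0 : 0 < ε) (hε : ε ≤ 1) (k : ℕ) :
    μ {x | ∃ v ∈ cosetVectors Γ e x, |v i₀| ≤ ε ∧ ε * (1 / 2) ^ (k + 1) < |v i| ∧
      ∀ l, l ≠ i₀ → |v l| ≤ ε * (1 / 2) ^ k} ≤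
      ENNReal.ofReal (4 * 8 ^ Fintype.card ι * ε ^ Fintype.card ι) * (2⁻¹) ^ k := by
  set s : ℝ := ε * (1 / 2) ^ k with hs
  have hs0 : 0 < s := by positivity
  have hsε : s ≤ ε := mul_le_of_le_one_right hε0.le (pow_le_one₀ (by norm_num) (by norm_num))
  have hs1 : s ≤ 1 := hsε.trans hε
  set δ : ℝ := s ^ (Fintype.card ι - 1) * ε with hδ
  have hδ1 : δ ≤ 1 := mul_le_one₀ (pow_le_one₀ hs0.le hs1) hε0.le hε
  set A := {x | ∃ v ∈ cosetVectors Γ e x, v ∈ slab i₀ i δ} with hA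
  have hAm : MeasurableSet A := measurableSet_exists_cosetVectors' hΓ (measurableSet_slab _ _ _)
  have hsub : {x | ∃ v ∈ cosetVectors Γ e x, |v i₀| ≤ ε ∧ ε * (1 / 2) ^ (k + 1) < |v i| ∧
      ∀ l, l ≠ i₀ → |v l| ≤ s} ⊆ {x | axisDiag i₀ s hs0.ne' • x ∈ A} := by
    rintro x ⟨v, hv, h1, h2, h3⟩
    refine ⟨_, mulVec_mem_cosetVectors (axisDiag i₀ s hs0.ne') hv, ?_, ?_, ?_⟩
    · rw [axisDiag_mulVec_self, abs_mul, abs_of_pos (pow_pos hs0 _)]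
      exact mul_le_mul_of_nonneg_left h1 (by positivity)
    · rw [axisDiag_mulVec_of_ne hi, abs_mul, abs_of_pos (inv_pos.2 hs0), inv_mul_eq_div,
        lt_div_iff₀ hs0, hs]
      rw [pow_succ] at h2
      linarith
    · intro l hl
      rw [axisDiag_mulVec_of_ne hl, abs_mul, abs_of_pos (inv_pos.2 hs0), inv_mul_eq_div,
        div_le_one hs0]
      exact h3 l hl
  have hcard : 2 ≤ Fintype.card ι := Fintype.one_lt_card_iff.2 ⟨i, i₀, hi⟩
  calc _ ≤ μ {x | axisDiag i₀ s hs0.ne' • x ∈ A} := measure_mono hsub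
    _ = μ A := measure_smul_mem hΓ hμ _ hAm
    _ ≤ ENNReal.ofReal (4 * 8 ^ Fintype.card ι * δ) := measure_slab_le hΓ he he0 hμ hi hδ1
    _ ≤ ENNReal.ofReal (4 * 8 ^ Fintype.card ι * ε ^ Fintype.card ι * (1 / 2) ^ k) := by
        refine ENNReal.ofReal_le_ofReal ?_
        rw [mul_assoc (4 * 8 ^ Fintype.card ι : ℝ)]
        have h8 : (0 : ℝ) ≤ 4 * 8 ^ Fintype.card ι := by positivity
        refine mul_le_mul_of_nonneg_left ?_ h8
        calc δ = s ^ (Fintype.card ι - 2) * s * ε := by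
              rw [hδ, ← pow_succ]; congr 2; omega
          _ ≤ ε ^ (Fintype.card ι - 2) * s * ε := by gcongr
          _ = ε ^ (Fintype.card ι - 2 + 2) * (1 / 2) ^ k := by rw [hs]; ring
          _ = _ := by rw [Nat.sub_add_cancel hcard]
    _ = _ := by
        rw [ENNReal.ofReal_mul (by positivity), ENNReal.ofReal_pow (by norm_num)]
        congr 2
        rw [one_div, ENNReal.ofReal_inv_of_pos (by norm_num)]
        simp

lemma tendsto_measure_exists_norm_le (hΓ : IsIntegralSubgroup Γ)
    (he : ∃ z : ι → ℤ, e = fun i => (z i : ℝ)) (he0 : e ≠ 0) :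
    Tendsto (fun l : ℕ => μ {x | ∃ v ∈ cosetVectors Γ e x, ‖v‖ ≤ ((l : ℝ) + 1)⁻¹}) atTop
      (𝓝 0) := by
  set A : ℕ → Set (Matrix.SpecialLinearGroup ι ℝ ⧸ Γ) :=
    fun l => {x | ∃ v ∈ cosetVectors Γ e x, ‖v‖ ≤ ((l : ℝ) + 1)⁻¹} with hA
  have hm : ∀ l, MeasurableSet (A l) := fun l =>
    measurableSet_exists_cosetVectors' hΓ (B := {v | ‖v‖ ≤ ((l : ℝ) + 1)⁻¹})
      (measurableSet_le measurable_norm measurable_const)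
  have hanti : Antitone A := by
    rintro a b hab x ⟨v, hv, hle⟩
    refine ⟨v, hv, hle.trans ?_⟩
    have : (a : ℝ) ≤ b := by exact_mod_cast hab
    gcongr
  have hempty : ⋂ l, A l = ∅ := by
    rw [eq_empty_iff_forall_notMem]
    intro x hx
    obtain ⟨κ, hκ, h⟩ := exists_pos_le_norm_cosetVectors hΓ he he0 x
    obtain ⟨l, hl⟩ := exists_nat_one_div_lt hκ
    obtain ⟨v, hv, hle⟩ := mem_iInter.1 hx l
    have := h v hv
    rw [one_div] at hl
    linarith
  have := tendsto_measure_iInter_atTop (μ := μ) (fun l => (hm l).nullMeasurableSet) hanti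
    ⟨0, measure_ne_top _ _⟩
  rwa [hempty, measure_empty] at this

lemma measure_axis_eq_zero (hΓ : IsIntegralSubgroup Γ)
    (he : ∃ z : ι → ℤ, e = fun i => (z i : ℝ)) (he0 : e ≠ 0)
    (hμ : ∀ g : Matrix.SpecialLinearGroup ι ℝ, Measure.map (fun x => g • x) μ = μ)
    {i₀ i : ι} (hi : i ≠ i₀) :
    μ {x | ∃ v ∈ cosetVectors Γ e x, ‖v‖ ≤ 1 ∧ ∀ k, k ≠ i₀ → v k = 0} = 0 := by
  refine le_antisymm (ge_of_tendsto' (tendsto_measure_exists_norm_le (μ := μ) hΓ he he0)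
    fun l => ?_) zero_le
  have hK : ((l : ℝ) + 1)⁻¹ ≠ 0 := by positivity
  have hK1 : ((l : ℝ) + 1)⁻¹ ≤ 1 := inv_le_one_of_one_le₀
    (by linarith [(Nat.cast_nonneg l : (0 : ℝ) ≤ l)])
  rw [← measure_smul_mem hΓ hμ (axisDiag i₀ _ hK)
    (A := {x | ∃ v ∈ cosetVectors Γ e x, ‖v‖ ≤ ((l : ℝ) + 1)⁻¹})
    (measurableSet_exists_cosetVectors' hΓ (B := {v | ‖v‖ ≤ ((l : ℝ) + 1)⁻¹})
      (measurableSet_le measurable_norm measurable_const))]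
  refine measure_mono ?_
  rintro x ⟨v, hv, h1, h2⟩
  refine ⟨_, mulVec_mem_cosetVectors (axisDiag i₀ _ hK) hv, ?_⟩
  rw [pi_norm_le_iff_of_nonneg (by positivity)]
  intro k
  by_cases hk : k = i₀
  · subst hk
    have hcard : 2 ≤ Fintype.card ι := Fintype.one_lt_card_iff.2 ⟨i, k, hi⟩
    rw [axisDiag_mulVec_self, norm_mul, Real.norm_of_nonneg (by positivity)]
    calc _ ≤ ((l : ℝ) + 1)⁻¹ ^ (Fintype.card ι - 1) * 1 := by
          gcongr
          exact (norm_le_pi_norm v k).trans h1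
      _ ≤ _ := by
          rw [mul_one]
          exact pow_le_of_le_one (by positivity) hK1 (by omega)
  · rw [axisDiag_mulVec_of_ne hk, h2 k hk]
    simp only [mul_zero, norm_zero]
    positivity

/-- The measure of the set of points with a vector of norm at most `ε` is `O(ε ^ d)`. -/
lemma measure_exists_norm_le (hΓ : IsIntegralSubgroup Γ)
    (he : ∃ z : ι → ℤ, e = fun i => (z i : ℝ)) (he0 : e ≠ 0)
    (hμ : ∀ g : Matrix.SpecialLinearGroup ι ℝ, Measure.map (fun x => g • x) μ = μ)
    [Nontrivial ι] {ε : ℝ} (hε0 : 0 < ε) (hε : ε ≤ 1) :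
    μ {x | ∃ v ∈ cosetVectors Γ e x, ‖v‖ ≤ ε} ≤
      Fintype.card ι * (ENNReal.ofReal (4 * 8 ^ Fintype.card ι * ε ^ Fintype.card ι) * 2) := by
  obtain ⟨i₀, i₁, hi₀₁⟩ := exists_pair_ne ι
  set E : {i // i ≠ i₀} → ℕ → Set (Matrix.SpecialLinearGroup ι ℝ ⧸ Γ) := fun i k =>
    {x | ∃ v ∈ cosetVectors Γ e x, |v i₀| ≤ ε ∧ ε * (1 / 2) ^ (k + 1) < |v i| ∧
      ∀ l, l ≠ i₀ → |v l| ≤ ε * (1 / 2) ^ k} with hE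
  set Z := {x | ∃ v ∈ cosetVectors Γ e x, ‖v‖ ≤ 1 ∧ ∀ k, k ≠ i₀ → v k = 0} with hZ
  have hsub : {x | ∃ v ∈ cosetVectors Γ e x, ‖v‖ ≤ ε} ⊆ Z ∪ ⋃ i, ⋃ k, E i k := by
    rintro x ⟨v, hv, hle⟩
    by_cases h0 : ∀ k, k ≠ i₀ → v k = 0
    · exact Or.inl ⟨v, hv, hle.trans hε, h0⟩
    right
    push Not at h0
    obtain ⟨k₀, hk₀, hvk⟩ := h0
    obtain ⟨i, -, hmax⟩ := Finset.exists_max_image (Finset.univ : Finset {i // i ≠ i₀})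
      (fun i => |v i|) ⟨⟨k₀, hk₀⟩, Finset.mem_univ _⟩
    have hpos : 0 < |v i| := (abs_pos.2 hvk).trans_le (hmax ⟨k₀, hk₀⟩ (Finset.mem_univ _))
    have hvi : ∀ k, |v k| ≤ ε := fun k => (norm_le_pi_norm v k).trans hle
    obtain ⟨k, hk1, hk2⟩ := exists_nat_pow_near_of_lt_one (x := |v i| / ε) (y := 1 / 2)
      (by positivity) ((div_le_one hε0).2 (hvi i)) (by norm_num) (by norm_num)
    rw [lt_div_iff₀ hε0, mul_comm] at hk1
    rw [div_le_iff₀ hε0, mul_comm] at hk2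
    exact mem_iUnion.2 ⟨i, mem_iUnion.2 ⟨k, v, hv, hvi i₀, hk1,
      fun l hl => (hmax ⟨l, hl⟩ (Finset.mem_univ _)).trans hk2⟩⟩
  calc _ ≤ μ Z + μ (⋃ i, ⋃ k, E i k) := (measure_mono hsub).trans (measure_union_le _ _)
    _ ≤ 0 + ∑' i : {i // i ≠ i₀}, ∑' k : ℕ, μ (E i k) := by
        rw [hZ, measure_axis_eq_zero hΓ he he0 hμ hi₀₁.symm]
        gcongr
        exact (measure_iUnion_le _).trans (ENNReal.tsum_le_tsum fun i => measure_iUnion_le _)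
    _ ≤ ∑' i : {i // i ≠ i₀}, ∑' k : ℕ,
        ENNReal.ofReal (4 * 8 ^ Fintype.card ι * ε ^ Fintype.card ι) * (2⁻¹) ^ k := by
        rw [zero_add]
        exact ENNReal.tsum_le_tsum fun i => ENNReal.tsum_le_tsum fun k =>
          measure_scaled_slab_le hΓ he he0 hμ i.2 hε0 hε k
    _ = ∑' i : {i // i ≠ i₀},
        ENNReal.ofReal (4 * 8 ^ Fintype.card ι * ε ^ Fintype.card ι) * 2 := by
        simp [ENNReal.tsum_mul_left, ENNReal.tsum_geometric]
    _ ≤ _ := by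
        rw [tsum_fintype, Finset.sum_const, nsmul_eq_mul]
        gcongr
        exact Fintype.card_subtype_le _

end firstMoment

section counting

lemma tsum_indicator_eq_encard {V : Type*} (Λ D : Set V) :
    ∑' v : Λ, D.indicator (1 : V → ℝ≥0∞) v = ((Λ ∩ D).encard : ℝ≥0∞) := by
  rw [tsum_subtype Λ (D.indicator (1 : V → ℝ≥0∞)), Set.indicator_indicator, ← tsum_subtype,
    ← ENNReal.tsum_set_one]
  rfl

lemma toENNReal_encard_mono {V : Type*} {A B : Set V} (h : A ⊆ B) :
    (A.encard : ℝ≥0∞) ≤ B.encard :=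
  ENat.toENNReal_le.2 (Set.encard_le_encard h)

lemma measurable_encard_cosetVectors {ι : Type*} [Fintype ι] [DecidableEq ι]
    {Γ : Subgroup (Matrix.SpecialLinearGroup ι ℝ)} {e : ι → ℝ}
    (hΓ : IsIntegralSubgroup Γ) {E : Type*} [MeasurableSpace E]
    [StandardBorelSpace E] {D : Set (((Matrix.SpecialLinearGroup ι ℝ ⧸ Γ) × E) × (ι → ℝ))}
    (hD : MeasurableSet D) :
    Measurable fun p : (Matrix.SpecialLinearGroup ι ℝ ⧸ Γ) × E =>
      ((cosetVectors Γ e p.1 ∩ {v | (p, v) ∈ D}).encard : ℝ≥0∞) := by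
  have h := measurable_tsum_cosetVectors (e := e) hΓ (f := D.indicator 1)
    (measurable_one.indicator hD)
  convert h using 2 with p
  rw [← tsum_indicator_eq_encard]
  rfl

variable {V : Type*} {m : ℕ} (z : V → Fin m → ℝ)

lemma setLIntegral_encard {U : Set V} (hU : U.Countable) (w : ℝ) {g : (Fin m → ℝ) → ℝ≥0∞}
    (hg : Measurable g) (ν : Measure (Fin m → ℝ)) :
    ∫⁻ α, ((U ∩ {v | ‖α - z v‖ ≤ w}).encard : ℝ≥0∞) * g α ∂ν =
      ∑' v : U, ∫⁻ α in closedBall (z v) w, g α ∂ν := by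
  have : Countable U := hU.to_subtype
  simp_rw [← lintegral_indicator measurableSet_closedBall]
  rw [← lintegral_tsum fun v => (hg.indicator measurableSet_closedBall).aemeasurable]
  refine lintegral_congr fun α => ?_
  rw [← tsum_indicator_eq_encard, ← ENNReal.tsum_mul_right]
  refine tsum_congr fun v => ?_
  by_cases h : ‖α - z v‖ ≤ w
  · rw [indicator_of_mem (by exact h), indicator_of_mem (by rwa [mem_closedBall_iff_norm])]
    simp
  · rw [indicator_of_notMem (by exact h), indicator_of_notMem (by rwa [mem_closedBall_iff_norm])]
    simp

/-- A set is `C`-packed at scale `ρ` if each `ρ`-ball centred at one of its points contains at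
most `C` of them. -/
def IsPacked (U : Set V) (ρ : ℝ) (C : ℝ≥0∞) : Prop :=
  ∀ v ∈ U, ((U ∩ {v' | ‖z v' - z v‖ ≤ ρ}).encard : ℝ≥0∞) ≤ C

variable {z}

lemma IsPacked.encard_inter_le {U : Set V} (hU : U.Countable) {ρ : ℝ} {C : ℝ≥0∞}
    (h : IsPacked z U ρ C) (hρ : 0 < ρ) (c : Fin m → ℝ) {a : ℝ} (ha : 0 ≤ a) :
    ((U ∩ {v | ‖z v - c‖ ≤ a}).encard : ℝ≥0∞) ≤
      C * ENNReal.ofReal (((2 * a + ρ) / ρ) ^ m) := by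
  set U' := U ∩ {v | ‖z v - c‖ ≤ a} with hU'
  have hU'c : U'.Countable := hU.mono inter_subset_left
  have h1 := setLIntegral_encard z hU'c (ρ / 2) (g := 1) measurable_one volume
  simp only [Pi.one_apply, mul_one, lintegral_one, Measure.restrict_apply_univ] at h1
  have hρm : ENNReal.ofReal (ρ ^ m) ≠ 0 := by
    rw [Ne, ENNReal.ofReal_eq_zero, not_le]; positivity
  have h2 : ∑' v : U', volume (closedBall (z v) (ρ / 2)) = U'.encard * ENNReal.ofReal (ρ ^ m) := by
    simp_rw [Real.volume_pi_closedBall _ (half_pos hρ).le, Fintype.card_fin,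
      mul_div_cancel₀ ρ (two_ne_zero' ℝ)]
    rw [ENNReal.tsum_const]; rfl
  have h3 : ∫⁻ α, ((U' ∩ {v | ‖α - z v‖ ≤ ρ / 2}).encard : ℝ≥0∞) ≤
      C * ENNReal.ofReal ((2 * a + ρ) ^ m) := by
    calc _ ≤ ∫⁻ α, (closedBall c (a + ρ / 2)).indicator (fun _ => C) α := by
          refine lintegral_mono fun α => ?_
          rcases (U' ∩ {v | ‖α - z v‖ ≤ ρ / 2}).eq_empty_or_nonempty with he | ⟨v₀, hv₀, hα⟩
          · simp [he]
          have hmem : α ∈ closedBall c (a + ρ / 2) := by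
            rw [mem_closedBall_iff_norm]
            calc ‖α - c‖ = ‖(α - z v₀) + (z v₀ - c)‖ := by congr 1; abel
              _ ≤ ‖α - z v₀‖ + ‖z v₀ - c‖ := norm_add_le _ _
              _ ≤ a + ρ / 2 := by
                have := hv₀.2
                simp only [mem_ofPred_eq] at hα this
                linarith
          rw [indicator_of_mem hmem]
          refine le_trans ?_ (h v₀ hv₀.1)
          have hsub : U' ∩ {v | ‖α - z v‖ ≤ ρ / 2} ⊆ U ∩ {v' | ‖z v' - z v₀‖ ≤ ρ} := by
            rintro v ⟨hv, hvα⟩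
            refine ⟨hv.1, ?_⟩
            simp only [mem_ofPred_eq] at hα hvα ⊢
            calc ‖z v - z v₀‖ = ‖(α - z v₀) - (α - z v)‖ := by congr 1; abel
              _ ≤ ‖α - z v₀‖ + ‖α - z v‖ := norm_sub_le _ _
              _ ≤ ρ := by linarith
          exact toENNReal_encard_mono hsub
      _ = C * volume (closedBall c (a + ρ / 2)) := by
          rw [lintegral_indicator measurableSet_closedBall, setLIntegral_const]
      _ = _ := by
          rw [Real.volume_pi_closedBall _ (by linarith), Fintype.card_fin]
          congr 3
          ring
  rw [h1, h2] at h3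
  rw [div_pow, ENNReal.ofReal_div_of_pos (by positivity), ← mul_div_assoc,
    ENNReal.le_div_iff_mul_le (Or.inl hρm) (Or.inl ENNReal.ofReal_ne_top)]
  exact h3

lemma measurable_encard_ball {U : Set V} (hU : U.Countable) (w : ℝ) :
    Measurable fun α => ((U ∩ {v | ‖α - z v‖ ≤ w}).encard : ℝ≥0∞) := by
  have : Countable U := hU.to_subtype
  simp_rw [← tsum_indicator_eq_encard]
  refine Measurable.tsum fun v => ?_
  have : (fun α => indicator {v | ‖α - z v‖ ≤ w} (1 : V → ℝ≥0∞) v.1) =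
      (closedBall (z v) w).indicator 1 := by
    ext α
    by_cases h : ‖α - z v‖ ≤ w
    · rw [indicator_of_mem (by exact h), indicator_of_mem (by rwa [mem_closedBall_iff_norm])]
      rfl
    · rw [indicator_of_notMem (by exact h), indicator_of_notMem (by rwa [mem_closedBall_iff_norm])]
  rw [this]
  exact measurable_one.indicator measurableSet_closedBall

/-- Correlation estimate for the counting functions of two packed sets. -/
lemma lintegral_encard_mul_encard_le {U₁ U₂ : Set V} (hU₁ : U₁.Countable) (hU₂ : U₂.Countable)
    {ρ₁ ρ₂ w₁ w₂ s : ℝ} {C : ℝ≥0∞} (h₁ : IsPacked z U₁ ρ₁ C) (h₂ : IsPacked z U₂ ρ₂ C)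
    (hρ₁ : 0 < ρ₁) (hρ₂ : 0 < ρ₂) (hw₂ : 0 ≤ w₂) (hw : w₂ ≤ w₁) (hs : 0 ≤ s)
    (hU₁s : ∀ v ∈ U₁, ‖z v‖ ≤ s) :
    ∫⁻ α, ((U₁ ∩ {v | ‖α - z v‖ ≤ w₁}).encard : ℝ≥0∞) *
        ((U₂ ∩ {v | ‖α - z v‖ ≤ w₂}).encard : ℝ≥0∞) ≤
      C * C * ENNReal.ofReal (((2 * s + ρ₁) / ρ₁) ^ m * ((4 * w₁ + ρ₂) / ρ₂) ^ m * (2 * w₂) ^ m) := by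
  rw [setLIntegral_encard z hU₁ w₁ (measurable_encard_ball hU₂ w₂)]
  have key : ∀ v : U₁, ∫⁻ α in closedBall (z v) w₁,
      ((U₂ ∩ {v | ‖α - z v‖ ≤ w₂}).encard : ℝ≥0∞) ≤
      C * ENNReal.ofReal (((4 * w₁ + ρ₂) / ρ₂) ^ m * (2 * w₂) ^ m) := by
    intro v
    set U' := U₂ ∩ {v' | ‖z v' - z v‖ ≤ w₁ + w₂} with hU'
    have hU'c : U'.Countable := hU₂.mono inter_subset_left
    have h1 := setLIntegral_encard z hU'c w₂ (g := 1) measurable_one volume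
    simp only [Pi.one_apply, mul_one, lintegral_one, Measure.restrict_apply_univ,
      Real.volume_pi_closedBall _ hw₂, Fintype.card_fin] at h1
    rw [ENNReal.tsum_const] at h1
    calc _ ≤ ∫⁻ α in closedBall (z v) w₁, ((U' ∩ {v | ‖α - z v‖ ≤ w₂}).encard : ℝ≥0∞) := by
          refine setLIntegral_mono (measurable_encard_ball hU'c _) fun α hα => ?_
          have hsub : U₂ ∩ {v | ‖α - z v‖ ≤ w₂} ⊆ U' ∩ {v | ‖α - z v‖ ≤ w₂} := by
            rintro v' ⟨hv', hv'α⟩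
            refine ⟨⟨hv', ?_⟩, hv'α⟩
            rw [mem_closedBall_iff_norm] at hα
            simp only [mem_ofPred_eq] at hv'α ⊢
            calc ‖z v' - z v‖ = ‖(α - z v) - (α - z v')‖ := by congr 1; abel
              _ ≤ ‖α - z v‖ + ‖α - z v'‖ := norm_sub_le _ _
              _ ≤ _ := by linarith
          exact toENNReal_encard_mono hsub
      _ ≤ ∫⁻ α, ((U' ∩ {v | ‖α - z v‖ ≤ w₂}).encard : ℝ≥0∞) := setLIntegral_le_lintegral _ _
      _ = U'.encard * ENNReal.ofReal ((2 * w₂) ^ m) := h1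
      _ ≤ C * ENNReal.ofReal (((4 * w₁ + ρ₂) / ρ₂) ^ m) * ENNReal.ofReal ((2 * w₂) ^ m) := by
          gcongr
          refine (h₂.encard_inter_le hU₂ hρ₂ (z v) (a := w₁ + w₂) (by linarith)).trans ?_
          have h0 : 2 * (w₁ + w₂) + ρ₂ ≤ 4 * w₁ + ρ₂ := by linarith
          have h0' : 0 ≤ 2 * (w₁ + w₂) + ρ₂ := by linarith
          gcongr
      _ = _ := by
          have : 0 ≤ w₁ := hw₂.trans hw
          rw [mul_assoc, ← ENNReal.ofReal_mul (by positivity)]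
  have hcard : (U₁.encard : ℝ≥0∞) ≤ C * ENNReal.ofReal (((2 * s + ρ₁) / ρ₁) ^ m) := by
    have hsub : U₁ ⊆ U₁ ∩ {v | ‖z v - 0‖ ≤ s} := fun v hv => ⟨hv, by
      rw [mem_ofPred_eq, sub_zero]
      exact hU₁s v hv⟩
    exact (toENNReal_encard_mono hsub).trans (h₁.encard_inter_le hU₁ hρ₁ 0 hs)
  calc _ ≤ ∑' v : U₁, C * ENNReal.ofReal (((4 * w₁ + ρ₂) / ρ₂) ^ m * (2 * w₂) ^ m) :=
        ENNReal.tsum_le_tsum key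
    _ = U₁.encard * (C * ENNReal.ofReal (((4 * w₁ + ρ₂) / ρ₂) ^ m * (2 * w₂) ^ m)) := by
        rw [ENNReal.tsum_const]; rfl
    _ ≤ C * ENNReal.ofReal (((2 * s + ρ₁) / ρ₁) ^ m) *
        (C * ENNReal.ofReal (((4 * w₁ + ρ₂) / ρ₂) ^ m * (2 * w₂) ^ m)) := by gcongr
    _ = _ := by
        rw [mul_assoc (((2 * s + ρ₁) / ρ₁) ^ m),
          ENNReal.ofReal_mul (p := ((2 * s + ρ₁) / ρ₁) ^ m) (by positivity)]
        ring

end counting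

section secondMoment

lemma ENNReal.le_sq_mul_inv_add {a c : ℝ≥0∞} (hc : c ≠ ⊤) (hc0 : c ≠ 0) :
    a ≤ a * a * c⁻¹ + c := by
  rcases le_total a c with h | h
  · exact h.trans le_add_self
  · refine le_trans ?_ le_self_add
    calc a = a * (c * c⁻¹) := by rw [ENNReal.mul_inv_cancel hc0 hc, mul_one]
      _ ≤ a * (a * c⁻¹) := by gcongr
      _ = _ := by ring

lemma sum_geometric_shift_le (i k : ℕ) :
    ∑ j ∈ Finset.range k, (if i ≤ j then (2⁻¹ : ℝ≥0∞) ^ (j - i) else 0) ≤ 2 := by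
  rw [← Finset.sum_filter]
  calc _ ≤ ∑ l ∈ Finset.range k, (2⁻¹ : ℝ≥0∞) ^ l := by
        rw [← Finset.sum_image (f := fun l => (2⁻¹ : ℝ≥0∞) ^ l) (g := fun j => j - i)]
        · refine Finset.sum_le_sum_of_subset fun l hl => ?_
          simp only [Finset.mem_image, Finset.mem_filter, Finset.mem_range] at hl ⊢
          omega
        · intro a ha b hb hab
          simp only [Finset.coe_filter, Finset.mem_range, mem_ofPred_eq] at ha hb hab
          omega
    _ ≤ ∑' l, (2⁻¹ : ℝ≥0∞) ^ l := ENNReal.sum_le_tsum _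
    _ = 2 := by simp [ENNReal.tsum_geometric]

variable {Ω : Type*} [MeasurableSpace Ω] {P : Measure Ω} {f : ℕ → Ω → ℝ≥0∞}
  {x : ℕ → ℝ≥0∞} {C : ℝ≥0∞}

lemma lintegral_sum_sq_le (hf : ∀ t, Measurable (f t))
    (hC : ∀ i j, i ≤ j → ∫⁻ ω, f i ω * f j ω ∂P ≤ C * (x i * x j + x i * (2⁻¹) ^ (j - i)))
    (k : ℕ) :
    ∫⁻ ω, (∑ t ∈ Finset.range k, f t ω) * (∑ t ∈ Finset.range k, f t ω) ∂P ≤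
      C * ((∑ t ∈ Finset.range k, x t) * (∑ t ∈ Finset.range k, x t) +
        4 * ∑ t ∈ Finset.range k, x t) := by
  set g : ℕ → ℕ → ℝ≥0∞ := fun i j => if i ≤ j then (2⁻¹ : ℝ≥0∞) ^ (j - i) else 0 with hg
  have hij : ∀ i j, ∫⁻ ω, f i ω * f j ω ∂P ≤ C * (x i * x j + (x i * g i j + x j * g j i)) := by
    intro i j
    rcases le_total i j with h | h
    · refine (hC i j h).trans ?_
      gcongr
      simp only [hg, if_pos h]
      exact le_self_add
    · simp_rw [mul_comm (f i _)]
      refine (hC j i h).trans ?_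
      rw [mul_comm (x j) (x i)]
      gcongr
      simp only [hg, if_pos h]
      exact le_add_self
  simp_rw [Finset.sum_mul_sum]
  have hij_meas : ∀ i j, Measurable fun ω => f i ω * f j ω := fun i j => (hf i).mul (hf j)
  rw [lintegral_finsetSum _ fun i _ => Finset.measurable_sum _ fun j _ => hij_meas i j]
  calc _ ≤ ∑ i ∈ Finset.range k, ∑ j ∈ Finset.range k,
        C * (x i * x j + (x i * g i j + x j * g j i)) := by
        refine Finset.sum_le_sum fun i _ => ?_
        rw [lintegral_finsetSum _ fun j _ => hij_meas i j]
        exact Finset.sum_le_sum fun j _ => hij i j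
    _ = C * (∑ i ∈ Finset.range k, ∑ j ∈ Finset.range k, x i * x j +
        (∑ i ∈ Finset.range k, x i * ∑ j ∈ Finset.range k, g i j +
          ∑ j ∈ Finset.range k, x j * ∑ i ∈ Finset.range k, g j i)) := by
        simp_rw [Finset.mul_sum, mul_add, Finset.sum_add_distrib, Finset.mul_sum]
        congr 2
        exact Finset.sum_comm
    _ ≤ C * (∑ i ∈ Finset.range k, ∑ j ∈ Finset.range k, x i * x j +
        (∑ i ∈ Finset.range k, x i * 2 + ∑ j ∈ Finset.range k, x j * 2)) := by
        gcongr <;> exact sum_geometric_shift_le _ _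
    _ = _ := by
        rw [← Finset.sum_mul]
        congr 2
        ring

/-- A quantitative divergence Borel–Cantelli lemma via second moments. -/
lemma le_of_secondMoment [IsFiniteMeasure P] (hf : ∀ t, Measurable (f t))
    (hx : ∀ t, x t ≠ ⊤) (hsum : ∑' t, x t = ⊤) {b : ℝ≥0∞} (hCtop : C ≠ ⊤)
    (hb : ∀ t, b * x t ≤ ∫⁻ ω, f t ω ∂P)
    (hC : ∀ i j, i ≤ j → ∫⁻ ω, f i ω * f j ω ∂P ≤ C * (x i * x j + x i * (2⁻¹) ^ (j - i)))
    {τ : ℝ≥0∞} (hτ0 : τ ≠ 0) (hτ : τ ≠ ⊤) :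
    b ≤ C / τ + τ * P {ω | ∑' t, f t ω = ⊤} := by
  set X : ℕ → ℝ≥0∞ := fun k => ∑ t ∈ Finset.range k, x t with hX
  have hXtop : ∀ k, X k ≠ ⊤ := fun k => by simp [hX, ENNReal.sum_eq_top, hx]
  have hXlim : Tendsto X atTop (𝓝 ⊤) := by
    rw [← hsum]; exact ENNReal.tendsto_nat_tsum x
  have hFm : ∀ k, Measurable fun ω => ∑ t ∈ Finset.range k, f t ω := fun k =>
    Finset.measurable_sum _ fun t _ => hf t
  have hFinf : Measurable fun ω => ∑' t, f t ω := Measurable.tsum hf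
  have hL : ∀ L : ℕ, b ≤ C / τ + τ * P {ω | (L : ℝ≥0∞) ≤ ∑' t, f t ω} := by
    intro L
    set G : Set Ω := {ω | (L : ℝ≥0∞) ≤ ∑' t, f t ω} with hG
    have hGm : MeasurableSet G := measurableSet_le measurable_const hFinf
    set A : ℝ≥0∞ := L * P univ + C / τ * 4 with hA
    have hAtop : A ≠ ⊤ := by
      refine ENNReal.add_ne_top.2 ⟨ENNReal.mul_ne_top (by simp) (measure_ne_top _ _),
        ENNReal.mul_ne_top (ENNReal.div_ne_top hCtop hτ0) (by simp)⟩
    have hmain : ∀ k, X k ≠ 0 → b ≤ A / X k + (C / τ + τ * P G) := by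
      intro k hk
      have hτX : τ * X k ≠ 0 := mul_ne_zero hτ0 hk
      have hτX' : τ * X k ≠ ⊤ := ENNReal.mul_ne_top hτ (hXtop k)
      have h1 : b * X k ≤ ∫⁻ ω, ∑ t ∈ Finset.range k, f t ω ∂P := by
        rw [lintegral_finsetSum _ fun t _ => hf t, hX, Finset.mul_sum]
        exact Finset.sum_le_sum fun t _ => hb t
      have h2 : ∫⁻ ω in Gᶜ, ∑ t ∈ Finset.range k, f t ω ∂P ≤ L * P univ := by
        calc _ ≤ ∫⁻ ω in Gᶜ, (L : ℝ≥0∞) ∂P := by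
              refine setLIntegral_mono measurable_const fun ω hω => ?_
              have : ∑' t, f t ω < L := not_le.1 hω
              exact (ENNReal.sum_le_tsum _).trans this.le
          _ = L * P Gᶜ := setLIntegral_const _ _
          _ ≤ _ := by gcongr; exact subset_univ _
      have h3 : ∫⁻ ω in G, ∑ t ∈ Finset.range k, f t ω ∂P ≤
          C / τ * (X k + 4) + τ * X k * P G := by
        calc _ ≤ ∫⁻ ω in G, ((∑ t ∈ Finset.range k, f t ω) * (∑ t ∈ Finset.range k, f t ω) *
              (τ * X k)⁻¹ + τ * X k) ∂P :=
              lintegral_mono fun ω => ENNReal.le_sq_mul_inv_add hτX' hτX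
          _ = ∫⁻ ω in G, (∑ t ∈ Finset.range k, f t ω) * (∑ t ∈ Finset.range k, f t ω) *
              (τ * X k)⁻¹ ∂P + τ * X k * P G := by
              rw [lintegral_add_right _ measurable_const, setLIntegral_const]
          _ ≤ C * (X k * X k + 4 * X k) * (τ * X k)⁻¹ + τ * X k * P G := by
              have hFF : Measurable fun ω => (∑ t ∈ Finset.range k, f t ω) *
                  ∑ t ∈ Finset.range k, f t ω := (hFm k).mul (hFm k)
              rw [lintegral_mul_const _ hFF]
              gcongr
              exact (setLIntegral_le_lintegral _ _).trans (lintegral_sum_sq_le hf hC k)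
          _ = _ := by
              rw [ENNReal.mul_inv (Or.inl hτ0) (Or.inl hτ), div_eq_mul_inv]
              have : X k * (X k)⁻¹ = 1 := ENNReal.mul_inv_cancel hk (hXtop k)
              congr 1
              calc _ = C * τ⁻¹ * ((X k + 4) * (X k * (X k)⁻¹)) := by ring
                _ = _ := by rw [this, mul_one]
      have h4 : b * X k ≤ A + (C / τ + τ * P G) * X k := by
        refine h1.trans ?_
        rw [← lintegral_add_compl _ hGm]
        calc _ ≤ (C / τ * (X k + 4) + τ * X k * P G) + L * P univ := add_le_add h3 h2
          _ = _ := by rw [hA]; ring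
      rw [← ENNReal.le_div_iff_mul_le (Or.inl hk) (Or.inl (hXtop k)), ENNReal.add_div,
        mul_div_assoc, ENNReal.div_self hk (hXtop k), mul_one] at h4
      exact h4
    have hlim : Tendsto (fun k => A / X k + (C / τ + τ * P G)) atTop
        (𝓝 (0 + (C / τ + τ * P G))) := by
      refine Tendsto.add ?_ tendsto_const_nhds
      have := ENNReal.Tendsto.const_div (a := A) hXlim (Or.inr hAtop)
      rwa [ENNReal.div_top] at this
    rw [zero_add] at hlim
    refine ge_of_tendsto hlim ?_
    filter_upwards [hXlim.eventually_ne ENNReal.top_ne_zero] with k hk using hmain k hk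
  have hanti : Antitone fun L : ℕ => {ω | (L : ℝ≥0∞) ≤ ∑' t, f t ω} := by
    intro a b hab ω hω
    have hω' : (b : ℝ≥0∞) ≤ ∑' t, f t ω := hω
    exact le_trans (Nat.cast_le.2 hab) hω'
  have hcap : ⋂ L : ℕ, {ω | (L : ℝ≥0∞) ≤ ∑' t, f t ω} = {ω | ∑' t, f t ω = ⊤} := by
    ext ω
    simp only [mem_iInter, mem_ofPred_eq]
    refine ⟨fun h => ?_, fun h L => by rw [h]; exact le_top⟩
    by_contra hne
    obtain ⟨L, hL⟩ := ENNReal.exists_nat_gt hne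
    exact absurd (h L) (not_le.2 hL)
  have hPlim := tendsto_measure_iInter_atTop (μ := P)
    (fun L : ℕ => (measurableSet_le measurable_const hFinf).nullMeasurableSet) hanti
    ⟨0, measure_ne_top _ _⟩
  rw [hcap] at hPlim
  exact ge_of_tendsto' ((ENNReal.Tendsto.const_mul hPlim (Or.inr hτ)).const_add _) hL

end secondMoment

section fibre

variable {m n : ℕ}

/-- The unipotent element `v ↦ v + v_j α`, where `α` lives in the expanded coordinates. -/
noncomputable def uShear (j : Fin n) (α : Fin m → ℝ) :
    Matrix.SpecialLinearGroup (Fin m ⊕ Fin n) ℝ :=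
  shear (Sum.inr j) (Sum.elim α 0)

lemma uShear_mulVec_inl (j : Fin n) (α : Fin m → ℝ) (v : Fin m ⊕ Fin n → ℝ) (i : Fin m) :
    (uShear j α).1.mulVec v (Sum.inl i) = v (Sum.inl i) + v (Sum.inr j) * α i := by
  rw [uShear, shear_mulVec]
  simp

lemma uShear_mulVec_inr (j : Fin n) (α : Fin m → ℝ) (v : Fin m ⊕ Fin n → ℝ) (k : Fin n) :
    (uShear j α).1.mulVec v (Sum.inr k) = v (Sum.inr k) := by
  rw [uShear, shear_mulVec]
  simp

lemma continuous_uShear (j : Fin n) : Continuous (uShear (m := m) j) := by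
  refine (continuous_shear _).comp ?_
  refine continuous_pi fun k => ?_
  rcases k with k | k
  · exact continuous_apply k
  · exact continuous_const

lemma uShear_add (j : Fin n) (α β : Fin m → ℝ) :
    uShear j (α + β) = uShear j α * uShear j β := by
  refine Subtype.ext (Matrix.ext_of_mulVec_single fun k => ?_)
  rw [Matrix.SpecialLinearGroup.coe_mul, ← Matrix.mulVec_mulVec]
  ext l
  rcases l with l | l
  · simp only [uShear_mulVec_inl, uShear_mulVec_inr, Pi.add_apply]
    ring
  · simp only [uShear_mulVec_inr]

/-- The point of `ℝ^m` at which the shear kills the expanded coordinates of `v`. -/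
noncomputable def resonantPoint (j : Fin n) (v : Fin m ⊕ Fin n → ℝ) : Fin m → ℝ :=
  fun i => -(v (Sum.inl i) / v (Sum.inr j))

lemma measurable_resonantPoint (j : Fin n) : Measurable (resonantPoint (m := m) j) := by
  unfold resonantPoint
  fun_prop

lemma norm_aFlowStd_mul_uShear_le_iff (hm : 0 < m) (hn : 0 < n) {j : Fin n}
    {v : Fin m ⊕ Fin n → ℝ} (hv : v (Sum.inr j) ≠ 0) (τ : ℝ) (α : Fin m → ℝ) {R : ℝ}
    (hR : 0 ≤ R) :
    ‖(aFlowStd m n hm hn τ * uShear j α).1.mulVec v‖ ≤ R ↔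
      Real.exp (τ / m) * (|v (Sum.inr j)| * ‖α - resonantPoint j v‖) ≤ R ∧
        ∀ k, Real.exp (-(τ / n)) * |v (Sum.inr k)| ≤ R := by
  have hvpos : 0 < |v (Sum.inr j)| := abs_pos.2 hv
  rw [pi_norm_le_iff_of_nonneg hR, Sum.forall]
  refine and_congr ?_ (forall_congr' fun k => ?_)
  · rw [← mul_assoc, mul_comm, ← le_div_iff₀ (by positivity),
      pi_norm_le_iff_of_nonneg (by positivity)]
    refine forall_congr' fun i => ?_
    rw [Matrix.SpecialLinearGroup.coe_mul, ← Matrix.mulVec_mulVec, aFlowStd, Matrix.mulVec_diagonal,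
      uShear_mulVec_inl, Sum.elim_inl, norm_mul, Real.norm_of_nonneg (Real.exp_pos _).le,
      le_div_iff₀ (by positivity)]
    have : v (Sum.inl i) + v (Sum.inr j) * α i = v (Sum.inr j) * (α - resonantPoint j v) i := by
      simp only [resonantPoint, Pi.sub_apply]
      field_simp
      ring
    rw [this, norm_mul, Real.norm_eq_abs (v (Sum.inr j))]
    rw [show Real.exp (τ / m) * (|v (Sum.inr j)| * ‖(α - resonantPoint j v) i‖) =
      ‖(α - resonantPoint j v) i‖ * (Real.exp (τ / m) * |v (Sum.inr j)|) by ring]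
  · rw [Matrix.SpecialLinearGroup.coe_mul, ← Matrix.mulVec_mulVec, aFlowStd, Matrix.mulVec_diagonal,
      uShear_mulVec_inr, Sum.elim_inr, norm_mul, Real.norm_of_nonneg (Real.exp_pos _).le,
      Real.norm_eq_abs]

/-- Vectors whose contracted coordinates have size about `exp (k + σ / n)`. -/
def window (j : Fin n) (σ k : ℝ) : Set (Fin m ⊕ Fin n → ℝ) :=
  {v | (∀ l, |v (Sum.inr l)| ≤ Real.exp (k + σ / n)) ∧
    Real.exp (-k + σ / n) ≤ |v (Sum.inr j)|}

lemma measurableSet_window (j : Fin n) (σ k : ℝ) : MeasurableSet (window (m := m) j σ k) := by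
  unfold window
  measurability

lemma ne_zero_of_mem_window {j : Fin n} {σ k : ℝ} {v : Fin m ⊕ Fin n → ℝ}
    (hv : v ∈ window j σ k) : v (Sum.inr j) ≠ 0 :=
  abs_pos.1 ((Real.exp_pos _).trans_le hv.2)

variable (m n) in
/-- The separation scale at time `σ`. -/
noncomputable def sepScale (σ : ℝ) : ℝ := Real.exp (-(σ / m + σ / n))

lemma sepScale_pos (σ : ℝ) : 0 < sepScale m n σ := Real.exp_pos _

lemma norm_flow_le_of_mem_window (hm : 0 < m) (hn : 0 < n) {j : Fin n} {t r k : ℝ}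
    {v : Fin m ⊕ Fin n → ℝ} (hv : v ∈ window j (t - n * (r + k)) k) {α : Fin m → ℝ}
    (hα : ‖α - resonantPoint j v‖ ≤ sepScale m n t) :
    ‖(aFlowStd m n hm hn t * uShear j α).1.mulVec v‖ ≤ Real.exp (-r) := by
  have hn' : (n : ℝ) ≠ 0 := by exact_mod_cast hn.ne'
  have hQ : k + (t - n * (r + k)) / n = t / n - r := by field_simp; ring
  obtain ⟨h1, h2⟩ := id hv
  rw [hQ] at h1
  rw [norm_aFlowStd_mul_uShear_le_iff hm hn (ne_zero_of_mem_window hv) _ _ (Real.exp_pos _).le]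
  refine ⟨?_, fun l => ?_⟩
  · calc _ ≤ Real.exp (t / m) * (Real.exp (t / n - r) * sepScale m n t) := by
          gcongr
          exact h1 j
      _ = _ := by rw [sepScale, ← Real.exp_add, ← Real.exp_add]; congr 1; ring
  · calc _ ≤ Real.exp (-(t / n)) * Real.exp (t / n - r) := by gcongr; exact h1 l
      _ = _ := by rw [← Real.exp_add]; congr 1; ring

variable {Γ : Subgroup (Matrix.SpecialLinearGroup (Fin m ⊕ Fin n) ℝ)} {e : Fin m ⊕ Fin n → ℝ}

variable (Γ e) in
/-- Vectors in a window whose resonant points are not too crowded. -/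
def goodVectors (j : Fin n) (σ k s : ℝ) (C : ℝ≥0∞)
    (x : Matrix.SpecialLinearGroup (Fin m ⊕ Fin n) ℝ ⧸ Γ) : Set (Fin m ⊕ Fin n → ℝ) :=
  {v | v ∈ cosetVectors Γ e x ∧ v ∈ window j σ k ∧
    ((cosetVectors Γ e x ∩ {v' | v' ∈ window j σ k ∧
      ‖resonantPoint j v' - resonantPoint j v‖ ≤ sepScale m n σ}).encard : ℝ≥0∞) ≤ C ∧
    ‖resonantPoint j v‖ ≤ s}

lemma isPacked_goodVectors (j : Fin n) (σ k s : ℝ) (C : ℝ≥0∞)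
    (x : Matrix.SpecialLinearGroup (Fin m ⊕ Fin n) ℝ ⧸ Γ) :
    IsPacked (resonantPoint j) (goodVectors Γ e j σ k s C x) (sepScale m n σ) C := by
  intro v hv
  refine (toENNReal_encard_mono ?_).trans hv.2.2.1
  rintro v' ⟨hv', h⟩
  exact ⟨hv'.1, hv'.2.1, h⟩

lemma countable_cosetVectors (hΓ : IsIntegralSubgroup Γ)
    (he : ∃ z : Fin m ⊕ Fin n → ℤ, e = fun i => (z i : ℝ)) (he0 : e ≠ 0)
    (x : Matrix.SpecialLinearGroup (Fin m ⊕ Fin n) ℝ ⧸ Γ) : (cosetVectors Γ e x).Countable := by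
  have : cosetVectors Γ e x = ⋃ k : ℕ, cosetVectors Γ e x ∩ closedBall 0 k := by
    rw [← inter_iUnion, iUnion_closedBall_nat, inter_univ]
  rw [this]
  exact countable_iUnion fun k => (finite_cosetVectors_inter hΓ he he0 x k).countable

variable (Γ e) in
/-- A family of sets exhausting the space: points with a short vector in general position and few
vectors in a large ball. -/
def coreSet (j : Fin n) (k : ℝ) (C : ℝ≥0∞) :
    Set (Matrix.SpecialLinearGroup (Fin m ⊕ Fin n) ℝ ⧸ Γ) :=
  {y | (∃ v ∈ cosetVectors Γ e y, ‖v‖ ≤ Real.exp k ∧ Real.exp (-k) ≤ |v (Sum.inr j)|) ∧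
    ((cosetVectors Γ e y ∩ closedBall 0 ((Real.exp (2 * k) + 1) * Real.exp k)).encard : ℝ≥0∞) ≤ C}

lemma measurableSet_coreSet (hΓ : IsIntegralSubgroup Γ) (j : Fin n) (k : ℝ) (C : ℝ≥0∞) :
    MeasurableSet (coreSet Γ e j k C) := by
  refine MeasurableSet.inter ?_ ?_
  · refine measurableSet_exists_cosetVectors' hΓ
      (B := {v | ‖v‖ ≤ Real.exp k ∧ Real.exp (-k) ≤ |v (Sum.inr j)|}) ?_
    exact (measurableSet_le measurable_norm measurable_const).inter
      (measurableSet_le measurable_const (measurable_pi_apply _).abs)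
  · have h := measurable_encard_cosetVectors (e := e) hΓ (E := Unit)
      (D := Prod.snd ⁻¹' closedBall 0 ((Real.exp (2 * k) + 1) * Real.exp k))
      (measurable_snd measurableSet_closedBall)
    have h2 := h.comp (measurable_id.prodMk measurable_const :
      Measurable fun x : Matrix.SpecialLinearGroup (Fin m ⊕ Fin n) ℝ ⧸ Γ => (x, ()))
    exact measurableSet_le h2 measurable_const

lemma exists_goodVectors_of_mem_coreSet (hm : 0 < m) (hn : 0 < n) {j : Fin n} {σ k s : ℝ}
    {C : ℝ≥0∞} {x : Matrix.SpecialLinearGroup (Fin m ⊕ Fin n) ℝ ⧸ Γ} {α : Fin m → ℝ}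
    (hs : Real.exp (2 * k) * sepScale m n σ ≤ s / 2) (hα : ‖α‖ ≤ s / 2)
    (h : (aFlowStd m n hm hn σ * uShear j α) • x ∈ coreSet Γ e j k C) :
    ∃ v ∈ goodVectors Γ e j σ k s C x,
      ‖α - resonantPoint j v‖ ≤ Real.exp (2 * k) * sepScale m n σ := by
  obtain ⟨⟨w, hw, hw1, hw2⟩, hcount⟩ := h
  obtain ⟨v, hv, rfl⟩ := exists_of_mem_cosetVectors_smul _ hw
  have hwj : (aFlowStd m n hm hn σ * uShear j α).1.mulVec v (Sum.inr j) =
      Real.exp (-(σ / n)) * v (Sum.inr j) := by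
    rw [Matrix.SpecialLinearGroup.coe_mul, ← Matrix.mulVec_mulVec, aFlowStd, Matrix.mulVec_diagonal,
      uShear_mulVec_inr, Sum.elim_inr]
  rw [hwj, abs_mul, abs_of_pos (Real.exp_pos _)] at hw2
  have hvj : Real.exp (-k + σ / n) ≤ |v (Sum.inr j)| := by
    have : Real.exp (-k + σ / n) = Real.exp (-k) * Real.exp (σ / n) := Real.exp_add _ _
    rw [this]
    calc _ ≤ Real.exp (-(σ / n)) * |v (Sum.inr j)| * Real.exp (σ / n) := by gcongr
      _ = |v (Sum.inr j)| * (Real.exp (-(σ / n)) * Real.exp (σ / n)) := by ring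
      _ = _ := by rw [← Real.exp_add]; simp
  have hv0 : v (Sum.inr j) ≠ 0 := abs_pos.1 ((Real.exp_pos _).trans_le hvj)
  obtain ⟨h1, h2⟩ := (norm_aFlowStd_mul_uShear_le_iff hm hn hv0 σ α (Real.exp_pos _).le).1 hw1
  have hwin : v ∈ window j σ k := by
    refine ⟨fun l => ?_, hvj⟩
    calc |v (Sum.inr l)| = (Real.exp (-(σ / n)) * |v (Sum.inr l)|) * Real.exp (σ / n) := by
          rw [mul_right_comm, ← Real.exp_add]; simp
      _ ≤ Real.exp k * Real.exp (σ / n) := by gcongr; exact h2 l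
      _ = _ := (Real.exp_add _ _).symm
  have hdist : ‖α - resonantPoint j v‖ ≤ Real.exp (2 * k) * sepScale m n σ := by
    have h3 : Real.exp (σ / m) * (Real.exp (-k + σ / n) * ‖α - resonantPoint j v‖) ≤ Real.exp k :=
      le_trans (by gcongr) h1
    rw [← mul_assoc, ← Real.exp_add, ← le_div_iff₀' (Real.exp_pos _), ← Real.exp_sub] at h3
    refine h3.trans_eq ?_
    rw [sepScale, ← Real.exp_add]
    congr 1
    ring
  refine ⟨v, ⟨hv, hwin, ?_, ?_⟩, hdist⟩
  · refine le_trans ?_ hcount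
    rw [ENat.toENNReal_le]
    refine Set.encard_le_encard_of_injOn (f := fun v' =>
      (aFlowStd m n hm hn σ * uShear j α).1.mulVec v') ?_ (specialLinear_mulVec_injective _).injOn
    rintro v' ⟨hv', hwin', hv'd⟩
    refine ⟨mulVec_mem_cosetVectors _ hv', ?_⟩
    have hR : Real.exp k ≤ (Real.exp (2 * k) + 1) * Real.exp k :=
      le_mul_of_one_le_left (Real.exp_pos _).le (by linarith [Real.exp_pos (2 * k)])
    rw [mem_closedBall_zero_iff, norm_aFlowStd_mul_uShear_le_iff hm hn (ne_zero_of_mem_window hwin')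
      _ _ (by positivity)]
    refine ⟨?_, fun l => ?_⟩
    · have h4 : ‖α - resonantPoint j v'‖ ≤ (Real.exp (2 * k) + 1) * sepScale m n σ := by
        calc ‖α - resonantPoint j v'‖ = ‖(α - resonantPoint j v) -
              (resonantPoint j v' - resonantPoint j v)‖ := by congr 1; abel
          _ ≤ ‖α - resonantPoint j v‖ + ‖resonantPoint j v' - resonantPoint j v‖ := norm_sub_le _ _
          _ ≤ Real.exp (2 * k) * sepScale m n σ + sepScale m n σ := add_le_add hdist hv'd
          _ = _ := by ring
      calc _ ≤ Real.exp (σ / m) * (Real.exp (k + σ / n) *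
            ((Real.exp (2 * k) + 1) * sepScale m n σ)) := by
            gcongr
            exact hwin'.1 j
        _ = (Real.exp (2 * k) + 1) * (Real.exp (σ / m) * Real.exp (k + σ / n) *
              sepScale m n σ) := by ring
        _ = _ := by
            rw [sepScale, ← Real.exp_add, ← Real.exp_add]
            congr 2
            ring
    · refine le_trans ?_ hR
      calc _ ≤ Real.exp (-(σ / n)) * Real.exp (k + σ / n) := by gcongr; exact hwin'.1 l
        _ = _ := by rw [← Real.exp_add]; congr 1; ring
  · calc ‖resonantPoint j v‖ = ‖α - (α - resonantPoint j v)‖ := by congr 1; abel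
      _ ≤ ‖α‖ + ‖α - resonantPoint j v‖ := norm_sub_le _ _
      _ ≤ s := by linarith

lemma volume_coreSet_le (hΓ : IsIntegralSubgroup Γ)
    (he : ∃ z : Fin m ⊕ Fin n → ℤ, e = fun i => (z i : ℝ)) (he0 : e ≠ 0)
    (hm : 0 < m) (hn : 0 < n) {j : Fin n} {σ k s : ℝ}
    {C : ℝ≥0∞} {x : Matrix.SpecialLinearGroup (Fin m ⊕ Fin n) ℝ ⧸ Γ}
    (hs : Real.exp (2 * k) * sepScale m n σ ≤ s / 2) :
    volume {α ∈ closedBall (0 : Fin m → ℝ) (s / 2) |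
      (aFlowStd m n hm hn σ * uShear j α) • x ∈ coreSet Γ e j k C} ≤
      (goodVectors Γ e j σ k s C x).encard *
        ENNReal.ofReal ((2 * (Real.exp (2 * k) * sepScale m n σ)) ^ m) := by
  have hU : (goodVectors Γ e j σ k s C x).Countable :=
    (countable_cosetVectors hΓ he he0 x).mono fun v hv => hv.1
  have : Countable (goodVectors Γ e j σ k s C x) := hU.to_subtype
  have hpos : 0 ≤ Real.exp (2 * k) * sepScale m n σ :=
    mul_nonneg (Real.exp_pos _).le (sepScale_pos σ).le
  calc _ ≤ volume (⋃ v : goodVectors Γ e j σ k s C x, closedBall (resonantPoint j v.1)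
        (Real.exp (2 * k) * sepScale m n σ)) := by
        refine measure_mono ?_
        rintro α ⟨hα, h⟩
        obtain ⟨v, hv, hd⟩ := exists_goodVectors_of_mem_coreSet hm hn hs
          (mem_closedBall_zero_iff.1 hα) h
        exact mem_iUnion.2 ⟨⟨v, hv⟩, mem_closedBall_iff_norm.2 hd⟩
    _ ≤ ∑' v : goodVectors Γ e j σ k s C x, volume (closedBall (resonantPoint j v.1)
        (Real.exp (2 * k) * sepScale m n σ)) := measure_iUnion_le _
    _ = _ := by
        simp_rw [Real.volume_pi_closedBall _ hpos, Fintype.card_fin]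
        rw [ENNReal.tsum_const]
        rfl

end fibre

section visits

variable {m n : ℕ}
variable {Γ : Subgroup (Matrix.SpecialLinearGroup (Fin m ⊕ Fin n) ℝ)} {e : Fin m ⊕ Fin n → ℝ}

variable (Γ e) in
/-- The number of good vectors that the shear by `α` and the flow up to time `t` make short. -/
noncomputable def visitCount (j : Fin n) (k s : ℝ) (C : ℝ≥0∞) (t r : ℝ)
    (x : Matrix.SpecialLinearGroup (Fin m ⊕ Fin n) ℝ ⧸ Γ) (α : Fin m → ℝ) : ℝ≥0∞ :=
  ((goodVectors Γ e j (t - n * (r + k)) k s C x ∩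
    {v | ‖α - resonantPoint j v‖ ≤ sepScale m n t}).encard : ℝ≥0∞)

lemma measurable_visitCount (hΓ : IsIntegralSubgroup Γ) (j : Fin n) (k s : ℝ) (C : ℝ≥0∞)
    (t r : ℝ) : Measurable fun p : (Matrix.SpecialLinearGroup (Fin m ⊕ Fin n) ℝ ⧸ Γ) ×
      (Fin m → ℝ) => visitCount Γ e j k s C t r p.1 p.2 := by
  set σ := t - n * (r + k)
  have hz := measurable_resonantPoint (m := m) j
  have hN := measurable_encard_cosetVectors (e := e) hΓ (E := Fin m ⊕ Fin n → ℝ)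
    (D := {q | q.2 ∈ window j σ k ∧
      ‖resonantPoint j q.2 - resonantPoint j q.1.2‖ ≤ sepScale m n σ})
    ((measurable_snd (measurableSet_window j σ k)).inter (measurableSet_le
      ((hz.comp measurable_snd).sub (hz.comp measurable_fst.snd)).norm measurable_const))
  have h := measurable_encard_cosetVectors (e := e) hΓ (E := Fin m → ℝ)
    (D := {q | (q.2 ∈ window j σ k ∧
      ((cosetVectors Γ e q.1.1 ∩ {v' | v' ∈ window j σ k ∧
        ‖resonantPoint j v' - resonantPoint j q.2‖ ≤ sepScale m n σ}).encard : ℝ≥0∞) ≤ C ∧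
      ‖resonantPoint j q.2‖ ≤ s) ∧ ‖q.1.2 - resonantPoint j q.2‖ ≤ sepScale m n t}) ?_
  · convert h using 2 with p
    unfold visitCount
    congr 2
    ext v
    simp only [goodVectors, mem_inter_iff, mem_ofPred_eq, and_assoc]
    rfl
  · refine MeasurableSet.inter (MeasurableSet.inter (measurable_snd (measurableSet_window j σ k))
      (MeasurableSet.inter ?_ ?_)) ?_
    · exact measurableSet_le (hN.comp (measurable_fst.fst.prodMk measurable_snd)) measurable_const
    · exact measurableSet_le (hz.comp measurable_snd).norm measurable_const
    · exact measurableSet_le (measurable_fst.snd.sub (hz.comp measurable_snd)).norm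
        measurable_const

lemma exists_norm_le_of_visitCount_ne_zero (hm : 0 < m) (hn : 0 < n) {j : Fin n} {k s : ℝ}
    {C : ℝ≥0∞} {t r : ℝ} {x : Matrix.SpecialLinearGroup (Fin m ⊕ Fin n) ℝ ⧸ Γ} {α : Fin m → ℝ}
    (h : visitCount Γ e j k s C t r x α ≠ 0) :
    ∃ v ∈ cosetVectors Γ e (uShear j α • x),
      ‖(aFlowStd m n hm hn t).1.mulVec v‖ ≤ Real.exp (-r) := by
  have h' : (goodVectors Γ e j (t - n * (r + k)) k s C x ∩
      {v | ‖α - resonantPoint j v‖ ≤ sepScale m n t}).Nonempty := by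
    rw [nonempty_iff_ne_empty]
    rintro h0
    exact h (by rw [visitCount, h0]; simp)
  obtain ⟨v, hv, hα⟩ := h'
  refine ⟨_, mulVec_mem_cosetVectors _ hv.1, ?_⟩
  rw [Matrix.mulVec_mulVec]
  exact norm_flow_le_of_mem_window hm hn hv.2.1 hα

lemma visitCount_ne_top (hΓ : IsIntegralSubgroup Γ)
    (he : ∃ z : Fin m ⊕ Fin n → ℤ, e = fun i => (z i : ℝ)) (he0 : e ≠ 0)
    (hm : 0 < m) (hn : 0 < n) (j : Fin n) (k s : ℝ) (C : ℝ≥0∞) (t r : ℝ)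
    (x : Matrix.SpecialLinearGroup (Fin m ⊕ Fin n) ℝ ⧸ Γ) (α : Fin m → ℝ) :
    visitCount Γ e j k s C t r x α ≠ ⊤ := by
  set g := aFlowStd m n hm hn t * uShear j α
  have hfin := finite_cosetVectors_inter hΓ he he0 (g • x) (Real.exp (-r))
  have hsub : goodVectors Γ e j (t - n * (r + k)) k s C x ∩
      {v | ‖α - resonantPoint j v‖ ≤ sepScale m n t} ⊆
      (fun v => g.1.mulVec v) ⁻¹' (cosetVectors Γ e (g • x) ∩ closedBall 0 (Real.exp (-r))) :=
    fun v hv => ⟨mulVec_mem_cosetVectors _ hv.1.1, mem_closedBall_zero_iff.2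
      (norm_flow_le_of_mem_window hm hn hv.1.2.1 hv.2)⟩
  have := (hfin.preimage (specialLinear_mulVec_injective g).injOn).subset hsub
  rw [visitCount, Ne, ENat.toENNReal_eq_top, encard_eq_top_iff]
  exact fun h => h this

lemma sepScale_le (hm : 0 < m) (hn : 0 < n) {σ τ : ℝ} (h : σ ≤ τ) :
    sepScale m n τ ≤ sepScale m n σ := by
  unfold sepScale
  gcongr

lemma setLIntegral_visitCount (hΓ : IsIntegralSubgroup Γ)
    (he : ∃ z : Fin m ⊕ Fin n → ℤ, e = fun i => (z i : ℝ)) (he0 : e ≠ 0)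
    (j : Fin n) (k : ℝ) {s : ℝ} (C : ℝ≥0∞) {t : ℝ} (r : ℝ) (hw : sepScale m n t ≤ s)
    (x : Matrix.SpecialLinearGroup (Fin m ⊕ Fin n) ℝ ⧸ Γ) :
    ∫⁻ α in closedBall 0 (2 * s), visitCount Γ e j k s C t r x α =
      (goodVectors Γ e j (t - n * (r + k)) k s C x).encard *
        ENNReal.ofReal ((2 * sepScale m n t) ^ m) := by
  have hU : (goodVectors Γ e j (t - n * (r + k)) k s C x).Countable :=
    (countable_cosetVectors hΓ he he0 x).mono fun v hv => hv.1
  have h := setLIntegral_encard (resonantPoint j) hU (sepScale m n t) (g := 1) measurable_one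
    (volume.restrict (closedBall 0 (2 * s)))
  simp only [Pi.one_apply, mul_one, lintegral_one, Measure.restrict_apply_univ] at h
  unfold visitCount
  rw [h]
  have h2 : ∀ v : goodVectors Γ e j (t - n * (r + k)) k s C x,
      (volume.restrict (closedBall 0 (2 * s))) (closedBall (resonantPoint j v.1)
        (sepScale m n t)) = ENNReal.ofReal ((2 * sepScale m n t) ^ m) := by
    intro v
    rw [Measure.restrict_eq_self, Real.volume_pi_closedBall _ (sepScale_pos t).le,
      Fintype.card_fin]
    refine closedBall_subset_closedBall' ?_
    rw [dist_zero_right]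
    linarith [v.2.2.2.2]
  simp_rw [h2]
  rw [ENNReal.tsum_const]
  rfl

variable (m n) in
/-- The proportion of a ball at the separation scale that leads to a short vector. -/
noncomputable def visitRatio (r : ℝ) : ℝ := Real.exp (-(r * (1 + n / m)))

lemma sepScale_mul_visitRatio (hn : 0 < n) (t r : ℝ) :
    sepScale m n (t - n * r) * visitRatio m n r = sepScale m n t := by
  have hn' : (n : ℝ) ≠ 0 := by exact_mod_cast hn.ne'
  rw [sepScale, visitRatio, sepScale, ← Real.exp_add]
  congr 1
  field_simp
  ring

lemma mul_volume_coreSet_le (hΓ : IsIntegralSubgroup Γ)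
    (he : ∃ z : Fin m ⊕ Fin n → ℤ, e = fun i => (z i : ℝ)) (he0 : e ≠ 0)
    (hm : 0 < m) (hn : 0 < n) (j : Fin n) {k s : ℝ} (C : ℝ≥0∞) {t r : ℝ}
    (hs : Real.exp (2 * k) * sepScale m n (t - n * (r + k)) ≤ s / 2)
    (hw : sepScale m n t ≤ s)
    (x : Matrix.SpecialLinearGroup (Fin m ⊕ Fin n) ℝ ⧸ Γ) :
    ENNReal.ofReal (Real.exp (-(2 * k)) ^ m) * ENNReal.ofReal (visitRatio m n (r + k) ^ m) *
      volume {α ∈ closedBall (0 : Fin m → ℝ) (s / 2) |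
        (aFlowStd m n hm hn (t - n * (r + k)) * uShear j α) • x ∈ coreSet Γ e j k C} ≤
      ∫⁻ α in closedBall 0 (2 * s), visitCount Γ e j k s C t r x α := by
  rw [setLIntegral_visitCount hΓ he he0 j k C r hw]
  have h := volume_coreSet_le (e := e) (C := C) (x := x) hΓ he he0 hm hn (j := j) hs
  have hy : 0 ≤ visitRatio m n (r + k) := (Real.exp_pos _).le
  have hw' := sepScale_mul_visitRatio (m := m) hn t (r + k)
  calc _ ≤ ENNReal.ofReal (Real.exp (-(2 * k)) ^ m) * ENNReal.ofReal (visitRatio m n (r + k) ^ m) *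
        ((goodVectors Γ e j (t - n * (r + k)) k s C x).encard * ENNReal.ofReal
          ((2 * (Real.exp (2 * k) * sepScale m n (t - n * (r + k)))) ^ m)) := by gcongr
    _ = (goodVectors Γ e j (t - n * (r + k)) k s C x).encard *
        (ENNReal.ofReal (Real.exp (-(2 * k)) ^ m) * ENNReal.ofReal (visitRatio m n (r + k) ^ m) *
        ENNReal.ofReal ((2 * (Real.exp (2 * k) * sepScale m n (t - n * (r + k)))) ^ m)) := by ring
    _ = _ := by
      rw [← ENNReal.ofReal_mul (by positivity), ← ENNReal.ofReal_mul (by positivity), ← mul_pow,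
        ← mul_pow, ← hw']
      congr 3
      have : Real.exp (-(2 * k)) * Real.exp (2 * k) = 1 := by rw [← Real.exp_add]; simp
      linear_combination (2 * sepScale m n (t - n * (r + k)) * visitRatio m n (r + k)) * this

lemma correlation_bound {m : ℕ} {s ρ₁ ρ₂ y₁ y₂ q : ℝ} (hρ₁ : 0 < ρ₁) (hρ₂ : 0 < ρ₂)
    (hy₁ : 0 ≤ y₁) (hy₂ : 0 ≤ y₂) (hq : 0 ≤ q) (hs : ρ₁ ≤ s) (hw : ρ₂ * y₂ = ρ₁ * y₁ * q) :
    ((2 * s + ρ₁) / ρ₁) ^ m * ((4 * (ρ₁ * y₁) + ρ₂) / ρ₂) ^ m * (2 * (ρ₂ * y₂)) ^ m ≤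
      (48 * s) ^ m * (y₁ ^ m * y₂ ^ m + y₁ ^ m * q ^ m) := by
  have hs0 : 0 < s := hρ₁.trans_le hs
  have h1 : (2 * s + ρ₁) / ρ₁ * ((4 * (ρ₁ * y₁) + ρ₂) / ρ₂) * (2 * (ρ₂ * y₂)) ≤
      6 * s * (4 * (y₁ * y₂) + y₁ * q) := by
    have h2 : (2 * s + ρ₁) / ρ₁ ≤ 3 * s / ρ₁ := by gcongr; linarith
    calc _ ≤ 3 * s / ρ₁ * ((4 * (ρ₁ * y₁) + ρ₂) / ρ₂) * (2 * (ρ₂ * y₂)) := by gcongr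
      _ = 3 * s / ρ₁ * (8 * ρ₁ * (y₁ * y₂) + 2 * (ρ₂ * y₂)) := by field_simp; ring
      _ = _ := by rw [hw]; field_simp; ring
  rw [← mul_pow, ← mul_pow]
  calc _ ≤ (6 * s * (4 * (y₁ * y₂) + y₁ * q)) ^ m := by gcongr
    _ ≤ (6 * s) ^ m * (2 ^ (m - 1) * ((4 * (y₁ * y₂)) ^ m + (y₁ * q) ^ m)) := by
        rw [mul_pow]
        gcongr
        exact add_pow_le (by positivity) (by positivity) m
    _ ≤ (6 * s) ^ m * (2 ^ m * (4 ^ m * (y₁ ^ m * y₂ ^ m) + 4 ^ m * (y₁ ^ m * q ^ m))) := by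
        have h4 : (1 : ℝ) ≤ 4 ^ m := one_le_pow₀ (by norm_num)
        have h5 : (2 : ℝ) ^ (m - 1) ≤ 2 ^ m := pow_le_pow_right₀ (by norm_num) (by omega)
        rw [mul_pow 4, mul_pow y₁ y₂, mul_pow y₁ q]
        have h6 : y₁ ^ m * q ^ m ≤ 4 ^ m * (y₁ ^ m * q ^ m) :=
          le_mul_of_one_le_left (by positivity) h4
        gcongr ?_ * (?_ * (?_ + ?_))
        exact le_rfl
    _ = _ := by
        rw [show (48 : ℝ) * s = 6 * s * 2 * 4 by ring, mul_pow (6 * s * 2), mul_pow (6 * s) 2]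
        ring

lemma lintegral_visitCount_mul_le (hΓ : IsIntegralSubgroup Γ)
    (he : ∃ z : Fin m ⊕ Fin n → ℤ, e = fun i => (z i : ℝ)) (he0 : e ≠ 0)
    (hm : 0 < m) (hn : 0 < n) (j : Fin n) (k : ℝ) {s : ℝ} (C : ℝ≥0∞) {t₁ t₂ : ℕ} (r₁ r₂ : ℝ)
    (ht : t₁ ≤ t₂) (hs : sepScale m n (t₁ - n * (r₁ + k)) ≤ s)
    (x : Matrix.SpecialLinearGroup (Fin m ⊕ Fin n) ℝ ⧸ Γ) :
    ∫⁻ α, visitCount Γ e j k s C t₁ r₁ x α * visitCount Γ e j k s C t₂ r₂ x α ≤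
      C * C * ENNReal.ofReal ((48 * s) ^ m) *
        (ENNReal.ofReal (visitRatio m n (r₁ + k) ^ m) *
          ENNReal.ofReal (visitRatio m n (r₂ + k) ^ m) +
        ENNReal.ofReal (visitRatio m n (r₁ + k) ^ m) * 2⁻¹ ^ (t₂ - t₁)) := by
  have hc := countable_cosetVectors hΓ he he0 x
  have hs0 : 0 ≤ s := (sepScale_pos _).le.trans hs
  have ht' : (t₁ : ℝ) ≤ t₂ := by exact_mod_cast ht
  have h := lintegral_encard_mul_encard_le (z := resonantPoint j)
    (hc.mono fun v hv => hv.1) (hc.mono fun v hv => hv.1)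
    (isPacked_goodVectors (e := e) j (t₁ - n * (r₁ + k)) k s C x)
    (isPacked_goodVectors (e := e) j (t₂ - n * (r₂ + k)) k s C x)
    (sepScale_pos _) (sepScale_pos _) (sepScale_pos t₂).le (sepScale_le hm hn ht') hs0
    (fun v hv => hv.2.2.2)
  refine h.trans ?_
  rw [mul_assoc (C * C)]
  gcongr
  set q : ℝ := Real.exp (-((t₂ - t₁ : ℝ) * (1 / m + 1 / n))) with hq
  have hy : ∀ r, 0 ≤ visitRatio m n r := fun r => (Real.exp_pos _).le
  have hwq : sepScale m n t₂ = sepScale m n t₁ * q := by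
    rw [sepScale, sepScale, hq, ← Real.exp_add]
    congr 1
    ring
  have h2 := correlation_bound (m := m) (q := q) (sepScale_pos (t₁ - n * (r₁ + k)))
    (sepScale_pos (t₂ - n * (r₂ + k))) (hy (r₁ + k)) (hy (r₂ + k)) (Real.exp_pos _).le hs
    (by rw [sepScale_mul_visitRatio hn, sepScale_mul_visitRatio hn, hwq])
  rw [sepScale_mul_visitRatio hn, sepScale_mul_visitRatio hn] at h2
  refine (ENNReal.ofReal_le_ofReal h2).trans ?_
  have hq2 : q ^ m ≤ 2⁻¹ ^ (t₂ - t₁) := by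
    have hm' : (m : ℝ) ≠ 0 := by exact_mod_cast hm.ne'
    calc q ^ m = Real.exp (-((t₂ - t₁ : ℝ) * (1 + m / n))) := by
          rw [hq, ← Real.exp_nat_mul]; congr 1; field_simp
      _ ≤ Real.exp (-((t₂ - t₁ : ℕ) : ℝ)) := by
          rw [Nat.cast_sub ht]
          gcongr
          refine le_mul_of_one_le_right (sub_nonneg.2 ht') ?_
          have : (0 : ℝ) ≤ m / n := by positivity
          linarith
      _ = (Real.exp (-1)) ^ (t₂ - t₁) := by rw [← Real.exp_nat_mul]; congr 1; ring
      _ ≤ _ := by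
          gcongr
          rw [Real.exp_neg]
          gcongr
          linarith [Real.add_one_le_exp 1]
  have hyp : ∀ r, 0 ≤ visitRatio m n r ^ m := fun r => pow_nonneg (hy r) m
  rw [ENNReal.ofReal_mul (by positivity)]
  gcongr
  rw [ENNReal.ofReal_add (mul_nonneg (hyp _) (hyp _)) (mul_nonneg (hyp _) (by positivity)),
    ENNReal.ofReal_mul (hyp _), ENNReal.ofReal_mul (hyp _)]
  gcongr
  refine (ENNReal.ofReal_le_ofReal hq2).trans_eq ?_
  rw [ENNReal.ofReal_pow (by norm_num), ENNReal.ofReal_inv_of_pos (by norm_num)]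
  simp

end visits

section divergence

variable {m n : ℕ}

lemma exists_lt_measure_coreSet {Γ : Subgroup (Matrix.SpecialLinearGroup (Fin m ⊕ Fin n) ℝ)}
    {e : Fin m ⊕ Fin n → ℝ} (hΓ : IsIntegralSubgroup Γ)
    (he : ∃ z : Fin m ⊕ Fin n → ℤ, e = fun i => (z i : ℝ)) (he0 : e ≠ 0) {j : Fin n}
    (hj : ∀ x : Matrix.SpecialLinearGroup (Fin m ⊕ Fin n) ℝ ⧸ Γ,
      ∃ v ∈ cosetVectors Γ e x, v (Sum.inr j) ≠ 0)
    (μ : Measure (Matrix.SpecialLinearGroup (Fin m ⊕ Fin n) ℝ ⧸ Γ)) {b : ℝ≥0∞}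
    (hb : b < μ univ) : ∃ k C : ℕ, b < μ (coreSet Γ e j k C) := by
  set A : ℕ → Set (Matrix.SpecialLinearGroup (Fin m ⊕ Fin n) ℝ ⧸ Γ) := fun k =>
    {y | ∃ v ∈ cosetVectors Γ e y, ‖v‖ ≤ Real.exp k ∧ Real.exp (-k) ≤ |v (Sum.inr j)|} with hA
  have hAmono : Monotone A := by
    rintro k l hkl y ⟨v, hv, h1, h2⟩
    have hkl' : (k : ℝ) ≤ l := by exact_mod_cast hkl
    exact ⟨v, hv, h1.trans (by gcongr), le_trans (by gcongr) h2⟩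
  have hAuniv : ⋃ k, A k = univ := by
    refine eq_univ_of_forall fun x => ?_
    obtain ⟨v, hv, hvj⟩ := hj x
    obtain ⟨k, hk⟩ := exists_nat_ge (max (Real.log ‖v‖) (-Real.log |v (Sum.inr j)|))
    have hv0 : 0 < ‖v‖ := norm_pos_iff.2 fun h => hvj (by simp [h])
    refine mem_iUnion.2 ⟨k, v, hv, ?_, ?_⟩
    · rw [← Real.log_le_iff_le_exp hv0]
      exact (le_max_left _ _).trans hk
    · rw [← Real.le_log_iff_exp_le (abs_pos.2 hvj)]
      linarith [(le_max_right _ _).trans hk]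
  have h1 := tendsto_measure_iUnion_atTop (μ := μ) hAmono
  rw [hAuniv] at h1
  obtain ⟨k, hk⟩ := (h1.eventually (lt_mem_nhds hb)).exists
  have hCmono : Monotone fun C : ℕ => coreSet Γ e j k C := by
    rintro C D hCD y ⟨h2, h3⟩
    exact ⟨h2, h3.trans (by gcongr)⟩
  have hCunion : ⋃ C : ℕ, coreSet Γ e j k C = A k := by
    ext y
    simp only [mem_iUnion]
    refine ⟨fun ⟨C, h⟩ => h.1, fun h => ?_⟩
    have hfin := finite_cosetVectors_inter hΓ he he0 y ((Real.exp (2 * k) + 1) * Real.exp k)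
    obtain ⟨C, hC⟩ := ENNReal.exists_nat_gt (r := ((cosetVectors Γ e y ∩
      closedBall 0 ((Real.exp (2 * k) + 1) * Real.exp k)).encard : ℝ≥0∞))
      (by rw [Ne, ENat.toENNReal_eq_top, encard_eq_top_iff]; exact fun h => h hfin)
    exact ⟨C, h, hC.le⟩
  have h2 := tendsto_measure_iUnion_atTop (μ := μ) hCmono
  rw [hCunion] at h2
  obtain ⟨C, hC⟩ := (h2.eventually (lt_mem_nhds hk)).exists
  exact ⟨k, C, hC⟩

lemma visitRatio_pow (hm : 0 < m) (r : ℝ) :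
    visitRatio m n r ^ m = Real.exp (-(r * (m + n))) := by
  have hm' : (m : ℝ) ≠ 0 := by exact_mod_cast hm.ne'
  rw [visitRatio, ← Real.exp_nat_mul]
  congr 1
  field_simp

lemma tsum_visitRatio_eq_top (hm : 0 < m) (hn : 0 < n) {N : ℕ}
    {μ : Measure (Matrix.SpecialLinearGroup (Fin m ⊕ Fin n) ℝ ⧸
      congruenceSubgroupR (Fin m ⊕ Fin n) N (stdE1Mod m n N))} [IsProbabilityMeasure μ]
    (hμ : ∀ g : Matrix.SpecialLinearGroup (Fin m ⊕ Fin n) ℝ, Measure.map (fun x => g • x) μ = μ)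
    {r : ℕ → ℝ} (hr : ∀ t, 1 ≤ r t) (hdiv : ∑' t, μ {x | r t ≤ DeltaCusp m n N x} = ⊤) (k : ℝ) :
    ∑' t, ENNReal.ofReal (visitRatio m n (r t + k) ^ m) = ⊤ := by
  have : NeZero m := ⟨hm.ne'⟩
  have : NeZero n := ⟨hn.ne'⟩
  have : Nontrivial (Fin m ⊕ Fin n) := ⟨Sum.inl 0, Sum.inr 0, Sum.inl_ne_inr⟩
  set d := Fintype.card (Fin m ⊕ Fin n) with hd
  have hd' : (d : ℝ) = m + n := by rw [hd]; simp
  set B : ℝ≥0∞ := d * (ENNReal.ofReal (4 * 8 ^ d * Real.exp ((1 + k) * d)) * 2) with hB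
  have hBtop : B ≠ ⊤ := by
    rw [hB]
    exact ENNReal.mul_ne_top (by simp) (ENNReal.mul_ne_top ENNReal.ofReal_ne_top (by simp))
  have key : ∀ t, μ {x | r t ≤ DeltaCusp m n N x} ≤
      B * ENNReal.ofReal (visitRatio m n (r t + k) ^ m) := by
    intro t
    have h1 : Real.exp (1 - r t) ≤ 1 := Real.exp_le_one_iff.2 (by linarith [hr t])
    have h2 := measure_exists_norm_le (isIntegralSubgroup_congruenceSubgroupR N (stdE1Mod m n N))
      (exists_int_stdE1 m n) (stdE1_ne_zero hm) hμ (Real.exp_pos _) h1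
    refine (measure_mono fun x hx => exists_norm_le_of_le_DeltaCusp hm hx).trans (h2.trans_eq ?_)
    have h3 : ENNReal.ofReal (4 * 8 ^ d * Real.exp (1 - r t) ^ d) =
        ENNReal.ofReal (4 * 8 ^ d * Real.exp ((1 + k) * d)) *
          ENNReal.ofReal (visitRatio m n (r t + k) ^ m) := by
      rw [← ENNReal.ofReal_mul (by positivity), visitRatio_pow hm, ← hd', mul_assoc (4 * 8 ^ d : ℝ),
        ← Real.exp_add, ← Real.exp_nat_mul]
      congr 3
      ring
    rw [hB, ← hd, h3]
    ring
  have h3 : (⊤ : ℝ≥0∞) ≤ B * ∑' t, ENNReal.ofReal (visitRatio m n (r t + k) ^ m) := by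
    rw [← hdiv, ← ENNReal.tsum_mul_left]
    exact ENNReal.tsum_le_tsum key
  by_contra h
  exact (ENNReal.mul_lt_top hBtop.lt_top (lt_top_iff_ne_top.2 h)).not_ge h3

lemma tsum_ite_visitRatio_eq_top (hm : 0 < m) (hn : 0 < n) {r : ℕ → ℝ} {k s : ℝ} (hs : 0 < s)
    (h : ∑' t, ENNReal.ofReal (visitRatio m n (r t + k) ^ m) = ⊤) :
    ∑' t : ℕ, (if Real.exp (2 * k) * sepScale m n (t - n * (r t + k)) ≤ s then
      ENNReal.ofReal (visitRatio m n (r t + k) ^ m) else 0) = ⊤ := by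
  have hm' : (0 : ℝ) < m := by exact_mod_cast hm
  have hn' : (0 : ℝ) < n := by exact_mod_cast hn
  set M : ℝ := (2 * k - Real.log s) * (m * n / (m + n)) with hM
  set q : ℝ≥0∞ := ENNReal.ofReal (Real.exp (-1)) with hq
  have hq1 : q < 1 := by
    rw [hq, ENNReal.ofReal_lt_one]
    simp
  set B : ℝ≥0∞ := ENNReal.ofReal (Real.exp (M * ((m + n) / n)))
  set f : ℕ → ℝ≥0∞ := fun t => if Real.exp (2 * k) * sepScale m n (t - n * (r t + k)) ≤ s then
      ENNReal.ofReal (visitRatio m n (r t + k) ^ m) else 0 with hf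
  have key : ∀ t, ENNReal.ofReal (visitRatio m n (r t + k) ^ m) ≤ f t + B * q ^ t := by
    intro t
    by_cases ht : Real.exp (2 * k) * sepScale m n (t - n * (r t + k)) ≤ s
    · simp [hf, ht]
    · have h1 : t - n * (r t + k) < M := by
        rw [not_le, sepScale, ← Real.exp_add, ← Real.log_lt_iff_lt_exp hs] at ht
        have h2 : (t - n * (r t + k)) / m + (t - n * (r t + k)) / n =
          (t - n * (r t + k)) / (m * n / (m + n)) := by field_simp; ring
        rw [h2] at ht
        rw [hM, ← div_lt_iff₀ (by positivity)]
        linarith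
      rw [hf]
      simp only [ht, if_false, zero_add]
      rw [hq, ← ENNReal.ofReal_pow (Real.exp_pos _).le, ← ENNReal.ofReal_mul (Real.exp_pos _).le,
        visitRatio_pow hm, ← Real.exp_nat_mul, ← Real.exp_add]
      refine ENNReal.ofReal_le_ofReal (Real.exp_le_exp.2 ?_)
      have h3 : (t - M) * ((m + n) / n) ≤ (r t + k) * (m + n) := by
        rw [mul_div_assoc', div_le_iff₀ hn']
        nlinarith
      have h4 : (t : ℝ) ≤ t * ((m + n) / n) := by
        refine le_mul_of_one_le_right (by positivity) ?_
        rw [one_le_div hn']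
        linarith
      linarith
  by_contra hne
  have h5 : ∑' t, (f t + B * q ^ t) ≠ ⊤ := by
    rw [ENNReal.tsum_add, ENNReal.tsum_mul_left, ENNReal.tsum_geometric]
    refine ENNReal.add_ne_top.2 ⟨hne, ENNReal.mul_ne_top ENNReal.ofReal_ne_top ?_⟩
    rw [Ne, ENNReal.inv_eq_top, tsub_eq_zero_iff_le, not_le]
    exact hq1
  exact h5 (top_le_iff.1 (h ▸ ENNReal.tsum_le_tsum key))

end divergence

section density

variable {ι : Type*} [Fintype ι] [DecidableEq ι] {Γ : Subgroup (Matrix.SpecialLinearGroup ι ℝ)}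
  {μ : Measure (Matrix.SpecialLinearGroup ι ℝ ⧸ Γ)} {m : ℕ}
  {u : (Fin m → ℝ) → Matrix.SpecialLinearGroup ι ℝ}

lemma measurableSet_smul_quotient (hΓ : IsIntegralSubgroup Γ) (hu : Continuous u)
    {Y : Set (Matrix.SpecialLinearGroup ι ℝ ⧸ Γ)} (hY : MeasurableSet Y) :
    MeasurableSet {p : (Matrix.SpecialLinearGroup ι ℝ ⧸ Γ) × (Fin m → ℝ) | u p.2 • p.1 ∈ Y} :=
  measurable_smul_quotient hΓ hu hY

/-- Points from which the orbit of a ball leaves `Y` with proportion more than `η`. -/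
def escapingSet (u : (Fin m → ℝ) → Matrix.SpecialLinearGroup ι ℝ)
    (Y : Set (Matrix.SpecialLinearGroup ι ℝ ⧸ Γ)) (η : ℝ≥0∞) (s : ℝ) :
    Set (Matrix.SpecialLinearGroup ι ℝ ⧸ Γ) :=
  {x | η * volume (closedBall (0 : Fin m → ℝ) s) <
    volume.restrict (closedBall (0 : Fin m → ℝ) s) {β | u β • x ∈ Yᶜ}}

lemma measurableSet_escapingSet (hΓ : IsIntegralSubgroup Γ) (hu : Continuous u)
    {Y : Set (Matrix.SpecialLinearGroup ι ℝ ⧸ Γ)} (hY : MeasurableSet Y) (η : ℝ≥0∞) (s : ℝ) :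
    MeasurableSet (escapingSet u Y η s) :=
  measurableSet_lt measurable_const
    (measurable_measure_prodMk_left (measurableSet_smul_quotient hΓ hu hY.compl))

lemma ae_eventually_notMem_escapingSet (hΓ : IsIntegralSubgroup Γ) (hu : Continuous u)
    (hadd : ∀ α β, u (α + β) = u α * u β)
    {Y : Set (Matrix.SpecialLinearGroup ι ℝ ⧸ Γ)} (hY : MeasurableSet Y) {η : ℝ≥0∞} (hη : η ≠ 0)
    (x : Matrix.SpecialLinearGroup ι ℝ ⧸ Γ) :
    ∀ᵐ α : Fin m → ℝ, ∀ᶠ s in 𝓝[>] (0 : ℝ), u α • x ∉ Y ∩ escapingSet u Y η s := by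
  set Z : Set (Fin m → ℝ) := {α | u α • x ∈ Yᶜ} with hZ
  have hZm : MeasurableSet Z :=
    (measurableSet_smul_quotient hΓ hu hY.compl).preimage measurable_prodMk_left
  filter_upwards [Besicovitch.ae_tendsto_measure_inter_div_of_measurableSet volume hZm] with α hα
  by_cases hαZ : α ∈ Z
  · exact Eventually.of_forall fun s h => hαZ h.1
  rw [indicator_of_notMem hαZ] at hα
  filter_upwards [hα.eventually (gt_mem_nhds (pos_iff_ne_zero.2 hη)), self_mem_nhdsWithin]
    with s hs hs0
  rintro ⟨-, h⟩
  rw [escapingSet, mem_ofPred_eq] at h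
  refine h.not_ge ?_
  have hball : volume (closedBall α s) = volume (closedBall (0 : Fin m → ℝ) s) := by
    rw [Measure.addHaar_closedBall_center]
  have hpos : volume (closedBall (0 : Fin m → ℝ) s) ≠ 0 :=
    (measure_closedBall_pos _ _ hs0).ne'
  rw [hball, ENNReal.div_lt_iff (Or.inl hpos) (Or.inl measure_closedBall_lt_top.ne)] at hs
  rw [Measure.restrict_apply' measurableSet_closedBall]
  refine le_trans (le_of_eq ?_) hs.le
  rw [← measure_preimage_add_right volume α (Z ∩ closedBall α s)]
  congr 1
  ext β
  simp [hZ, hadd, mul_smul]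

lemma tendsto_measure_escapingSet [IsProbabilityMeasure μ] (hΓ : IsIntegralSubgroup Γ)
    (hμ : ∀ g : Matrix.SpecialLinearGroup ι ℝ, Measure.map (fun x => g • x) μ = μ)
    (hu : Continuous u) (hadd : ∀ α β, u (α + β) = u α * u β)
    {Y : Set (Matrix.SpecialLinearGroup ι ℝ ⧸ Γ)} (hY : MeasurableSet Y) {η : ℝ≥0∞} (hη : η ≠ 0)
    {s : ℕ → ℝ} (hs : Tendsto s atTop (𝓝[>] 0)) :
    Tendsto (fun i => μ (Y ∩ escapingSet u Y η (s i))) atTop (𝓝 0) := by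
  set ν : Measure (Fin m → ℝ) := volume.restrict (closedBall 0 1) with hν
  have : IsFiniteMeasure ν := ⟨by simp [hν]⟩
  have hν0 : ν univ ≠ 0 := by
    rw [hν, Measure.restrict_apply_univ]
    exact (measure_closedBall_pos _ _ one_pos).ne'
  have hm : ∀ i, MeasurableSet (Y ∩ escapingSet u Y η (s i)) := fun i =>
    hY.inter (measurableSet_escapingSet hΓ hu hY _ _)
  have h1 : ∀ x : Matrix.SpecialLinearGroup ι ℝ ⧸ Γ,
      Tendsto (fun i => ν {α | u α • x ∈ Y ∩ escapingSet u Y η (s i)}) atTop (𝓝 0) := by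
    intro x
    have h2 := tendsto_measure_of_ae_tendsto_indicator_of_isFiniteMeasure atTop (μ := ν)
      (A := ∅) (As := fun i => {α | u α • x ∈ Y ∩ escapingSet u Y η (s i)}) MeasurableSet.empty
      (fun i => (measurableSet_smul_quotient hΓ hu (hm i)).preimage measurable_prodMk_left) ?_
    · simpa using h2
    · filter_upwards [ae_restrict_of_ae (ae_eventually_notMem_escapingSet hΓ hu hadd hY hη x)]
        with α hα
      filter_upwards [hs.eventually hα] with i hi
      simpa using hi
  have h3 : Tendsto (fun i => ∫⁻ x, ν {α | u α • x ∈ Y ∩ escapingSet u Y η (s i)} ∂μ) atTop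
      (𝓝 (∫⁻ _, 0 ∂μ)) := by
    refine tendsto_lintegral_of_dominated_convergence (fun _ => ν univ) (fun i => ?_)
      (fun i => ae_of_all _ fun x => measure_mono (subset_univ _)) ?_ (ae_of_all _ h1)
    · exact measurable_measure_prodMk_left (measurableSet_smul_quotient hΓ hu (hm i))
    · simp
  simp_rw [lintegral_measure_smul_mem hΓ hμ hu ν (hm _), lintegral_zero] at h3
  have h4 := ENNReal.Tendsto.mul_const (b := (ν univ)⁻¹) h3 (Or.inr (ENNReal.inv_ne_top.2 hν0))
  simp_rw [mul_assoc, ENNReal.mul_inv_cancel hν0 (measure_ne_top ν univ), mul_one, zero_mul] at h4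
  exact h4

end density

section excursions

lemma ENNReal.frequently_ne_zero_of_tsum_eq_top {f : ℕ → ℝ≥0∞} (hf : ∀ t, f t ≠ ⊤)
    (h : ∑' t, f t = ⊤) : ∃ᶠ t in atTop, f t ≠ 0 := by
  intro h0
  obtain ⟨N, hN⟩ := eventually_atTop.1 h0
  have h1 : ∑' t, f t = ∑ t ∈ Finset.range N, f t := tsum_eq_sum fun t ht =>
    not_not.1 (hN t (by simpa using ht))
  rw [h1, ENNReal.sum_eq_top] at h
  obtain ⟨t, -, ht⟩ := h
  exact hf t ht

lemma MeasureTheory.mul_le_setLIntegral_measure {X E : Type*} [MeasurableSpace X]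
    [MeasurableSpace E] {μ : Measure X} {ν : Measure E} [IsFiniteMeasure ν]
    {A : X → Set E} (hA : Measurable fun x => ν (A x)) {Y : Set X} {a b : ℝ≥0∞}
    (ha : a ≠ ⊤) (hY : a + b ≤ μ Y) (hAc : ∫⁻ x, ν (A x)ᶜ ∂μ ≤ a * ν univ) :
    b * ν univ ≤ ∫⁻ x in Y, ν (A x) ∂μ := by
  have h1 : μ Y * ν univ ≤ ∫⁻ x in Y, ν (A x) ∂μ + a * ν univ := by
    calc μ Y * ν univ = ∫⁻ _ in Y, ν univ ∂μ := by rw [setLIntegral_const, mul_comm]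
      _ ≤ ∫⁻ x in Y, (ν (A x) + ν (A x)ᶜ) ∂μ := lintegral_mono fun x => by
          rw [← union_compl_self (A x)]
          exact measure_union_le _ _
      _ = ∫⁻ x in Y, ν (A x) ∂μ + ∫⁻ x in Y, ν (A x)ᶜ ∂μ := lintegral_add_left hA _
      _ ≤ _ := by
          gcongr
          exact (setLIntegral_le_lintegral _ _).trans hAc
  have h2 : b * ν univ + a * ν univ ≤ ∫⁻ x in Y, ν (A x) ∂μ + a * ν univ := by
    rw [← add_mul, add_comm b]
    exact le_trans (by gcongr) h1
  exact ENNReal.le_of_add_le_add_right (ENNReal.mul_ne_top ha (measure_ne_top ν _)) h2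

variable {m n : ℕ} {Γ : Subgroup (Matrix.SpecialLinearGroup (Fin m ⊕ Fin n) ℝ)}
  {e : Fin m ⊕ Fin n → ℝ} {μ : Measure (Matrix.SpecialLinearGroup (Fin m ⊕ Fin n) ℝ ⧸ Γ)}

lemma measurableSet_frequently_exists_norm_le (hΓ : IsIntegralSubgroup Γ) (hm : 0 < m)
    (hn : 0 < n) (r : ℕ → ℝ) : MeasurableSet
      {x : Matrix.SpecialLinearGroup (Fin m ⊕ Fin n) ℝ ⧸ Γ | ∃ᶠ t : ℕ in atTop,
        ∃ v ∈ cosetVectors Γ e x, ‖(aFlowStd m n hm hn t).1.mulVec v‖ ≤ Real.exp (-r t)} := by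
  have h : ∀ t : ℕ, MeasurableSet {x : Matrix.SpecialLinearGroup (Fin m ⊕ Fin n) ℝ ⧸ Γ |
      ∃ v ∈ cosetVectors Γ e x, ‖(aFlowStd m n hm hn t).1.mulVec v‖ ≤ Real.exp (-r t)} := by
    intro t
    refine measurableSet_exists_cosetVectors' hΓ
      (B := {v | ‖(aFlowStd m n hm hn t).1.mulVec v‖ ≤ Real.exp (-r t)}) ?_
    exact measurableSet_le (Continuous.matrix_mulVec continuous_const
      continuous_id).norm.measurable measurable_const
  have h2 := MeasurableSet.measurableSet_limsup h
  convert h2 using 1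
  ext x
  rw [mem_limsup_iff_frequently_mem]
  rfl

lemma measurable_ite_visitCount (hΓ : IsIntegralSubgroup Γ) (j : Fin n) (k s : ℝ) (C : ℝ≥0∞)
    (t r : ℝ) (p : Prop) [Decidable p] :
    Measurable fun ω : (Matrix.SpecialLinearGroup (Fin m ⊕ Fin n) ℝ ⧸ Γ) × (Fin m → ℝ) =>
      if p then visitCount Γ e j k s C t r ω.1 ω.2 else 0 := by
  split_ifs
  · exact measurable_visitCount hΓ j k s C t r
  · exact measurable_const

/-- The second moment method on the product of `Y` with a small ball of shears. -/
lemma le_of_visitCount (hΓ : IsIntegralSubgroup Γ)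
    (he : ∃ z : Fin m ⊕ Fin n → ℤ, e = fun i => (z i : ℝ)) (he0 : e ≠ 0)
    (hm : 0 < m) (hn : 0 < n) [IsProbabilityMeasure μ]
    (hμ : ∀ g : Matrix.SpecialLinearGroup (Fin m ⊕ Fin n) ℝ, Measure.map (fun x => g • x) μ = μ)
    {r : ℕ → ℝ} (hr : ∀ t, 0 ≤ r t) (j : Fin n) {k s : ℝ} (hk : 0 ≤ k) (hs : 0 < s) {C : ℝ≥0∞}
    (hC : C ≠ ⊤)
    (hdiv : ∑' t, ENNReal.ofReal (visitRatio m n (r t + k) ^ m) = ⊤)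
    {Y : Set (Matrix.SpecialLinearGroup (Fin m ⊕ Fin n) ℝ ⧸ Γ)} {b : ℝ≥0∞} (hb : b ≠ ⊤)
    (hYb : b + b ≤ μ Y) (hcore : μ (coreSet Γ e j k C)ᶜ ≤ b) {η : ℝ≥0∞}
    (hη : ∀ x ∈ Y, volume.restrict (closedBall 0 (2 * s)) {α : Fin m → ℝ | ∃ᶠ t : ℕ in atTop,
      ∃ v ∈ cosetVectors Γ e (uShear j α • x),
        ‖(aFlowStd m n hm hn t).1.mulVec v‖ ≤ Real.exp (-r t)} ≤
      η * volume (closedBall (0 : Fin m → ℝ) (2 * s)))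
    {τ : ℝ≥0∞} (hτ0 : τ ≠ 0) (hτ : τ ≠ ⊤) :
    ENNReal.ofReal (Real.exp (-(2 * k)) ^ m) * b * ENNReal.ofReal (s ^ m) ≤
      C * C * ENNReal.ofReal ((48 * s) ^ m) / τ + τ * (η * ENNReal.ofReal ((4 * s) ^ m)) := by
  classical
  set p : ℕ → Prop := fun t => Real.exp (2 * k) * sepScale m n (t - n * (r t + k)) ≤ s / 2 with hp
  have hsep : ∀ t, p t → sepScale m n (t - n * (r t + k)) ≤ s := fun t ht => by
    have h1 : 1 ≤ Real.exp (2 * k) := Real.one_le_exp (by linarith)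
    have h2 := (sepScale_pos (m := m) (n := n) (t - n * (r t + k))).le
    simp only [hp] at ht
    nlinarith
  have hsep' : ∀ t, p t → sepScale m n t ≤ s := fun t ht => by
    refine le_trans (sepScale_le hm hn ?_) (hsep t ht)
    have : 0 ≤ (n : ℝ) * (r t + k) := mul_nonneg (by positivity) (add_nonneg (hr t) hk)
    linarith
  set ν : Measure (Fin m → ℝ) := volume.restrict (closedBall 0 (2 * s)) with hν
  have : IsFiniteMeasure ν :=
    ⟨by rw [hν, Measure.restrict_apply_univ]; exact measure_closedBall_lt_top⟩
  set P := (μ.restrict Y).prod ν with hP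
  set x : ℕ → ℝ≥0∞ := fun t =>
    if p t then ENNReal.ofReal (visitRatio m n (r t + k) ^ m) else 0 with hx
  set f : ℕ → (Matrix.SpecialLinearGroup (Fin m ⊕ Fin n) ℝ ⧸ Γ) × (Fin m → ℝ) → ℝ≥0∞ := fun t ω =>
    if p t then visitCount Γ e j k s C t (r t) ω.1 ω.2 else 0 with hf
  have hfm : ∀ t, Measurable (f t) := fun t => measurable_ite_visitCount hΓ j k s C t (r t) (p t)
  have hball : ∀ a : ℝ, 0 ≤ a →
      volume (closedBall (0 : Fin m → ℝ) a) = ENNReal.ofReal ((2 * a) ^ m) := fun a ha => by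
    rw [Real.volume_pi_closedBall _ ha, Fintype.card_fin]
  have hlower : ∀ t, ENNReal.ofReal (Real.exp (-(2 * k)) ^ m) * b * ENNReal.ofReal (s ^ m) * x t ≤
      ∫⁻ ω, f t ω ∂P := by
    intro t
    by_cases ht : p t
    · simp only [hx, hf, ht, if_true]
      rw [hP, lintegral_prod _ (measurable_visitCount hΓ j k s C t (r t)).aemeasurable]
      set ν' : Measure (Fin m → ℝ) := volume.restrict (closedBall 0 (s / 2)) with hν'
      have hν'u : ν' univ = ENNReal.ofReal (s ^ m) := by
        rw [hν', Measure.restrict_apply_univ, hball _ (by positivity)]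
        congr 2
        ring
      have hK := measurableSet_coreSet (e := e) hΓ j k C
      have hu : Continuous fun α : Fin m → ℝ =>
          aFlowStd m n hm hn (t - n * (r t + k)) * uShear j α := by
        have hcont := continuous_uShear (m := m) j
        exact continuous_const.mul hcont
      have : IsFiniteMeasure ν' := ⟨by rw [hν'u]; exact ENNReal.ofReal_lt_top⟩
      have hAm : Measurable fun y : Matrix.SpecialLinearGroup (Fin m ⊕ Fin n) ℝ ⧸ Γ => ν' {α |
          (aFlowStd m n hm hn (t - n * (r t + k)) * uShear j α) • y ∈ coreSet Γ e j k C} :=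
        measurable_measure_prodMk_left (measurableSet_smul_quotient hΓ hu hK)
      have h1 := MeasureTheory.mul_le_setLIntegral_measure (μ := μ) (ν := ν')
        (A := fun x => {α | (aFlowStd m n hm hn (t - n * (r t + k)) * uShear j α) • x ∈
          coreSet Γ e j k C})
        hAm hb hYb (by
          have h2 := lintegral_measure_smul_mem hΓ hμ hu ν' hK.compl
          exact h2.trans_le (by gcongr))
      rw [hν'u] at h1
      calc _ = ENNReal.ofReal (Real.exp (-(2 * k)) ^ m) *
            ENNReal.ofReal (visitRatio m n (r t + k) ^ m) * (b * ENNReal.ofReal (s ^ m)) := by ring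
        _ ≤ ENNReal.ofReal (Real.exp (-(2 * k)) ^ m) *
            ENNReal.ofReal (visitRatio m n (r t + k) ^ m) * _ := by gcongr
        _ = _ := (lintegral_const_mul _ hAm).symm
        _ ≤ _ := by
          refine lintegral_mono fun y => ?_
          refine le_trans ?_ (mul_volume_coreSet_le hΓ he he0 hm hn j C ht (hsep' t ht) y)
          refine mul_le_mul' le_rfl ?_
          rw [hν', Measure.restrict_apply' measurableSet_closedBall]
          exact measure_mono fun α h => ⟨h.2, h.1⟩
    · simp [hx, ht]
  have hupper : ∀ i l, i ≤ l → ∫⁻ ω, f i ω * f l ω ∂P ≤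
      C * C * ENNReal.ofReal ((48 * s) ^ m) * (x i * x l + x i * (2⁻¹) ^ (l - i)) := by
    intro i l hil
    by_cases hi : p i
    swap
    · simp [hf, hi]
    by_cases hl : p l
    swap
    · simp [hf, hl]
    rw [hP, lintegral_prod (fun ω => f i ω * f l ω) ((hfm i).mul (hfm l)).aemeasurable]
    simp only [hx, hf, hi, hl, if_true]
    refine (lintegral_mono fun y => (setLIntegral_le_lintegral _ _).trans
      (lintegral_visitCount_mul_le hΓ he he0 hm hn j k C (r i) (r l) hil (hsep i hi) y)).trans ?_
    rw [setLIntegral_const]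
    exact mul_le_of_le_one_right' prob_le_one
  have hmoment := le_of_secondMoment (P := P) hfm (x := x)
    (fun t => by simp only [hx]; split_ifs <;> simp)
    (tsum_ite_visitRatio_eq_top hm hn (half_pos hs) hdiv)
    (ENNReal.mul_ne_top (ENNReal.mul_ne_top hC hC) ENNReal.ofReal_ne_top) hlower hupper hτ0 hτ
  refine hmoment.trans ?_
  gcongr
  rw [hP, Measure.prod_apply (measurableSet_eq_fun (Measurable.tsum hfm) measurable_const)]
  calc _ ≤ ∫⁻ _ in Y, η * ENNReal.ofReal ((4 * s) ^ m) ∂μ := by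
        refine setLIntegral_mono measurable_const fun y hy => ?_
        have h3 := hη y hy
        rw [hball _ (by positivity), show 2 * (2 * s) = 4 * s by ring] at h3
        refine le_trans (measure_mono fun α hα => ?_) h3
        have h4 := ENNReal.frequently_ne_zero_of_tsum_eq_top (f := fun t => f t (y, α)) (fun t => by
          simp only [hf]
          split_ifs
          · exact visitCount_ne_top hΓ he he0 hm hn j k s C t (r t) y α
          · simp) hα
        refine h4.mono fun t ht => ?_
        simp only [hf] at ht
        exact exists_norm_le_of_visitCount_ne_zero hm hn (C := C) (k := k) (s := s)
          fun h5 => ht (by simp [h5])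
    _ ≤ _ := by
        rw [setLIntegral_const]
        exact mul_le_of_le_one_right' prob_le_one

end excursions

section conclusion

variable {m n : ℕ} {Γ : Subgroup (Matrix.SpecialLinearGroup (Fin m ⊕ Fin n) ℝ)}
  {e : Fin m ⊕ Fin n → ℝ} {μ : Measure (Matrix.SpecialLinearGroup (Fin m ⊕ Fin n) ℝ ⧸ Γ)}

lemma ENNReal.exists_forall_add_lt_mul {c D : ℝ≥0∞} (hc0 : c ≠ 0) (hc : c ≠ ⊤) (hD : D ≠ ⊤)
    (hD0 : D ≠ 0) {L : ℝ≥0∞} (hL0 : L ≠ 0) (hL : L ≠ ⊤) :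
    ∃ η τ : ℝ≥0∞, η ≠ 0 ∧ τ ≠ 0 ∧ τ ≠ ⊤ ∧ ∀ S, S ≠ 0 → S ≠ ⊤ →
      D * S / τ + τ * (η * (L * S)) < c * S := by
  have hc4 : c / 2 / 2 ≠ 0 := by simp [hc0]
  have hc4' : c / 2 / 2 ≠ ⊤ := ENNReal.div_ne_top (ENNReal.div_ne_top hc two_ne_zero) two_ne_zero
  have hτ : D / (c / 2 / 2) ≠ ⊤ := ENNReal.div_ne_top hD hc4
  have hτ0 : D / (c / 2 / 2) ≠ 0 := ENNReal.div_ne_zero.2 ⟨hD0, hc4'⟩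
  refine ⟨c / 2 / 2 / (D / (c / 2 / 2) * L), D / (c / 2 / 2),
    ENNReal.div_ne_zero.2 ⟨hc4, ENNReal.mul_ne_top hτ hL⟩, hτ0, hτ, fun S hS0 hS => ?_⟩
  have h1 : D / (D / (c / 2 / 2)) = c / 2 / 2 := by
    exact ENNReal.div_div_cancel hD0 hD
  have h2 : D / (c / 2 / 2) * (c / 2 / 2 / (D / (c / 2 / 2) * L) * (L * S)) = c / 2 / 2 * S := by
    rw [show D / (c / 2 / 2) * (c / 2 / 2 / (D / (c / 2 / 2) * L) * (L * S)) =
      (D / (c / 2 / 2) * L) * (c / 2 / 2 / (D / (c / 2 / 2) * L)) * S by ring,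
      ENNReal.mul_div_cancel (mul_ne_zero hτ0 hL0) (ENNReal.mul_ne_top hτ hL)]
  rw [h2, div_eq_mul_inv, mul_right_comm, ← div_eq_mul_inv, h1, ← add_mul, ENNReal.add_halves]
  exact ENNReal.mul_lt_mul_left hS0 hS (ENNReal.half_lt_self hc0 hc)

theorem ae_frequently_exists_norm_le (hΓ : IsIntegralSubgroup Γ)
    (he : ∃ z : Fin m ⊕ Fin n → ℤ, e = fun i => (z i : ℝ)) (he0 : e ≠ 0)
    (hm : 0 < m) (hn : 0 < n) {j : Fin n}
    (hj : ∀ x : Matrix.SpecialLinearGroup (Fin m ⊕ Fin n) ℝ ⧸ Γ,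
      ∃ v ∈ cosetVectors Γ e x, v (Sum.inr j) ≠ 0) [IsProbabilityMeasure μ]
    (hμ : ∀ g : Matrix.SpecialLinearGroup (Fin m ⊕ Fin n) ℝ, Measure.map (fun x => g • x) μ = μ)
    {r : ℕ → ℝ} (hr : ∀ t, 0 ≤ r t)
    (hdiv : ∀ k, ∑' t, ENNReal.ofReal (visitRatio m n (r t + k) ^ m) = ⊤) :
    ∀ᵐ x ∂μ, ∃ᶠ t : ℕ in atTop, ∃ v ∈ cosetVectors Γ e x,
      ‖(aFlowStd m n hm hn t).1.mulVec v‖ ≤ Real.exp (-r t) := by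
  set W : Set (Matrix.SpecialLinearGroup (Fin m ⊕ Fin n) ℝ ⧸ Γ) := {x | ∃ᶠ t : ℕ in atTop,
    ∃ v ∈ cosetVectors Γ e x, ‖(aFlowStd m n hm hn t).1.mulVec v‖ ≤ Real.exp (-r t)} with hW
  have hWm : MeasurableSet W := measurableSet_frequently_exists_norm_le hΓ hm hn r
  change μ Wᶜ = 0
  by_contra hY0
  set y := μ Wᶜ with hy
  have hytop : y ≠ ⊤ := measure_ne_top μ _
  have hb0 : y / 2 / 2 ≠ 0 := by simp [hY0]
  have hbtop : y / 2 / 2 ≠ ⊤ :=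
    ENNReal.div_ne_top (ENNReal.div_ne_top hytop two_ne_zero) two_ne_zero
  obtain ⟨k, C, hK⟩ := exists_lt_measure_coreSet hΓ he he0 hj μ (b := μ univ - y / 2 / 2)
    (ENNReal.sub_lt_self (measure_ne_top μ _) (by simp) hb0)
  have hcore : μ (coreSet Γ e j k C)ᶜ ≤ y / 2 / 2 := by
    rw [measure_compl (measurableSet_coreSet hΓ j k C) (measure_ne_top μ _)]
    exact tsub_le_iff_tsub_le.1 hK.le
  set c := ENNReal.ofReal (Real.exp (-(2 * k)) ^ m) * (y / 2 / 2) with hc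
  have hc0 : c ≠ 0 := mul_ne_zero (by simp [Real.exp_pos]) hb0
  have hctop : c ≠ ⊤ := ENNReal.mul_ne_top ENNReal.ofReal_ne_top hbtop
  set D : ℝ≥0∞ := C * C * ENNReal.ofReal (48 ^ m) + 1 with hD
  obtain ⟨η, τ, hη0, hτ0, hτ, hlt⟩ := ENNReal.exists_forall_add_lt_mul hc0 hctop (D := D)
    (by rw [hD]; finiteness) (by simp [hD]) (L := ENNReal.ofReal (4 ^ m)) (by simp) (by simp)
  have hs : Tendsto (fun i : ℕ => 1 / ((i : ℝ) + 1)) atTop (𝓝[>] 0) :=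
    tendsto_nhdsWithin_iff.2 ⟨tendsto_one_div_add_atTop_nhds_zero_nat,
      Eventually.of_forall fun i => mem_Ioi.2 Nat.one_div_pos_of_nat⟩
  have hesc := tendsto_measure_escapingSet hΓ hμ (continuous_uShear (m := m) j) (uShear_add j)
    hWm.compl hη0 hs
  obtain ⟨i, hi⟩ := (hesc.eventually (gt_mem_nhds (pos_iff_ne_zero.2
    (show y / 2 ≠ 0 by simp [hY0])))).exists
  set s : ℝ := 1 / ((i : ℝ) + 1) / 2 with hsdef
  have hs0 : 0 < s := half_pos Nat.one_div_pos_of_nat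
  have h2s : 1 / ((i : ℝ) + 1) = 2 * s := by rw [hsdef]; ring
  rw [h2s] at hi
  have hY'm : y / 2 / 2 + y / 2 / 2 ≤ μ (Wᶜ \ escapingSet (uShear j) Wᶜ η (2 * s)) := by
    rw [ENNReal.add_halves]
    have h1 : y / 2 + y / 2 ≤ y / 2 + μ (Wᶜ \ escapingSet (uShear j) Wᶜ η (2 * s)) := by
      rw [ENNReal.add_halves]
      calc y ≤ μ (Wᶜ ∩ escapingSet (uShear j) Wᶜ η (2 * s)) +
            μ (Wᶜ \ escapingSet (uShear j) Wᶜ η (2 * s)) := measure_le_inter_add_sdiff _ _ _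
        _ ≤ _ := by gcongr
    exact ENNReal.le_of_add_le_add_left (ENNReal.div_ne_top hytop two_ne_zero) h1
  have h := le_of_visitCount hΓ he he0 hm hn hμ hr j (k := k) (Nat.cast_nonneg k) hs0
    (ENNReal.natCast_ne_top C) (hdiv k) hbtop hY'm hcore (η := η) (fun x hx => by
      have h1 := hx.2
      rw [escapingSet, mem_ofPred_eq, not_lt, compl_compl] at h1
      exact h1) hτ0 hτ
  refine (hlt (ENNReal.ofReal (s ^ m)) (by simp [hs0]) ENNReal.ofReal_ne_top).not_ge
    (h.trans ?_)
  rw [mul_pow, mul_pow, ENNReal.ofReal_mul (by positivity), ENNReal.ofReal_mul (by positivity),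
    ← mul_assoc]
  gcongr
  exact le_self_add

end conclusion

end CuspExcursions

/-- Corollary 4.4 of the paper (a dynamical Borel–Cantelli lemma): if
`∑_t μ{Δ ≥ r_t} = ∞` then for `μ`-a.e. `x ∈ X_N` there are infinitely many
`t ∈ ℕ` with `Δ(a(t)x) ≥ r_t`. -/
theorem borel_cantelli_cusp_excursions (m n : ℕ) (hm : 0 < m) (hn : 0 < n)
    (N : ℕ) (hN : 0 < N)
    (μ : Measure (Matrix.SpecialLinearGroup (Fin m ⊕ Fin n) ℝ ⧸
      congruenceSubgroupR (Fin m ⊕ Fin n) N (stdE1Mod m n N)))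
    (hμprob : IsProbabilityMeasure μ)
    (hμinv : ∀ g : Matrix.SpecialLinearGroup (Fin m ⊕ Fin n) ℝ,
      Measure.map (fun x => g • x) μ = μ)
    (r : ℕ → ℝ) (hr : ∀ t, 1 ≤ r t)
    (hdiv : ∑' t : ℕ, μ {x | r t ≤ DeltaCusp m n N x} = ⊤) :
    ∀ᵐ x ∂μ, {t : ℕ | r t ≤ DeltaCusp m n N (aFlowStd m n hm hn t • x)}.Infinite := by
  have h := ae_frequently_exists_norm_le (μ := μ)
    (isIntegralSubgroup_congruenceSubgroupR N (stdE1Mod m n N))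
    (exists_int_stdE1 m n) (stdE1_ne_zero hm) hm hn (j := ⟨0, hn⟩)
    (fun x => exists_cuspVectors_apply_ne_zero hm hN x _) hμinv
    (fun t => zero_le_one.trans (hr t)) (tsum_visitRatio_eq_top hm hn hμinv hr hdiv)
  filter_upwards [h] with x hx
  rw [← Nat.frequently_atTop_iff_infinite]
  refine hx.mono fun t ht => ?_
  obtain ⟨v, hv, hvt⟩ := ht
  exact le_DeltaCusp hm ⟨_, mulVec_mem_cosetVectors _ hv, hvt⟩
end

section
/- Let m, n be positive integers. Given x_0 > 0 and a non-increasing continuous function ψ : [x_0,∞) → (0,∞), there exists a unique continuous function r : [t_0,∞) → ℝ, where t_0 = (m/(m+n))·log x_0 − (n/(m+n))·log ψ(x_0), satisfying: (1) λ(t) := t − n·r(t) is strictly increasing on [t_0,∞) and unbounded; (2) L(t) := t + m·r(t) is non-decreasing on [t_0,∞); (3) ψ(e^{t − n·r(t)}) = e^{−t − m·r(t)} for all t ≥ t_0. -/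
open Set

open Filter in
/-- A positive multiple of the identity plus a continuous monotone function that is constant to
the left of some point has a continuous, strictly increasing inverse. -/
theorem exists_orderIso_mul_add {c a : ℝ} (hc : 0 < c) {h : ℝ → ℝ} (hcont : Continuous h)
    (hmono : Monotone h) (hconst : ∀ s ≤ a, h s = h a) :
    ∃ e : ℝ ≃o ℝ, ∀ s, e s = c * s + h s := by
  have hstrict : StrictMono fun s => c * s + h s :=
    (strictMono_mul_left_of_pos hc).add_monotone hmono
  have htop : Tendsto (fun s => c * s + h s) atTop atTop :=
    tendsto_atTop_add_right_of_le' _ (h a) (tendsto_id.const_mul_atTop hc)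
      ((eventually_ge_atTop a).mono fun s hs => hmono hs)
  have hbot : Tendsto (fun s => c * s + h s) atBot atBot :=
    tendsto_atBot_add_right_of_ge' _ (h a) (tendsto_id.const_mul_atBot hc)
      ((eventually_le_atBot a).mono fun s hs => (hconst s hs).le)
  exact ⟨hstrict.orderIsoOfSurjective _
    (((continuous_const.mul continuous_id).add hcont).surjective htop hbot), fun _ => rfl⟩

/-- The forward direction of the Dani change-of-variables lemma
(Lemma 8.3 of Kleinbock–Margulis): a non-increasing continuous
`ψ : [x₀,∞) → (0,∞)` determines a unique continuous `r : [t₀,∞) → ℝ`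
such that `t ↦ t - n r(t)` is strictly increasing and unbounded,
`t ↦ t + m r(t)` is non-decreasing, and `ψ(e^{t - n r(t)}) = e^{-t - m r(t)}`. -/
theorem dani_correspondence_forward (m n : ℕ) (hm : 0 < m) (hn : 0 < n)
    (x₀ : ℝ) (hx₀ : 0 < x₀) (ψ : ℝ → ℝ)
    (hψpos : ∀ x ∈ Ici x₀, 0 < ψ x)
    (hψanti : AntitoneOn ψ (Ici x₀))
    (hψcont : ContinuousOn ψ (Ici x₀)) :
    ∃ r : ℝ → ℝ,
      (ContinuousOn r (Ici ((m / (m + n) : ℝ) * Real.log x₀ -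
          (n / (m + n) : ℝ) * Real.log (ψ x₀))) ∧
        StrictMonoOn (fun t => t - n * r t)
          (Ici ((m / (m + n) : ℝ) * Real.log x₀ -
            (n / (m + n) : ℝ) * Real.log (ψ x₀))) ∧
        (∀ C : ℝ, ∃ t, t ∈ Ici ((m / (m + n) : ℝ) * Real.log x₀ -
            (n / (m + n) : ℝ) * Real.log (ψ x₀)) ∧ C < t - n * r t) ∧
        MonotoneOn (fun t => t + m * r t)
          (Ici ((m / (m + n) : ℝ) * Real.log x₀ -
            (n / (m + n) : ℝ) * Real.log (ψ x₀))) ∧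
        (∀ t ∈ Ici ((m / (m + n) : ℝ) * Real.log x₀ -
            (n / (m + n) : ℝ) * Real.log (ψ x₀)),
          ψ (Real.exp (t - n * r t)) = Real.exp (-t - m * r t))) ∧
      ∀ r' : ℝ → ℝ,
        (ContinuousOn r' (Ici ((m / (m + n) : ℝ) * Real.log x₀ -
            (n / (m + n) : ℝ) * Real.log (ψ x₀))) ∧
          StrictMonoOn (fun t => t - n * r' t)
            (Ici ((m / (m + n) : ℝ) * Real.log x₀ -
              (n / (m + n) : ℝ) * Real.log (ψ x₀))) ∧
          (∀ C : ℝ, ∃ t, t ∈ Ici ((m / (m + n) : ℝ) * Real.log x₀ -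
              (n / (m + n) : ℝ) * Real.log (ψ x₀)) ∧ C < t - n * r' t) ∧
          MonotoneOn (fun t => t + m * r' t)
            (Ici ((m / (m + n) : ℝ) * Real.log x₀ -
              (n / (m + n) : ℝ) * Real.log (ψ x₀))) ∧
          (∀ t ∈ Ici ((m / (m + n) : ℝ) * Real.log x₀ -
              (n / (m + n) : ℝ) * Real.log (ψ x₀)),
            ψ (Real.exp (t - n * r' t)) = Real.exp (-t - m * r' t))) →
        EqOn r r' (Ici ((m / (m + n) : ℝ) * Real.log x₀ -
          (n / (m + n) : ℝ) * Real.log (ψ x₀))) := by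
  have hm' : (0 : ℝ) < m := by exact_mod_cast hm
  have hn' : (0 : ℝ) < n := by exact_mod_cast hn
  have hmn : (0 : ℝ) < m + n := by positivity
  obtain ⟨a, ha⟩ : ∃ a, a = Real.log x₀ := ⟨_, rfl⟩
  have hexp_mem {s : ℝ} (hs : a ≤ s) : Real.exp s ∈ Ici x₀ :=
    (Real.log_le_iff_le_exp hx₀).1 (ha ▸ hs)
  have hexp_a : Real.exp a = x₀ := by rw [ha, Real.exp_log hx₀]
  -- `ψ` in logarithmic coordinates, extended to the left of `log x₀` by a constant
  let h : ℝ → ℝ := fun s => -Real.log (ψ (Real.exp (max s a)))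
  have hmem (s : ℝ) : Real.exp (max s a) ∈ Ici x₀ := hexp_mem (le_max_right s a)
  have hcont : Continuous h := by
    refine (Continuous.log ?_ fun s => (hψpos _ (hmem s)).ne').neg
    exact hψcont.comp_continuous (by fun_prop) hmem
  have hmono : Monotone h := fun s u hsu =>
    neg_le_neg (Real.log_le_log (hψpos _ (hmem u)) (hψanti (hmem s) (hmem u)
      (Real.exp_le_exp.2 (max_le_max_right a hsu))))
  have hof_le {s : ℝ} (hs : a ≤ s) : h s = -Real.log (ψ (Real.exp s)) := by
    simp only [h, max_eq_left hs]
  obtain ⟨e, he⟩ := exists_orderIso_mul_add (a := a) (div_pos hm' hmn)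
    (hcont.const_mul (n / (m + n) : ℝ)) (hmono.const_mul (by positivity))
    (fun s hs => by simp only [h, max_eq_right hs, max_self])
  have he_mul (s : ℝ) : (m + n) * e s = m * s + n * h s := by
    rw [he]; field_simp
  obtain ⟨t₀, ht₀⟩ : ∃ t₀, t₀ = (m / (m + n) : ℝ) * Real.log x₀ -
    (n / (m + n) : ℝ) * Real.log (ψ x₀) := ⟨_, rfl⟩
  have he_a : e a = t₀ := by
    rw [he, hof_le le_rfl, hexp_a, ht₀, ha]; ring
  rw [← ht₀]
  have hsymm_ge {t : ℝ} (ht : t ∈ Ici t₀) : a ≤ e.symm t := by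
    rw [e.le_symm_apply, he_a]; exact ht
  let r : ℝ → ℝ := fun t => (t - e.symm t) / n
  have hlam (t : ℝ) : t - n * r t = e.symm t := by
    simp only [r]; field_simp; ring
  have hL (t : ℝ) : t + m * r t = h (e.symm t) := by
    have := he_mul (e.symm t)
    rw [e.apply_symm_apply] at this
    simp only [r]
    field_simp
    linarith
  refine ⟨r, ⟨?_, ?_, ?_, ?_, ?_⟩, ?_⟩
  · exact ((continuous_id.sub e.symm.continuous).div_const _).continuousOn
  · simp only [hlam]
    exact e.symm.strictMono.strictMonoOn _
  · intro C
    have hC : max C a < max C a + 1 := lt_add_one _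
    refine ⟨e (max C a + 1), ?_, ?_⟩
    · rw [mem_Ici, ← he_a]
      exact e.monotone ((le_max_right C a).trans hC.le)
    · rw [hlam, e.symm_apply_apply]
      exact (le_max_left C a).trans_lt hC
  · simp only [hL]
    exact (hmono.comp e.symm.monotone).monotoneOn _
  · intro t ht
    rw [← neg_add', hL, hlam, hof_le (hsymm_ge ht), neg_neg,
      Real.exp_log (hψpos _ (hexp_mem (hsymm_ge ht)))]
  · rintro r' ⟨hr'cont, hr'strict, hr'unbdd, -, hr'eq⟩
    have heq {t : ℝ} (ht : t ∈ Ici t₀) (hge : a ≤ t - n * r' t) : e (t - n * r' t) = t := by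
      have h1 : h (t - n * r' t) = t + m * r' t := by
        rw [hof_le hge, hr'eq t ht, Real.log_exp]; ring
      have h2 := he_mul (t - n * r' t)
      rw [h1] at h2
      refine mul_left_cancel₀ hmn.ne' (h2.trans ?_)
      ring
    have hstart : a ≤ t₀ - n * r' t₀ := by
      by_contra! hlt
      obtain ⟨u, hu, hau⟩ := hr'unbdd a
      have hcontOn : ContinuousOn (fun t => t - n * r' t) (Icc t₀ u) :=
        (continuousOn_id.sub (hr'cont.const_mul _)).mono Icc_subset_Ici_self
      obtain ⟨v, hv, hva⟩ := intermediate_value_Icc hu hcontOn ⟨hlt.le, hau.le⟩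
      have hv' : v - n * r' v = a := hva
      have : t₀ = v := by rw [← heq hv.1 hv'.ge, hv', he_a]
      rw [this] at hlt
      exact hlt.ne hv'
    intro t ht
    have hge : a ≤ t - n * r' t :=
      hstart.trans (hr'strict.monotoneOn self_mem_Ici ht ht)
    have h3 : t - n * r t = t - n * r' t := by
      rw [hlam, e.symm_apply_eq, heq ht hge]
    exact mul_left_cancel₀ hn'.ne' (sub_right_injective h3)
end

section
/- Let m, n be positive integers, x_0 > 0, and let ψ : [x_0,∞) → (0,∞) be non-increasing and continuous. Let r : [t_0,∞) → ℝ, with t_0 = (m/(m+n))·log x_0 − (n/(m+n))·log ψ(x_0), be the unique continuous function such that t − n·r(t) is strictly increasing and unbounded, t + m·r(t) is non-decreasing, and ψ(e^{t − n·r(t)}) = e^{−t − m·r(t)} for all t ≥ t_0. Then ∫_{x_0}^∞ ψ(x) dx < ∞ if and only if ∫_{t_0}^∞ e^{−(m+n)·r(t)} dt < ∞. -/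
open Set MeasureTheory

open Filter Topology Asymptotics

/-- If the partial derivative of `P` in the second variable vanishes at `(t, r t)`, then
`s ↦ P (s, r s)` is differentiable at `t` as soon as `r` is Lipschitz at `t`. -/
theorem hasDerivWithinAt_comp_graph_of_partial_eq_zero {P : ℝ × ℝ → ℝ} {r : ℝ → ℝ} {S : Set ℝ}
    {t e : ℝ} (hP : HasFDerivAt P (e • ContinuousLinearMap.fst ℝ ℝ ℝ) (t, r t))
    (hrcont : ContinuousWithinAt r S t) (hr : ∀ s ∈ S, |r s - r t| ≤ |s - t|) :
    HasDerivWithinAt (fun s => P (s, r s)) e S t := by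
  rw [hasDerivWithinAt_iff_isLittleO]
  have htend : Tendsto (fun s => (s, r s)) (𝓝[S] t) (𝓝 (t, r t)) :=
    (continuousWithinAt_id (x := t) (s := S)).prodMk hrcont
  have hbig : (fun s => (s, r s) - (t, r t)) =O[𝓝[S] t] fun s => s - t := by
    refine IsBigO.of_bound 1 ?_
    filter_upwards [self_mem_nhdsWithin] with s hs
    simpa [Prod.norm_def, Real.norm_eq_abs] using hr s hs
  refine ((hP.isLittleO.comp_tendsto htend).trans_isBigO hbig).congr_left fun s => ?_
  simp [mul_comm]

/-- The change of variables `x = exp (t - n r t)`, with the term in `dr` integrated explicitly. -/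
theorem integral_exp_change_of_variables {m n T : ℝ} (hmn : m + n ≠ 0) {φ r : ℝ → ℝ}
    (hφ : Continuous φ) (hr : Continuous r)
    (hlip : ∀ s ∈ Ici T, ∀ t ∈ Ici T, |r s - r t| ≤ |s - t|)
    (heq : ∀ t ∈ Ici T, φ (Real.exp (t - n * r t)) = Real.exp (-t - m * r t))
    {b : ℝ} (hb : T ≤ b) :
    ∫ x in Real.exp (T - n * r T)..Real.exp (b - n * r b), φ x =
      (∫ t in T..b, Real.exp (-((m + n) * r t))) +
        n / (m + n) * (Real.exp (-((m + n) * r b)) - Real.exp (-((m + n) * r T))) := by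
  set X := Real.exp (T - n * r T) with hX
  have hE : Continuous fun t => Real.exp (-((m + n) * r t)) := by fun_prop
  have hprim : Continuous fun y => ∫ x in X..y, φ x :=
    intervalIntegral.continuous_primitive (fun _ _ => hφ.intervalIntegrable _ _) _
  have hprimE : Continuous fun y => ∫ t in T..y, Real.exp (-((m + n) * r t)) :=
    intervalIntegral.continuous_primitive (fun _ _ => hE.intervalIntegrable _ _) _
  have key := constant_of_has_deriv_right_zero
    (f := fun t => ((∫ x in X..Real.exp (t - n * r t), φ x) -
      n / (m + n) * Real.exp (-((m + n) * r t))) - ∫ s in T..t, Real.exp (-((m + n) * r s)))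
    (a := T) (b := b) ?_ ?_ b ⟨hb, le_rfl⟩
  · simp only [← hX, intervalIntegral.integral_same] at key
    linarith
  · have := hprim.comp (f := fun t => Real.exp (t - n * r t)) (by fun_prop)
    exact ((this.sub (continuous_const.mul hE)).sub hprimE).continuousOn
  · intro t ht
    have hG := (hE.integral_hasStrictDerivAt T t).hasDerivAt.hasDerivWithinAt (s := Ici t)
    have hfst : HasFDerivAt (fun p : ℝ × ℝ => p.1) (ContinuousLinearMap.fst ℝ ℝ ℝ) (t, r t) :=
      hasFDerivAt_fst
    have hsnd : HasFDerivAt (fun p : ℝ × ℝ => p.2) (ContinuousLinearMap.snd ℝ ℝ ℝ) (t, r t) :=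
      hasFDerivAt_snd
    have hu := (hfst.sub (hsnd.const_mul n)).exp
    have hF := (hφ.integral_hasStrictDerivAt X
      (Real.exp (t - n * r t))).hasDerivAt.comp_hasFDerivAt (t, r t) hu
    have hv := ((hsnd.const_mul (m + n)).neg.exp).const_mul (n / (m + n))
    have hE' : Real.exp (-t - m * r t) * Real.exp (t - n * r t)
        = Real.exp (-((m + n) * r t)) := by
      rw [← Real.exp_add]; congr 1; ring
    have hP := hF.sub hv
    have hD := hasDerivWithinAt_comp_graph_of_partial_eq_zero
      (e := Real.exp (-((m + n) * r t))) (S := Ici t)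
      (hP.congr_fderiv ?_) hr.continuousWithinAt
      (fun s hs => hlip s (ht.1.trans hs) t ht.1)
    · have h := hD.sub hG
      rw [sub_self] at h
      exact h
    · rw [heq t ht.1]
      ext
      · simp [hE']
      · simp only [Pi.sub_apply, Pi.neg_apply, hE', smul_smul]
        simp
        field_simp
        ring

/-- Integrability on a half-line of a continuous function depends only on its tail. -/
theorem integrableOn_Ici_iff_integrableOn_Ioi_tail {f : ℝ → ℝ} {a b : ℝ} (hab : a ≤ b)
    (hf : ContinuousOn f (Ici a)) :
    IntegrableOn f (Ici a) ↔ IntegrableOn f (Ioi b) := by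
  rw [← Icc_union_Ioi_eq_Ici hab, integrableOn_union]
  exact and_iff_right ((hf.mono Icc_subset_Ici_self).integrableOn_Icc)

/-- An integrable exponential of a function with Lipschitz constant `c` is bounded. -/
theorem exp_le_mul_integral_of_lipschitz {g : ℝ → ℝ} {c T : ℝ} (hc : 0 ≤ c)
    (hg : ∀ s ∈ Ici T, ∀ t ∈ Ici T, |g s - g t| ≤ c * |s - t|)
    (hint : IntegrableOn (fun t => Real.exp (g t)) (Ioi T)) {s : ℝ} (hs : T ≤ s) :
    Real.exp (g s) ≤ Real.exp c * ∫ t in Ioi T, Real.exp (g t) := by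
  have hsub : Ioc s (s + 1) ⊆ Ioi T := fun x hx => hs.trans_lt hx.1
  have h1 : ∫ _ in Ioc s (s + 1), Real.exp (g s - c) ≤ ∫ t in Ioc s (s + 1), Real.exp (g t) := by
    refine setIntegral_mono_on (by simp) (hint.mono_set hsub) measurableSet_Ioc fun t ht => ?_
    have h := hg s hs t (hs.trans ht.1.le)
    have h2 : |s - t| ≤ 1 := abs_le.2 ⟨by linarith [ht.2], by linarith [ht.1]⟩
    have h3 := le_abs_self (g s - g t)
    gcongr
    nlinarith
  have h2 : ∫ t in Ioc s (s + 1), Real.exp (g t) ≤ ∫ t in Ioi T, Real.exp (g t) :=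
    setIntegral_mono_set hint (ae_of_all _ fun _ => (Real.exp_pos _).le) hsub.eventuallyLE
  simp only [setIntegral_const, measureReal_def, Real.volume_Ioc, add_sub_cancel_left,
    ENNReal.ofReal_one, ENNReal.toReal_one, one_smul] at h1
  calc Real.exp (g s) = Real.exp c * Real.exp (g s - c) := by
        rw [← Real.exp_add]; congr 1; ring
    _ ≤ _ := by gcongr; exact h1.trans h2

/-- The integrability equivalence in the Dani change-of-variables lemma:
with `r` the function associated to `ψ`, one has
`∫_{x₀}^∞ ψ(x) dx < ∞` if and only if `∫_{t₀}^∞ e^{-(m+n) r(t)} dt < ∞`. -/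
theorem dani_correspondence_integrability (m n : ℕ) (hm : 0 < m) (hn : 0 < n)
    (x₀ : ℝ) (hx₀ : 0 < x₀) (ψ : ℝ → ℝ)
    (hψpos : ∀ x ∈ Ici x₀, 0 < ψ x)
    (hψanti : AntitoneOn ψ (Ici x₀))
    (hψcont : ContinuousOn ψ (Ici x₀))
    (t₀ : ℝ)
    (ht₀ : t₀ = (m / (m + n) : ℝ) * Real.log x₀ - (n / (m + n) : ℝ) * Real.log (ψ x₀))
    (r : ℝ → ℝ) (hrcont : ContinuousOn r (Ici t₀))
    (hlamMono : StrictMonoOn (fun t => t - n * r t) (Ici t₀))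
    (hlamUnbdd : ∀ C : ℝ, ∃ t, t ∈ Ici t₀ ∧ C < t - n * r t)
    (hLmono : MonotoneOn (fun t => t + m * r t) (Ici t₀))
    (heq : ∀ t ∈ Ici t₀, ψ (Real.exp (t - n * r t)) = Real.exp (-t - m * r t)) :
    IntegrableOn ψ (Ici x₀) volume ↔
      IntegrableOn (fun t => Real.exp (-((m + n : ℝ) * r t))) (Ici t₀) volume := by
  have hm1 : (1 : ℝ) ≤ m := by exact_mod_cast hm
  have hn1 : (1 : ℝ) ≤ n := by exact_mod_cast hn
  have hlip : ∀ s ∈ Ici t₀, ∀ t ∈ Ici t₀, |r s - r t| ≤ |s - t| := by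
    have aux : ∀ s ∈ Ici t₀, ∀ t ∈ Ici t₀, s ≤ t → |r s - r t| ≤ |s - t| := by
      intro s hs t ht hst
      have h1 := hlamMono.monotoneOn hs ht hst
      have h2 := hLmono hs ht hst
      simp only at h1 h2
      rw [abs_sub_comm s t, abs_of_nonneg (sub_nonneg.2 hst), abs_le]
      constructor <;> nlinarith
    intro s hs t ht
    rcases le_total s t with h | h
    · exact aux s hs t ht h
    · rw [abs_sub_comm, abs_sub_comm s t]
      exact aux t ht s hs h
  obtain ⟨T, hT, hlamT⟩ := hlamUnbdd (Real.log x₀)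
  have hsub : Ici T ⊆ Ici t₀ := Ici_subset_Ici.2 hT
  have hlam_ge : ∀ t ∈ Ici T, x₀ ≤ Real.exp (t - n * r t) := fun t ht =>
    (Real.log_le_iff_le_exp hx₀).1
      (hlamT.le.trans (hlamMono.monotoneOn hT (hsub ht) ht))
  set ψ' : ℝ → ℝ := fun x => ψ (max x₀ x) with hψ'
  set r' : ℝ → ℝ := fun t => r (max t₀ t) with hr'
  have hψ'c : Continuous ψ' :=
    hψcont.comp_continuous (by fun_prop) fun x => mem_Ici.2 (le_max_left _ _)
  have hr'c : Continuous r' :=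
    hrcont.comp_continuous (by fun_prop) fun x => mem_Ici.2 (le_max_left _ _)
  have hψ'eq : ∀ x, x₀ ≤ x → ψ' x = ψ x := fun x hx => by simp only [hψ', max_eq_right hx]
  have hr'eq : ∀ t, t₀ ≤ t → r' t = r t := fun t ht => by simp only [hr', max_eq_right ht]
  have hr'eqT : ∀ t ∈ Ici T, r' t = r t := fun t ht => hr'eq t (hsub ht)
  have hψ'pos : ∀ x, 0 < ψ' x := fun x => hψpos _ (mem_Ici.2 (le_max_left _ _))
  have hlip' : ∀ s ∈ Ici T, ∀ t ∈ Ici T, |r' s - r' t| ≤ |s - t| := fun s hs t ht => by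
    rw [hr'eqT s hs, hr'eqT t ht]
    exact hlip s (hsub hs) t (hsub ht)
  have heq' : ∀ t ∈ Ici T, ψ' (Real.exp (t - n * r' t)) = Real.exp (-t - m * r' t) :=
    fun t ht => by
      rw [hr'eqT t ht, hψ'eq _ (hlam_ge t ht), heq t (hsub ht)]
  have hid := fun {b : ℝ} (hb : T ≤ b) =>
    integral_exp_change_of_variables (by positivity : (m + n : ℝ) ≠ 0) hψ'c hr'c hlip' heq' hb
  set X := Real.exp (T - n * r' T) with hX
  have hx₀X : x₀ ≤ X := by
    rw [hX, hr'eqT T self_mem_Ici]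
    exact hlam_ge T self_mem_Ici
  have hEc : Continuous fun t => Real.exp (-((m + n : ℝ) * r' t)) := by fun_prop
  have htop : Tendsto (fun t => Real.exp (t - n * r' t)) atTop atTop := by
    refine Real.tendsto_exp_atTop.comp (tendsto_atTop.2 fun C => ?_)
    obtain ⟨t, ht, hCt⟩ := hlamUnbdd C
    filter_upwards [eventually_ge_atTop t] with s hs
    have hs' : s ∈ Ici t₀ := Ici_subset_Ici.2 ht hs
    rw [hr'eq s hs']
    exact hCt.le.trans (hlamMono.monotoneOn ht hs' hs)
  have hψtail : IntegrableOn ψ (Ici x₀) ↔ IntegrableOn ψ' (Ioi X) := by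
    rw [← integrableOn_Ici_iff_integrableOn_Ioi_tail hx₀X hψ'c.continuousOn]
    exact integrableOn_congr_fun (fun x hx => (hψ'eq x hx).symm) measurableSet_Ici
  have hrtail : IntegrableOn (fun t => Real.exp (-((m + n : ℝ) * r t))) (Ici t₀) ↔
      IntegrableOn (fun t => Real.exp (-((m + n : ℝ) * r' t))) (Ioi T) := by
    rw [← integrableOn_Ici_iff_integrableOn_Ioi_tail hT hEc.continuousOn]
    exact integrableOn_congr_fun (fun t ht => by simp only [hr'eq t ht]) measurableSet_Ici
  rw [hψtail, hrtail]
  have hET : 0 ≤ (n / (m + n) : ℝ) * Real.exp (-((m + n : ℝ) * r' T)) := by positivity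
  constructor
  · intro h
    refine integrableOn_Ioi_of_intervalIntegral_norm_bounded
      ((∫ x in Ioi X, ψ' x) + (n / (m + n) : ℝ) * Real.exp (-((m + n : ℝ) * r' T))) T
      (fun b => (hEc.integrableOn_Icc (a := T) (b := b)).mono_set Ioc_subset_Icc_self)
      tendsto_id ?_
    filter_upwards [eventually_ge_atTop T, htop.eventually_ge_atTop X] with b hb hbX
    simp only [Real.norm_eq_abs, Real.abs_exp]
    have h1 : ∫ x in X..Real.exp (b - n * r' b), ψ' x ≤ ∫ x in Ioi X, ψ' x := by
      rw [intervalIntegral.integral_of_le hbX]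
      exact setIntegral_mono_set h (ae_of_all _ fun x => (hψ'pos x).le)
        Ioc_subset_Ioi_self.eventuallyLE
    have h2 : 0 ≤ (n / (m + n) : ℝ) * Real.exp (-((m + n : ℝ) * r' b)) := by positivity
    linarith [hid hb]
  · intro h
    refine integrableOn_Ioi_of_intervalIntegral_norm_bounded
      ((∫ t in Ioi T, Real.exp (-((m + n : ℝ) * r' t))) + (n / (m + n) : ℝ) *
        (Real.exp (m + n) * ∫ t in Ioi T, Real.exp (-((m + n : ℝ) * r' t)))) X
      (fun b => (hψ'c.integrableOn_Icc (a := X)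
        (b := Real.exp (b - n * r' b))).mono_set Ioc_subset_Icc_self) htop ?_
    filter_upwards [eventually_ge_atTop T] with b hb
    simp only [Real.norm_eq_abs, abs_of_pos (hψ'pos _)]
    have h1 : ∫ t in T..b, Real.exp (-((m + n : ℝ) * r' t)) ≤
        ∫ t in Ioi T, Real.exp (-((m + n : ℝ) * r' t)) := by
      rw [intervalIntegral.integral_of_le hb]
      exact setIntegral_mono_set h (ae_of_all _ fun x => (Real.exp_pos _).le)
        Ioc_subset_Ioi_self.eventuallyLE
    have h2 := exp_le_mul_integral_of_lipschitz (by positivity : (0 : ℝ) ≤ m + n)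
      (fun s hs t ht => by
        rw [← neg_sub', abs_neg, ← mul_sub, abs_mul,
          abs_of_nonneg (a := (m + n : ℝ)) (by positivity)]
        exact mul_le_mul_of_nonneg_left (hlip' s hs t ht) (by positivity)) h hb
    have h3 : (n / (m + n) : ℝ) * Real.exp (-((m + n : ℝ) * r' b)) ≤ (n / (m + n) : ℝ) *
        (Real.exp (m + n) * ∫ t in Ioi T, Real.exp (-((m + n : ℝ) * r' t))) := by gcongr
    linarith [hid hb]
end
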